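/- Let $G$ be a polycyclic-by-finite group and let $P$ be a nonzero finitely generated projective $\mathbb{Z}G$-module. Then $P$ is a generator of the category of $\mathbb{Z}G$-modules; that is, the trace ideal of $P$ equals $\mathbb{Z}G$, equivalently there exist $k$ and a surjective $\mathbb{Z}G$-linear map $P^k \to \mathbb{Z}G$. -/

import Mathlib

/-- A group is polycyclic if it has a subnormal series with cyclic factors. -/
def IsPolycyclic (G : Type*) [Group G] : Prop :=
  ∃ (n : ℕ) (s : Fin (n + 1) → Subgroup G),
    s 0 = ⊥ ∧ s (Fin.last n) = ⊤ ∧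
    ∀ i : Fin n, s i.castSucc ≤ s i.succ ∧
      ∃ _ : ((s i.castSucc).subgroupOf (s i.succ)).Normal,
        IsCyclic ((s i.succ) ⧸ (s i.castSucc).subgroupOf (s i.succ))

/-- A group is polycyclic-by-finite if it has a normal polycyclic subgroup of
finite index. -/
def IsPolycyclicByFinite (G : Type*) [Group G] : Prop :=
  ∃ N : Subgroup G, N.Normal ∧ N.FiniteIndex ∧ IsPolycyclic N

/-- The trace ideal of a module `P` over a ring `R`: the sum of the images of
all `R`-linear maps `P → R`. -/
def traceIdeal (R : Type*) [Ring R] (P : Type*) [AddCommGroup P] [Module R P] :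
    Ideal R :=
  ⨆ f : P →ₗ[R] R, LinearMap.range f

theorem Equiv.Perm.dvd_card_of_pow_apply_ne {β : Type*} [Fintype β] {p s : ℕ}
    (hp : p.Prime) (ψ : Equiv.Perm β) (h1 : ψ ^ p ^ (s + 1) = 1)
    (h2 : ∀ a, (ψ ^ p ^ s) a ≠ a) : p ^ (s + 1) ∣ Fintype.card β := by
  classical
  have hs : ψ.support = Finset.univ := by
    ext a
    simp only [Equiv.Perm.mem_support, Finset.mem_univ, iff_true]
    intro h
    exact h2 a (Equiv.Perm.pow_apply_eq_self_of_apply_eq_self h _)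
  rw [← Finset.card_univ, ← hs, ← Equiv.Perm.sum_cycleType]
  apply Multiset.dvd_sum
  intro n hn
  have hn' : n ∣ p ^ (s + 1) := by
    have := Equiv.Perm.dvd_of_mem_cycleType hn
    exact this.trans (orderOf_dvd_of_pow_eq_one h1)
  rw [Equiv.Perm.cycleType_def] at hn
  simp only [Multiset.mem_map, Function.comp] at hn
  obtain ⟨c, hc, rfl⟩ := hn
  have hc' : c ∈ ψ.cycleFactorsFinset := hc
  rw [Equiv.Perm.mem_cycleFactorsFinset_iff] at hc'
  obtain ⟨hcyc, hceq⟩ := hc'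
  obtain ⟨a, ha⟩ := hcyc.nonempty_support
  have key : ∀ k : ℕ, (ψ ^ k) a = (c ^ k) a := by
    intro k
    induction k with
    | zero => rfl
    | succ k ih =>
      rw [pow_succ', pow_succ', Equiv.Perm.mul_apply, Equiv.Perm.mul_apply, ih]
      refine (hceq _ ?_).symm
      exact Equiv.Perm.pow_apply_mem_support.mpr ha
  obtain ⟨k, hk, hk'⟩ := (Nat.dvd_prime_pow hp).mp hn'
  rcases Nat.lt_or_ge k (s + 1) with h | h
  · exfalso
    apply h2 a
    rw [key]
    have : c ^ p ^ s = 1 := by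
      rw [← orderOf_dvd_iff_pow_eq_one, hcyc.orderOf, hk']
      exact pow_dvd_pow p (by omega)
    rw [this]; rfl
  · have : k = s + 1 := by omega
    rw [hk', this]

theorem Equiv.Perm.dvd_sum_of_pow_apply_ne {α : Type*} [Fintype α] {p s : ℕ}
    (hp : p.Prime) (ψ : Equiv.Perm α) (h1 : ψ ^ p ^ (s + 1) = 1) (F : α → ℤ)
    (hF : ∀ a, F (ψ a) = F a) (S : Finset α) (hS : ∀ a, a ∈ S ↔ (ψ ^ p ^ s) a ≠ a) :
    (p : ℤ) ^ (s + 1) ∣ ∑ a ∈ S, F a := by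
  classical
  rw [← Finset.sum_fiberwise_of_maps_to (g := F) (t := S.image F)
    (fun x hx => Finset.mem_image_of_mem F hx)]
  apply Finset.dvd_sum
  intro v _
  rw [Finset.sum_congr rfl (g := fun _ => v) (fun a ha => (Finset.mem_filter.mp ha).2)]
  rw [Finset.sum_const, nsmul_eq_mul]
  apply Dvd.dvd.mul_right
  set T := S.filter (fun a => F a = v) with hT
  have hmem : ∀ a, a ∈ T ↔ ψ a ∈ T := by
    intro a
    simp only [hT, Finset.mem_filter, hS, hF]
    have : (ψ ^ p ^ s) (ψ a) = ψ ((ψ ^ p ^ s) a) := by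
      rw [← Equiv.Perm.mul_apply, ← Equiv.Perm.mul_apply, ← pow_succ, ← pow_succ']
    rw [this]
    simp
  have := Equiv.Perm.dvd_card_of_pow_apply_ne (β := {a // a ∈ T}) hp (s := s)
    (ψ.subtypePerm (p := fun a => a ∈ T) (fun a => (hmem a).symm)) ?_ ?_
  · rw [Fintype.card_coe] at this
    exact_mod_cast this
  · rw [Equiv.Perm.subtypePerm_pow]
    ext a
    simp [h1]
  · rintro ⟨a, ha⟩ h
    rw [Equiv.Perm.subtypePerm_pow] at h
    have h' := congrArg Subtype.val h
    simp only [Equiv.Perm.subtypePerm_apply] at h'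
    exact (hS a).mp (Finset.mem_filter.mp ha).1 h'

theorem sum_pow_eq_sum_words {R ι : Type*} [Ring R] [Fintype ι] (y : ι → R) (N : ℕ) :
    (∑ i, y i) ^ N = ∑ w : Fin N → ι, (List.ofFn (fun i => y (w i))).prod := by
  induction N with
  | zero => simp
  | succ N ih =>
    rw [pow_succ', ih, Finset.sum_mul_sum, ← Fintype.sum_prod_type',
      ← (Fin.consEquiv (fun _ => ι)).sum_comp]
    refine Finset.sum_congr rfl fun x _ => ?_
    simp [Fin.consEquiv, List.ofFn_succ]

theorem trace_ofFn_rotate {R : Type*} [Ring R] (τ : R →+ ℤ)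
    (hτ : ∀ a b, τ (a * b) = τ (b * a)) {N : ℕ} (w : Fin N → R) :
    τ (List.ofFn (fun i => w (finRotate N i))).prod = τ (List.ofFn w).prod := by
  cases N with
  | zero => rfl
  | succ n =>
    rw [List.ofFn_succ (f := w), List.prod_cons, hτ, List.ofFn_succ', List.concat_eq_append,
      List.prod_append]
    simp

theorem finRotate_pow_apply {n : ℕ} (k : ℕ) (i : Fin (n + 1)) :
    ((finRotate (n + 1)) ^ k) i = i + Fin.ofNat (n + 1) k := by
  induction k with
  | zero => simp
  | succ k ih =>
    rw [pow_succ', Equiv.Perm.mul_apply, ih, finRotate_apply]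
    ext
    simp [Fin.val_add, add_assoc]

theorem val_finRotate_pow_apply {N : ℕ} (k : ℕ) (i : Fin N) :
    (((finRotate N) ^ k) i : ℕ) = (i + k) % N := by
  cases N with
  | zero => exact i.elim0
  | succ n => rw [finRotate_pow_apply]; simp [Fin.val_add]

theorem List.prod_ofFn_repeat {R : Type*} [Monoid R] {M : ℕ} (p : ℕ) (u : Fin M → R) :
    (List.ofFn (Fin.repeat p u)).prod = (List.ofFn u).prod ^ p := by
  rw [List.ofFn_fin_repeat, List.prod_flatten]
  simp

/-- The words of length `p * M` fixed by rotation by `M` are the `p`-fold repetitions. -/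
theorem comp_finRotate_pow_eq_iff {ι : Type*} {p M : ℕ} (hp : 0 < p)
    (w : Fin (p * M) → ι) :
    (fun i => w (((finRotate (p * M)) ^ M) i)) = w ↔ ∃ u : Fin M → ι, Fin.repeat p u = w := by
  constructor
  · intro h
    rcases Nat.eq_zero_or_pos M with rfl | hM
    · exact ⟨Fin.elim0, by ext i; exact absurd i.2 (by simp)⟩
    have hlt : ∀ i : Fin M, (i : ℕ) < p * M := fun i =>
      lt_of_lt_of_le i.2 (Nat.le_mul_of_pos_left _ hp)
    refine ⟨fun i => w ⟨i, hlt i⟩, ?_⟩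
    have key : ∀ (k r : ℕ) (hk : k * M + r < p * M) (hr : r < p * M),
        w ⟨k * M + r, hk⟩ = w ⟨r, hr⟩ := by
      intro k r
      induction k with
      | zero => intro hk hr; simp
      | succ k ih =>
        intro hk hr
        have hk' : k * M + r < p * M := by
          have : (k + 1) * M = k * M + M := by ring
          omega
        rw [← ih hk' hr]
        conv_rhs => rw [← h]
        congr 1
        ext
        rw [val_finRotate_pow_apply, Nat.mod_eq_of_lt]
        · simp; ring
        · simp only; have : (k + 1) * M = k * M + M := by ring
          omega
    ext i
    have e : (i : ℕ) = (i : ℕ) / M * M + i % M := (Nat.div_add_mod' _ _).symm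
    have := key (i / M) (i % M) (by rw [← e]; exact i.2) ((Nat.mod_lt _ hM).trans_le (Nat.le_mul_of_pos_left _ hp))
    simp only [Fin.repeat_apply]
    refine Eq.trans this.symm ?_
    congr 1
    ext
    exact e.symm
  · rintro ⟨u, rfl⟩
    ext i
    simp only [Fin.repeat_apply]
    congr 1
    ext
    simp only [Fin.coe_modNat, val_finRotate_pow_apply]
    rw [Nat.mod_mul_left_mod]
    simp

theorem dvd_trace_sum_pow {R ι : Type*} [Ring R] [Fintype ι] {p : ℕ} (hp : p.Prime) (s : ℕ)
    (τ τ' : R →+ ℤ) (hτ : ∀ a b, τ (a * b) = τ (b * a)) (U : Submonoid R)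
    (hU : ∀ u ∈ U, τ (u ^ p) = τ' u) (y : ι → R) (hy : ∀ i, y i ∈ U) :
    (p : ℤ) ^ (s + 1) ∣ τ ((∑ i, y i) ^ p ^ (s + 1)) - τ' ((∑ i, y i) ^ p ^ s) := by
  classical
  have hN : p ^ (s + 1) = p * p ^ s := by rw [pow_succ']
  rw [hN, sum_pow_eq_sum_words, sum_pow_eq_sum_words, map_sum, map_sum]
  set M := p ^ s with hM
  let ψ : Equiv.Perm (Fin (p * M) → ι) :=
    Equiv.arrowCongr (finRotate (p * M)).symm (Equiv.refl ι)
  have hψ : ∀ k w, (ψ ^ k) w = fun i => w (((finRotate (p * M)) ^ k) i) := by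
    intro k w
    induction k generalizing w with
    | zero => rfl
    | succ k ih =>
      rw [pow_succ, Equiv.Perm.mul_apply, ih]
      ext i
      rw [pow_succ', Equiv.Perm.mul_apply]
      rfl
  let F : (Fin (p * M) → ι) → ℤ := fun w => τ (List.ofFn (fun i => y (w i))).prod
  have hF : ∀ w, F (ψ w) = F w := fun w =>
    trace_ofFn_rotate τ hτ (fun i => y (w i))
  rw [← Finset.sum_filter_add_sum_filter_not Finset.univ (fun w => (ψ ^ M) w ≠ w)]
  have h1 := Equiv.Perm.dvd_sum_of_pow_apply_ne hp (s := s) ψ (by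
      ext w i
      rw [hψ]
      simp only [Equiv.Perm.coe_one, id]
      congr 1
      ext
      rw [val_finRotate_pow_apply, hN]
      simp [Nat.mod_eq_of_lt i.2]) F hF
      (Finset.univ.filter (fun w => (ψ ^ M) w ≠ w)) (by simp [hM])
  have h2 : ∑ w ∈ Finset.univ.filter (fun w => ¬ (ψ ^ M) w ≠ w), F w =
      ∑ u : Fin M → ι, τ' (List.ofFn (fun i => y (u i))).prod := by
    symm
    refine Finset.sum_bij' (i := fun u _ => Fin.repeat p u) (j := fun w _ => fun i => w ⟨i, lt_of_lt_of_le i.2 (Nat.le_mul_of_pos_left _ hp.pos)⟩) ?_ ?_ ?_ ?_ ?_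
    · intro u _
      simp only [Finset.mem_filter, Finset.mem_univ, true_and, not_not]
      rw [hψ, comp_finRotate_pow_eq_iff hp.pos]
      exact ⟨u, rfl⟩
    · simp
    · intro u _
      ext i
      simp only [Fin.repeat_apply]
      congr 1
      ext; simp [Fin.coe_modNat, Nat.mod_eq_of_lt i.2]
    · intro w hw
      simp only [Finset.mem_filter, Finset.mem_univ, true_and, not_not] at hw
      rw [hψ, comp_finRotate_pow_eq_iff hp.pos] at hw
      obtain ⟨u, rfl⟩ := hw
      congr 1
      ext i
      simp only [Fin.repeat_apply]
      congr 1
      ext; simp [Fin.coe_modNat, Nat.mod_eq_of_lt i.2]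
    · intro u _
      simp only [F]
      have : (fun i => y (Fin.repeat p u i)) = Fin.repeat p (fun i => y (u i)) := rfl
      rw [this, List.prod_ofFn_repeat]
      refine (hU _ ?_).symm
      apply Submonoid.list_prod_mem
      intro x hx
      rw [List.mem_ofFn] at hx
      obtain ⟨i, rfl⟩ := hx
      exact hy _
  rw [← h2]
  simp only [F] at *
  rw [add_sub_cancel_right]
  exact h1

theorem exists_add_nsmul_pow {R : Type*} [Ring R] (y z : R) (m N : ℕ) :
    ∃ z', (y + m • z) ^ N = y ^ N + m • z' := by
  induction N with
  | zero => exact ⟨0, by simp⟩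
  | succ N ih =>
    obtain ⟨z', h⟩ := ih
    refine ⟨y ^ N * z + z' * (y + m • z), ?_⟩
    rw [pow_succ, h, pow_succ, add_mul, mul_add, smul_add, mul_smul_comm, smul_mul_assoc, add_assoc]

theorem AddSubgroup.exists_list_of_mem_closure {R : Type*} [AddCommGroup R] (U : Set R) (m : ℕ)
    (hm : 0 < m) {x : R} (hx : x ∈ AddSubgroup.closure U) :
    ∃ l : List R, (∀ u ∈ l, u ∈ U) ∧ ∃ z, x = l.sum + m • z := by
  induction hx using AddSubgroup.closure_induction with
  | mem x hx => exact ⟨[x], by simpa using hx, 0, by simp⟩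
  | zero => exact ⟨[], by simp, 0, by simp⟩
  | add x y _ _ hx hy =>
    obtain ⟨l, hl, z, rfl⟩ := hx
    obtain ⟨l', hl', z', rfl⟩ := hy
    refine ⟨l ++ l', ?_, z + z', ?_⟩
    · intro u hu
      rcases List.mem_append.mp hu with h | h
      exacts [hl u h, hl' u h]
    · rw [List.sum_append, smul_add]; abel
  | neg x _ hx =>
    obtain ⟨l, hl, z, rfl⟩ := hx
    refine ⟨(List.replicate (m - 1) l).flatten, ?_, - l.sum - z, ?_⟩
    · intro u hu
      rw [List.mem_flatten] at hu
      obtain ⟨l', hl', hu⟩ := hu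
      rw [List.eq_of_mem_replicate hl'] at hu
      exact hl u hu
    · rw [List.sum_flatten, List.map_replicate, List.sum_replicate]
      obtain ⟨k, rfl⟩ := Nat.exists_eq_succ_of_ne_zero hm.ne'
      simp only [Nat.succ_eq_add_one, Nat.add_sub_cancel, add_smul, one_smul, smul_sub, smul_neg]
      abel

theorem dvd_trace_pow_sub {R : Type*} [Ring R] {p : ℕ} (hp : p.Prime) (s : ℕ)
    (τ τ' : R →+ ℤ) (hτ : ∀ a b, τ (a * b) = τ (b * a)) (U : Submonoid R)
    (hU : ∀ u ∈ U, τ (u ^ p) = τ' u) {x : R} (hx : x ∈ AddSubgroup.closure (U : Set R)) :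
    (p : ℤ) ^ (s + 1) ∣ τ (x ^ p ^ (s + 1)) - τ' (x ^ p ^ s) := by
  obtain ⟨l, hl, z, rfl⟩ := AddSubgroup.exists_list_of_mem_closure _ (p ^ (s + 1))
    (pow_pos hp.pos _) hx
  obtain ⟨z1, h1⟩ := exists_add_nsmul_pow l.sum z (p ^ (s + 1)) (p ^ (s + 1))
  obtain ⟨z2, h2⟩ := exists_add_nsmul_pow l.sum z (p ^ (s + 1)) (p ^ s)
  rw [h1, h2, map_add, map_add, map_nsmul, map_nsmul]
  have h3 := dvd_trace_sum_pow hp s τ τ' hτ U hU (fun i : Fin l.length => l[i]) (fun i => hl _ (by simp))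
  have h4 : ∑ i : Fin l.length, l[i] = l.sum := Fin.sum_univ_getElem l
  rw [h4] at h3
  have : ∀ a b c d : ℤ, (a + p ^ (s + 1) * b) - (c + p ^ (s + 1) * d) =
    (a - c) + p ^ (s + 1) * (b - d) := by intros; ring
  simp only [nsmul_eq_mul, Nat.cast_pow]
  rw [this]
  exact dvd_add h3 (dvd_mul_right _ _)

/-- The `ℤ`-linear extension of a function `c` on a monoid, applied to the trace of a matrix. -/
noncomputable def matTr {n W : Type*} [Fintype n] (c : W → ℤ) :
    Matrix n n (MonoidAlgebra ℤ W) →+ ℤ :=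
  (MonoidAlgebra.liftNC (AddMonoidHom.id ℤ) c).comp (Matrix.traceAddMonoidHom n _)

section
variable {n W : Type*} [Fintype n]

theorem matTr_apply (c : W → ℤ) (x : Matrix n n (MonoidAlgebra ℤ W)) :
    matTr c x = ∑ i, MonoidAlgebra.liftNC (AddMonoidHom.id ℤ) c (x i i) := by
  simp [matTr, Matrix.trace]

theorem MonoidAlgebra.liftNC_mul_comm_of_class [Monoid W] {c : W → ℤ}
    (hc : ∀ a b, c (a * b) = c (b * a)) (x y : MonoidAlgebra ℤ W) :
    MonoidAlgebra.liftNC (AddMonoidHom.id ℤ) c (x * y) =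
      MonoidAlgebra.liftNC (AddMonoidHom.id ℤ) c (y * x) := by
  induction x using MonoidAlgebra.induction_linear with
  | zero => simp
  | add f g hf hg => rw [add_mul, mul_add, map_add, map_add, hf, hg]
  | single a r =>
    induction y using MonoidAlgebra.induction_linear with
    | zero => simp
    | add f g hf hg => rw [add_mul, mul_add, map_add, map_add, hf, hg]
    | single b s =>
      simp only [MonoidAlgebra.single_mul_single, MonoidAlgebra.liftNC_single, hc a b, mul_comm r s]

theorem matTr_mul_comm [Monoid W] {c : W → ℤ} (hc : ∀ a b, c (a * b) = c (b * a))
    (x y : Matrix n n (MonoidAlgebra ℤ W)) : matTr c (x * y) = matTr c (y * x) := by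
  simp only [matTr_apply, Matrix.mul_apply, map_sum]
  rw [Finset.sum_comm]
  simp only [MonoidAlgebra.liftNC_mul_comm_of_class hc (x _ _)]

theorem pow_class [Monoid W] {c : W → ℤ} (hc : ∀ a b, c (a * b) = c (b * a)) (k : ℕ) (a b : W) :
    c ((a * b) ^ k) = c ((b * a) ^ k) := by
  cases k with
  | zero => simp
  | succ k =>
    have : ∀ k : ℕ, (a * b) ^ (k + 1) = a * ((b * a) ^ k * b) := by
      intro k
      induction k with
      | zero => simp
      | succ k ih => rw [pow_succ', ih, pow_succ']; simp only [mul_assoc]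
    rw [this, hc, pow_succ, mul_assoc]

theorem matTr_congr_mul_add (c c' δ : W → ℤ) (q : ℤ) (h : ∀ w, c w = c' w + q * δ w)
    (x : Matrix n n (MonoidAlgebra ℤ W)) : matTr c x = matTr c' x + q * matTr δ x := by
  simp only [matTr_apply]
  rw [Finset.mul_sum, ← Finset.sum_add_distrib]
  refine Finset.sum_congr rfl fun i _ => ?_
  induction x i i using MonoidAlgebra.induction_linear with
  | zero => simp
  | add f g hf hg => rw [map_add, map_add, map_add, hf, hg]; ring
  | single a r => simp only [MonoidAlgebra.liftNC_single, h, AddMonoidHom.id_apply]; ring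

theorem dvd_matTr_pow_sub [Monoid W] [DecidableEq n] {p : ℕ} (hp : p.Prime) {c : W → ℤ}
    (hc : ∀ a b, c (a * b) = c (b * a)) (x : Matrix n n (MonoidAlgebra ℤ W)) (s : ℕ) :
    (p : ℤ) ^ (s + 1) ∣
      matTr c (x ^ p ^ (s + 1)) - matTr (fun w => c (w ^ p)) (x ^ p ^ s) := by
  let U : Submonoid (Matrix n n (MonoidAlgebra ℤ W)) :=
    { carrier := {u | u = 0 ∨ u = 1 ∨
        ∃ i j w, u = Matrix.single i j (MonoidAlgebra.single w (1 : ℤ))}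
      one_mem' := Or.inr (Or.inl rfl)
      mul_mem' := by
        rintro a b (rfl | rfl | ⟨i, j, w, rfl⟩) (rfl | rfl | ⟨i', j', w', rfl⟩)
        · simp
        · simp
        · simp
        · simp
        · simp
        · rw [one_mul]; exact Or.inr (Or.inr ⟨i', j', w', rfl⟩)
        · simp
        · rw [mul_one]; exact Or.inr (Or.inr ⟨i, j, w, rfl⟩)
        by_cases h : j = i'
        · subst h
          right; right
          refine ⟨i, j', w * w', ?_⟩
          rw [Matrix.single_mul_single_same, MonoidAlgebra.single_mul_single, mul_one]
        · left
          rw [Matrix.single_mul_single_of_ne _ _ _ _ h] }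
  refine dvd_trace_pow_sub hp s _ _ (matTr_mul_comm hc) U ?_ ?_
  · rintro u (rfl | rfl | ⟨i, j, w, rfl⟩)
    · simp [hp.ne_zero]
    · rw [one_pow, matTr_apply, matTr_apply]
      simp [MonoidAlgebra.one_def, MonoidAlgebra.liftNC_single]
    · obtain ⟨q, rfl⟩ := Nat.exists_eq_add_of_le' hp.two_le
      by_cases h : i = j
      · subst h
        have : ∀ k : ℕ, (Matrix.single i i (MonoidAlgebra.single w (1 : ℤ))) ^ (k + 1) =
            Matrix.single i i (MonoidAlgebra.single (w ^ (k + 1)) (1 : ℤ)) := by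
          intro k
          induction k with
          | zero => simp
          | succ k ih =>
            rw [pow_succ, ih, Matrix.single_mul_single_same, MonoidAlgebra.single_mul_single,
              mul_one, ← pow_succ]
        rw [this (q + 1), matTr_apply, matTr_apply]
        refine Finset.sum_congr rfl fun k _ => ?_
        by_cases hk : i = k
        · subst hk
          simp [MonoidAlgebra.liftNC_single]
        · simp [Matrix.single_apply_of_ne, hk]
      · rw [pow_add, pow_two, Matrix.single_mul_single_of_ne _ _ _ _ (Ne.symm h), mul_zero,
          map_zero, matTr_apply]
        symm
        refine Finset.sum_eq_zero fun k _ => ?_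
        rw [Matrix.single_apply_of_ne _ _ _ _ _ (by rintro ⟨rfl, rfl⟩; exact h rfl), map_zero]
  · rw [Matrix.matrix_eq_sum_single x]
    refine sum_mem fun i _ => sum_mem fun j _ => ?_
    induction x i j using MonoidAlgebra.induction_linear with
    | zero => rw [Matrix.single_zero]; exact zero_mem _
    | add f g hf hg => rw [Matrix.single_add]; exact add_mem hf hg
    | single a r =>
      have h : Matrix.single i j (MonoidAlgebra.single a (1 : ℤ)) ∈
          AddSubgroup.closure (U : Set (Matrix n n (MonoidAlgebra ℤ W))) :=
        AddSubgroup.subset_closure (Or.inr (Or.inr ⟨i, j, a, rfl⟩))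
      have h2 := map_zsmul ((Matrix.singleAddMonoidHom i j).comp
        (MonoidAlgebra.singleAddHom a : ℤ →+ MonoidAlgebra ℤ W)) r 1
      rw [smul_eq_mul, mul_one] at h2
      have h3 : Matrix.single i j (MonoidAlgebra.single a r) =
        r • Matrix.single i j (MonoidAlgebra.single a (1 : ℤ)) := h2
      rw [h3]
      exact zsmul_mem h r

/-- Traces of `p`-power powers with respect to `f` may be computed from functions `Θ m` which
approximate `f` on `p ^ m`-th powers. -/
theorem dvd_matTr_pow_sub_of_approx [Monoid W] [DecidableEq n] {p : ℕ} (hp : p.Prime)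
    {f : W → ℤ} (hf : ∀ a b, f (a * b) = f (b * a)) (Θ : ℕ → W → ℤ)
    (hΘ : ∀ m a b, Θ m (a * b) = Θ m (b * a))
    (hfΘ : ∀ m w, (p : ℤ) ^ (m + 1) ∣ f (w ^ p ^ m) - Θ m w)
    (x : Matrix n n (MonoidAlgebra ℤ W))
    (hx : ∀ m j, matTr (Θ m) (x ^ p ^ (j + 1)) = matTr (fun w => Θ m (w ^ p)) (x ^ p ^ j))
    (s : ℕ) : (p : ℤ) ^ (s + 1) ∣ matTr f (x ^ p ^ s) - matTr (Θ s) x := by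
  choose δ hδ using hfΘ
  have hδ' : ∀ m w, f (w ^ p ^ m) = Θ m w + (p : ℤ) ^ (m + 1) * δ m w := by
    intro m w
    rw [← hδ]; ring
  have hp0 : ∀ m : ℕ, (p : ℤ) ^ m ≠ 0 := fun m => pow_ne_zero _ (by exact_mod_cast hp.ne_zero)
  have hδc : ∀ m a b, δ m (a * b) = δ m (b * a) := by
    intro m a b
    apply mul_left_cancel₀ (hp0 (m + 1))
    rw [← hδ, ← hδ, hΘ, pow_class hf]
  have key : ∀ j m, j + m = s →
      (p : ℤ) ^ (s + 1) ∣ matTr (fun w => f (w ^ p ^ m)) (x ^ p ^ j) -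
        matTr (fun w => f (w ^ p ^ s)) x := by
    intro j
    induction j with
    | zero => rintro m hm; simp at hm; subst hm; simp
    | succ j ih =>
      intro m hm
      have h1 := ih (m + 1) (by omega)
      have h2 : (fun w => f (w ^ p ^ (m + 1))) = fun w : W => f ((w ^ p) ^ p ^ m) := by
        funext w; rw [← pow_mul, ← pow_succ']
      rw [h2, matTr_congr_mul_add _ (fun w => Θ m (w ^ p)) (fun w => δ m (w ^ p)) (p ^ (m + 1))
        (fun w => hδ' _ _)] at h1
      rw [matTr_congr_mul_add _ (Θ m) (δ m) (p ^ (m + 1)) (fun w => hδ' _ _)]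
      have h3 := dvd_matTr_pow_sub hp (hδc m) x j
      have h4 : (p : ℤ) ^ (s + 1) ∣ (p : ℤ) ^ (m + 1) * (matTr (δ m) (x ^ p ^ (j + 1)) -
          matTr (fun w => δ m (w ^ p)) (x ^ p ^ j)) := by
        have : s + 1 = (m + 1) + (j + 1) := by omega
        rw [this, pow_add]
        exact mul_dvd_mul_left _ h3
      have := dvd_add h4 h1
      rw [hx]
      refine this.trans (dvd_of_eq ?_)
      ring
  have h1 := key s 0 (by omega)
  simp only [pow_zero, pow_one] at h1
  rw [matTr_congr_mul_add (fun w => f (w ^ p ^ s)) (Θ s) (δ s) (p ^ (s + 1)) (fun w => hδ' _ _)] at h1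
  have := dvd_add h1 (dvd_mul_right ((p : ℤ) ^ (s + 1)) (matTr (δ s) x))
  refine this.trans (dvd_of_eq ?_)
  ring
end

section
variable {n W : Type*} [Fintype n]

theorem matTr_map [Monoid W] {W' : Type*} [Monoid W']
    (π : MonoidAlgebra ℤ W →+* MonoidAlgebra ℤ W') (c : W → ℤ) (c' : W' → ℤ)
    (h : ∀ w, c w = MonoidAlgebra.liftNC (AddMonoidHom.id ℤ) c' (π (MonoidAlgebra.single w 1)))
    (x : Matrix n n (MonoidAlgebra ℤ W)) : matTr c x = matTr c' (x.map π) := by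
  have : MonoidAlgebra.liftNC (AddMonoidHom.id ℤ) c =
      (MonoidAlgebra.liftNC (AddMonoidHom.id ℤ) c').comp (π : MonoidAlgebra ℤ W →+ MonoidAlgebra ℤ W') := by
    refine AddMonoidHom.ext fun a => ?_
    induction a using MonoidAlgebra.induction_linear with
    | zero => simp
    | add f g hf hg => rw [map_add, map_add, hf, hg]
    | single w r =>
      have e : MonoidAlgebra.single w r = r • MonoidAlgebra.single w (1 : ℤ) := by
        rw [MonoidAlgebra.smul_single, smul_eq_mul, mul_one]
      rw [e, map_zsmul, map_zsmul]
      simp [MonoidAlgebra.liftNC_single, h]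
  simp only [matTr_apply, Matrix.map_apply, this]
  rfl

theorem matTr_idempotent {Γ : Type*} [Group Γ] [Finite Γ] [DecidableEq n]
    {e : Matrix n n (MonoidAlgebra ℤ Γ)} (he : e * e = e) {c : Γ → ℤ}
    (hc : ∀ a b, c (a * b) = c (b * a)) : matTr c e = c 1 * matTr (fun _ => 1) e := by
  have hpow : ∀ k : ℕ, e ^ (k + 1) = e := by
    intro k
    induction k with
    | zero => simp
    | succ k ih => rw [pow_succ, ih, he]
  have hpow' : ∀ k : ℕ, 0 < k → e ^ k = e := by
    intro k hk
    obtain ⟨j, rfl⟩ := Nat.exists_eq_succ_of_ne_zero hk.ne'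
    exact hpow j
  have hprime : ∀ p : ℕ, p.Prime → ∀ c : Γ → ℤ, (∀ a b, c (a * b) = c (b * a)) →
      matTr c e = matTr (fun w => c (w ^ p)) e := by
    intro p hp c hc
    rw [← sub_eq_zero]
    by_contra hne
    set D := matTr c e - matTr (fun w => c (w ^ p)) e with hD
    have h := dvd_matTr_pow_sub hp hc e D.natAbs
    rw [hpow' _ (pow_pos hp.pos _), hpow' _ (pow_pos hp.pos _), ← hD] at h
    have h2 := Int.natAbs_dvd_natAbs.mpr h
    have h3 := Nat.le_of_dvd (Int.natAbs_pos.mpr hne) h2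
    rw [Int.natAbs_pow, Int.natAbs_natCast] at h3
    have h4 : D.natAbs + 1 < p ^ (D.natAbs + 1) := Nat.lt_pow_self hp.one_lt
    omega
  have hall : ∀ N : ℕ, N ≠ 0 → ∀ c : Γ → ℤ, (∀ a b, c (a * b) = c (b * a)) →
      matTr c e = matTr (fun w => c (w ^ N)) e := by
    intro N
    induction N using induction_on_primes with
    | zero => intro h; exact absurd rfl h
    | one => intro _ c _; simp
    | prime_mul p a hp ih =>
      intro h c hc
      have ha : a ≠ 0 := by rintro rfl; simp at h
      rw [hprime p hp c hc, ih ha _ (pow_class hc p)]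
      congr 2
      funext w
      rw [← pow_mul, mul_comm]
  rw [hall (Nat.card Γ) Nat.card_pos.ne' c hc]
  have : (fun w : Γ => c (w ^ Nat.card Γ)) = fun w => c 1 * (fun _ => (1 : ℤ)) w := by
    funext w; simp [pow_card_eq_one']
  rw [this]
  have := matTr_congr_mul_add (n := n) (fun w : Γ => c 1 * (fun _ => (1 : ℤ)) w) (fun _ => 0)
    (fun _ => 1) (c 1) (by intro w; simp) e
  rw [this]
  have h0 := matTr_congr_mul_add (n := n) (fun w : Γ => (0 : ℤ)) (fun _ => 0)
    (fun _ => 0) (-1) (by intro w; simp) e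
  have h0' : matTr (fun w : Γ => (0 : ℤ)) e = 0 := by linarith
  rw [h0', zero_add]

theorem dvd_trace_pow_sub_of_congr {d : Type*} [Fintype d] [DecidableEq d] {p : ℕ} (hp : p.Prime)
    (Y Z : Matrix d d ℤ) (m : ℕ) :
    (p : ℤ) ^ (m + 1) ∣ ((Y + (p : ℤ) • Z) ^ p ^ m).trace - (Y ^ p ^ m).trace := by
  classical
  let W : Submonoid (Multiplicative ℕ × Matrix d d ℤ) :=
    { carrier := {w | ∃ Z, w.2 = ((p : ℤ) ^ (Multiplicative.toAdd w.1)) • Z}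
      one_mem' := ⟨1, by simp⟩
      mul_mem' := by
        rintro a b ⟨Z, hZ⟩ ⟨Z', hZ'⟩
        refine ⟨Z * Z', ?_⟩
        rw [Prod.snd_mul, hZ, hZ', Prod.fst_mul, toAdd_mul, pow_add, smul_mul_assoc,
          mul_smul_comm, smul_smul] }
  let y : W := ⟨(1, Y), Y, by simp⟩
  let z : W := ⟨(Multiplicative.ofAdd 1, (p : ℤ) • Z), Z, by simp⟩
  let f : W → ℤ := fun w => w.1.2.trace
  let Θ : ℕ → W → ℤ := fun m w => if w.1.1 = 1 then (w.1.2 ^ p ^ m).trace else 0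
  let x : Matrix Unit Unit (MonoidAlgebra ℤ W) := Matrix.diagonal fun _ =>
    MonoidAlgebra.single y 1 + MonoidAlgebra.single z 1
  let π : MonoidAlgebra ℤ W →+* MonoidAlgebra ℤ (Matrix d d ℤ) :=
    (MonoidAlgebra.lift ℤ (MonoidAlgebra ℤ (Matrix d d ℤ)) W
      { toFun := fun w => if w.1.1 = 1 then MonoidAlgebra.single w.1.2 1 else 0
        map_one' := by simp [MonoidAlgebra.one_def]
        map_mul' := by
          intro a b
          have : (a * b).1.1 = 1 ↔ a.1.1 = 1 ∧ b.1.1 = 1 := by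
            show a.1.1 * b.1.1 = 1 ↔ _
            constructor
            · intro h
              have h' := congrArg Multiplicative.toAdd h
              rw [toAdd_mul, toAdd_one] at h'
              exact ⟨by apply Multiplicative.toAdd.injective; rw [toAdd_one]; omega,
                by apply Multiplicative.toAdd.injective; rw [toAdd_one]; omega⟩
            · rintro ⟨h1, h2⟩; rw [h1, h2, mul_one]
          by_cases h1 : a.1.1 = 1 <;> by_cases h2 : b.1.1 = 1 <;> simp [h1, h2] } : _ →ₐ[ℤ] _)
  have hπ : ∀ w, π (MonoidAlgebra.single w 1) =
      if w.1.1 = 1 then MonoidAlgebra.single w.1.2 1 else 0 := by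
    intro w
    simp only [π, RingHom.coe_coe, MonoidAlgebra.lift_single, one_smul]
    rfl
  have hx : x.map π = Matrix.diagonal fun _ => MonoidAlgebra.single Y 1 := by
    ext i j : 1
    simp [x, hπ, y, z]
  have hxp : ∀ N : ℕ, (x ^ N).map π = Matrix.diagonal fun _ => MonoidAlgebra.single (Y ^ N) 1 := by
    intro N
    have : (x ^ N).map π = (x.map π) ^ N := map_pow π.mapMatrix x N
    rw [this, hx, Matrix.diagonal_pow]
    ext i j : 1
    simp [MonoidAlgebra.single_pow]
  have hpp : ∀ m : ℕ, m + 1 ≤ p ^ m := fun m => Nat.lt_pow_self hp.one_lt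
  have main := dvd_matTr_pow_sub_of_approx hp (f := f)
    (fun a b => Matrix.trace_mul_comm _ _) Θ ?_ ?_ x ?_ m
  · have e1 : matTr (Θ m) x = (Y ^ p ^ m).trace := by
      rw [matTr_map π _ (fun X : Matrix d d ℤ => (X ^ p ^ m).trace), hx]
      · simp [matTr_apply]
      · intro w
        rw [hπ]
        by_cases h : w.1.1 = 1 <;> simp [h, Θ]
    have e2 : matTr f (x ^ p ^ m) = ((Y + (p : ℤ) • Z) ^ p ^ m).trace := by
      let π2 : MonoidAlgebra ℤ W →+* MonoidAlgebra ℤ (Matrix d d ℤ) :=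
        MonoidAlgebra.mapDomainRingHom ℤ ((MonoidHom.snd _ _).comp W.subtype)
      let π3 : MonoidAlgebra ℤ (Matrix d d ℤ) →+* Matrix d d ℤ :=
        (MonoidAlgebra.lift ℤ (Matrix d d ℤ) (Matrix d d ℤ) (MonoidHom.id _) : _ →ₐ[ℤ] _)
      have h3 : ∀ a : MonoidAlgebra ℤ W,
          MonoidAlgebra.liftNC (AddMonoidHom.id ℤ) f a = (π3 (π2 a)).trace := by
        intro a
        induction a using MonoidAlgebra.induction_linear with
        | zero => simp
        | add f g hf hg => rw [map_add, map_add, map_add, Matrix.trace_add, hf, hg]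
        | single a r =>
          simp [π2, π3, f]
          rw [← zsmul_eq_mul, Matrix.trace_smul, smul_eq_mul]
      rw [matTr_apply]
      simp only [x, Matrix.diagonal_pow, Finset.univ_unique, Finset.sum_singleton,
        Matrix.diagonal_apply_eq]
      rw [h3, Pi.pow_apply, map_pow, map_pow]
      congr 2
      rw [map_add, map_add]
      simp [π2, π3, y, z]
    rw [← e1, ← e2]
    exact main
  · intro m a b
    have : (a * b).1.1 = (b * a).1.1 := mul_comm a.1.1 b.1.1
    simp only [Θ, this]
    split_ifs
    · exact pow_class (c := fun X : Matrix d d ℤ => X.trace) (fun a b => Matrix.trace_mul_comm _ _)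
        _ _ _
    · rfl
  · intro m w
    simp only [f, Θ]
    split_ifs with h
    · simp
    · obtain ⟨⟨k, X⟩, Z', hZ⟩ := w
      simp only [sub_zero]
      change X = _ at hZ
      change ¬ k = 1 at h
      change _ ∣ (X ^ p ^ m).trace
      obtain ⟨q, hq⟩ : ∃ q, Multiplicative.toAdd k = q + 1 := by
        apply Nat.exists_eq_succ_of_ne_zero
        intro h0; exact h (Multiplicative.toAdd.injective h0)
      change X = ((p : ℤ) ^ (Multiplicative.toAdd k)) • Z' at hZ
      rw [hZ, hq, smul_pow, Matrix.trace_smul, smul_eq_mul, ← pow_mul]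
      apply Dvd.dvd.mul_right
      apply pow_dvd_pow
      exact (hpp m).trans (Nat.le_mul_of_pos_left _ (Nat.succ_pos q))
  · intro m j
    rw [matTr_map π (Θ m) (fun X : Matrix d d ℤ => (X ^ p ^ m).trace),
      matTr_map π (fun w => Θ m (w ^ p)) (fun X : Matrix d d ℤ => ((X ^ p) ^ p ^ m).trace), hxp, hxp]
    · simp only [matTr_apply, Matrix.diagonal_apply_eq, MonoidAlgebra.liftNC_single, ← pow_mul]
      rw [show p ^ (j + 1) * p ^ m = p ^ j * (p * p ^ m) by ring]
    · intro w
      rw [hπ]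
      have : (w ^ p).1.1 = 1 ↔ w.1.1 = 1 := by
        show w.1.1 ^ p = 1 ↔ _
        constructor
        · intro h
          have h' := congrArg Multiplicative.toAdd h
          rw [toAdd_pow, toAdd_one, smul_eq_mul] at h'
          apply Multiplicative.toAdd.injective
          rw [toAdd_one]
          exact (mul_eq_zero.mp h').resolve_left hp.ne_zero
        · intro h; rw [h, one_pow]
      by_cases h : w.1.1 = 1
      · simp [h, Θ]
      · simp [h, Θ, hp.ne_zero]
    · intro w
      rw [hπ]
      by_cases h : w.1.1 = 1 <;> simp [h, Θ]
end

theorem trace_pow_dvd_of_map_eq {d : Type*} [Fintype d] [DecidableEq d] {p : ℕ} (hp : p.Prime)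
    (X Y : Matrix d d ℤ) (h : X.map (Int.castRingHom (ZMod p)) = Y.map (Int.castRingHom (ZMod p)))
    (m : ℕ) : (p : ℤ) ^ (m + 1) ∣ (X ^ p ^ m).trace - (Y ^ p ^ m).trace := by
  have : ∀ i j, (p : ℤ) ∣ X i j - Y i j := by
    intro i j
    have h1 := congrFun (congrFun h i) j
    simp only [Matrix.map_apply, eq_intCast] at h1
    rw [← ZMod.intCast_zmod_eq_zero_iff_dvd]
    push_cast
    rw [h1, sub_self]
  choose Z hZ using this
  have hX : X = Y + (p : ℤ) • (Matrix.of Z) := by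
    ext i j
    simp only [Matrix.add_apply, Matrix.smul_apply, Matrix.of_apply, smul_eq_mul]
    rw [← hZ]; ring
  rw [hX]
  exact dvd_trace_pow_sub_of_congr hp Y _ m

/-- Left regular representation of an integral group ring by integral matrices. -/
noncomputable def regularMatrix (Γ : Type*) [Group Γ] [Fintype Γ] [DecidableEq Γ] :
    MonoidAlgebra ℤ Γ →ₐ[ℤ] Matrix Γ Γ ℤ :=
  MonoidAlgebra.lift ℤ (Matrix Γ Γ ℤ) Γ
    { toFun := fun g => Matrix.of fun a b => if a = g * b then 1 else 0
      map_one' := by ext a b; simp [Matrix.one_apply]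
      map_mul' := by
        intro g h
        ext a b
        simp [Matrix.mul_apply, mul_assoc] }

theorem regularMatrix_apply {Γ : Type*} [Group Γ] [Fintype Γ] [DecidableEq Γ]
    (x : MonoidAlgebra ℤ Γ) (a b : Γ) : regularMatrix Γ x a b = x.coeff (a * b⁻¹) := by
  induction x using MonoidAlgebra.induction_linear with
  | zero => simp
  | add f g hf hg => rw [map_add, Matrix.add_apply, hf, hg]; simp
  | single g r =>
    simp only [regularMatrix, MonoidAlgebra.lift_single, Matrix.smul_apply, MonoidHom.coe_mk,
      OneHom.coe_mk, Matrix.of_apply, MonoidAlgebra.coeff_single, Finsupp.single_apply,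
      eq_mul_inv_iff_mul_eq]
    simp [eq_comm]

theorem eq_zero_of_matTr_eq_zero {n Γ : Type*} [Fintype n] [DecidableEq n] [Group Γ] [Finite Γ]
    {e : Matrix n n (MonoidAlgebra ℤ Γ)} (he : e * e = e) (h0 : matTr (fun _ => 1) e = 0) :
    e = 0 := by
  classical
  have := Fintype.ofFinite Γ
  let c : Γ → ℤ := fun g => if g = 1 then 1 else 0
  have hc : ∀ a b, c (a * b) = c (b * a) := by
    intro a b
    simp only [c]
    have : a * b = 1 ↔ b * a = 1 := mul_eq_one_comm
    simp only [this]
  have h1 := matTr_idempotent he hc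
  rw [h0, mul_zero] at h1
  let E : Matrix (n × Γ) (n × Γ) ℤ := Matrix.of fun i j => regularMatrix Γ (e i.1 j.1) i.2 j.2
  have hE : E * E = E := by
    ext i j
    rw [Matrix.mul_apply, Fintype.sum_prod_type]
    simp only [E, Matrix.of_apply]
    have : ∀ k, ∑ g, regularMatrix Γ (e i.1 k) i.2 g * regularMatrix Γ (e k j.1) g j.2 =
      regularMatrix Γ (e i.1 k * e k j.1) i.2 j.2 := by
      intro k
      rw [map_mul, Matrix.mul_apply]
    simp only [this]
    conv_rhs => rw [← he, Matrix.mul_apply, map_sum, Matrix.sum_apply]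
  have htr : E.trace = 0 := by
    simp only [Matrix.trace, Matrix.diag, Fintype.sum_prod_type, E, Matrix.of_apply,
      regularMatrix_apply, mul_inv_cancel]
    rw [matTr_apply] at h1
    have h2 : ∀ x : MonoidAlgebra ℤ Γ, MonoidAlgebra.liftNC (AddMonoidHom.id ℤ) c x = x.coeff 1 := by
      intro x
      induction x using MonoidAlgebra.induction_linear with
      | zero => simp
      | add f g hf hg => rw [map_add, hf, hg]; simp
      | single g r => simp [MonoidAlgebra.liftNC_single, c, Finsupp.single_apply]
    simp only [h2] at h1
    simp [← Finset.mul_sum, h1]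
  let κ : Matrix (n × Γ) (n × Γ) ℤ →+* Matrix (n × Γ) (n × Γ) ℚ :=
    (Int.castRingHom ℚ).mapMatrix
  have hQ : Matrix.toLinAlgEquiv' (κ E) = 0 := by
    apply LinearMap.IsIdempotentElem.eq_zero_of_trace_eq_zero
    · rw [IsIdempotentElem, ← map_mul, ← map_mul, hE]
    · have h3 : (κ E).trace = ((E.trace : ℤ) : ℚ) := by simp [κ, Matrix.trace]
      have h4 := Matrix.trace_toLin'_eq (κ E)
      rw [h3, htr, Int.cast_zero] at h4
      exact h4
  have hκE : κ E = 0 := by simpa using hQ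
  have hE0 : E = 0 := by
    ext i j
    have := congrFun (congrFun hκE i) j
    simpa [κ] using this
  ext i j g
  have := congrFun (congrFun hE0 (i, g)) (j, 1)
  simpa [E, regularMatrix_apply] using this

theorem idempotent_eq_zero_of_lift_eq_zero {n Γ d : Type*} [Fintype n] [DecidableEq n] [Group Γ]
    [Finite Γ] [Fintype d] [DecidableEq d] [Nonempty d] {p : ℕ} (hp : p.Prime)
    (ρ : Γ →* Matrix d d (ZMod p)) {e : Matrix n n (MonoidAlgebra ℤ Γ)} (he : e * e = e)
    (hρ : ∀ i j, MonoidAlgebra.lift ℤ (Matrix d d (ZMod p)) Γ ρ (e i j) = 0) : e = 0 := by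
  classical
  have hepow : ∀ N : ℕ, 0 < N → e ^ N = e := by
    intro N hN
    obtain ⟨j, rfl⟩ := Nat.exists_eq_succ_of_ne_zero hN.ne'
    induction j with
    | zero => simp
    | succ k ih => rw [pow_succ, ih (Nat.succ_pos _), he]
  let κ : Matrix d d ℤ →+* Matrix d d (ZMod p) := (Int.castRingHom (ZMod p)).mapMatrix
  have hκ : Function.Surjective κ := by
    intro X
    refine ⟨Matrix.of fun i j => (ZMod.intCast_surjective (X i j)).choose, ?_⟩
    ext i j
    exact (ZMod.intCast_surjective (X i j)).choose_spec
  choose L hL using fun g => hκ (ρ g)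
  let W : Submonoid (Γ × Matrix d d ℤ) :=
    { carrier := {w | κ w.2 = ρ w.1}
      one_mem' := by simp
      mul_mem' := by
        intro a b ha hb
        simp only [Set.mem_ofPred_eq] at ha hb ⊢
        rw [Prod.snd_mul, Prod.fst_mul, map_mul, map_mul, ha, hb] }
  let f : W → ℤ := fun w => w.1.2.trace
  let θ : ℕ → Γ → ℤ := fun m g => (L g ^ p ^ m).trace % (p : ℤ) ^ (m + 1)
  have hθ : ∀ (w : W) (m : ℕ), (w.1.2 ^ p ^ m).trace % (p : ℤ) ^ (m + 1) = θ m w.1.1 := by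
    intro w m
    apply Int.ModEq.eq
    apply Int.ModEq.symm
    rw [Int.modEq_iff_dvd]
    exact trace_pow_dvd_of_map_eq hp _ _ (w.2.trans (hL w.1.1).symm) m
  have hθc : ∀ m a b, θ m (a * b) = θ m (b * a) := by
    intro m a b
    let wa : W := ⟨(a, L a), hL a⟩
    let wb : W := ⟨(b, L b), hL b⟩
    have h1 := hθ (wa * wb) m
    have h2 := hθ (wb * wa) m
    have h3 : ((wa * wb).1.2 ^ p ^ m).trace = ((wb * wa).1.2 ^ p ^ m).trace :=
      pow_class (c := fun X : Matrix d d ℤ => X.trace) (fun a b => Matrix.trace_mul_comm _ _)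
        _ (L a) (L b)
    rw [h3, h2] at h1
    exact h1.symm
  let u : MonoidAlgebra ℤ W →+* MonoidAlgebra ℤ Γ :=
    MonoidAlgebra.mapDomainRingHom ℤ ((MonoidHom.fst _ _).comp W.subtype)
  let sec : Γ → W := fun g => ⟨(g, L g), hL g⟩
  let x : Matrix n n (MonoidAlgebra ℤ W) := e.map (MonoidAlgebra.mapDomain sec)
  have hux : x.map u = e := by
    refine Matrix.ext fun i j => ?_
    simp only [x, Matrix.map_apply]
    generalize e i j = a
    induction a using MonoidAlgebra.induction_linear with
    | zero => simp
    | add f g hf hg => rw [MonoidAlgebra.mapDomain_add, map_add, hf, hg]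
    | single g r => simp [u, sec]
  have huxp : ∀ N, 0 < N → (x ^ N).map u = e := by
    intro N hN
    have : (x ^ N).map u = (x.map u) ^ N := map_pow u.mapMatrix x N
    rw [this, hux, hepow N hN]
  have hu : ∀ w : W, u (MonoidAlgebra.single w 1) = MonoidAlgebra.single w.1.1 1 := by
    intro w; simp [u]
  have main := fun s => dvd_matTr_pow_sub_of_approx hp (f := f)
    (fun a b => Matrix.trace_mul_comm _ _) (fun m w => θ m w.1.1)
    (fun m a b => hθc m _ _) (by
      intro m w
      rw [← hθ]
      exact Int.dvd_self_sub_emod) x (by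
      intro m j
      rw [matTr_map u _ (θ m), matTr_map u (fun w : W => θ m (w ^ p).1.1) (fun g => θ m (g ^ p)),
        huxp _ (pow_pos hp.pos _), huxp _ (pow_pos hp.pos _), matTr_idempotent he (hθc m),
        matTr_idempotent he (c := fun g => θ m (g ^ p)) (pow_class (hθc m) p), one_pow]
      · intro w; rw [hu]; simp [MonoidAlgebra.liftNC_single]
      · intro w; rw [hu]; simp [MonoidAlgebra.liftNC_single]) s
  apply eq_zero_of_matTr_eq_zero he
  set t := matTr (fun _ => 1) e with ht
  have h1 : ∀ s, matTr (fun w : W => θ s w.1.1) x = θ s 1 * t := by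
    intro s
    rw [matTr_map u _ (θ s), hux, matTr_idempotent he (hθc s)]
    intro w; rw [hu]; simp [MonoidAlgebra.liftNC_single]
  have h2 : ∀ s, (p : ℤ) ^ (s + 1) ∣ (Fintype.card d : ℤ) - θ s 1 := by
    intro s
    have := hθ 1 s
    simp only [OneMemClass.coe_one, Prod.snd_one, one_pow, Matrix.trace_one, Prod.fst_one] at this
    rw [← this]
    exact Int.dvd_self_sub_emod
  let ψ : MonoidAlgebra ℤ W →+* Matrix d d ℤ :=
    (MonoidAlgebra.lift ℤ (Matrix d d ℤ) W ((MonoidHom.snd _ _).comp W.subtype) : _ →ₐ[ℤ] _)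
  have hψ : ∀ a, MonoidAlgebra.liftNC (AddMonoidHom.id ℤ) f a = (ψ a).trace := by
    intro a
    induction a using MonoidAlgebra.induction_linear with
    | zero => simp
    | add f g hf hg => rw [map_add, map_add, Matrix.trace_add, hf, hg]
    | single a r =>
      simp [ψ, f]
      rw [← zsmul_eq_mul, Matrix.trace_smul, smul_eq_mul]
  have hκψ : ∀ i j, κ (ψ (x i j)) = 0 := by
    intro i j
    rw [← hρ i j]
    simp only [x, Matrix.map_apply]
    generalize e i j = a
    induction a using MonoidAlgebra.induction_linear with
    | zero => simp
    | add f g hf hg => rw [MonoidAlgebra.mapDomain_add, map_add, map_add, map_add, hf, hg]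
    | single g r =>
      rw [MonoidAlgebra.mapDomain_single, MonoidAlgebra.lift_single, ← hL]
      simp only [ψ, RingHom.coe_coe, MonoidAlgebra.lift_single]
      rw [map_zsmul]
      rfl
  have hZ : ∀ i j, ∃ Z : Matrix d d ℤ, ψ (x i j) = (p : ℤ) • Z := by
    intro i j
    have : ∀ a b, (p : ℤ) ∣ ψ (x i j) a b := by
      intro a b
      have h1 := congrFun (congrFun (hκψ i j) a) b
      rw [← ZMod.intCast_zmod_eq_zero_iff_dvd]
      exact h1
    choose Z hZ using this
    refine ⟨Matrix.of Z, ?_⟩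
    ext a b
    rw [hZ]; simp
  choose Z hZ using hZ
  have h3 : ∀ s, (p : ℤ) ^ (s + 1) ∣ matTr f (x ^ p ^ s) := by
    intro s
    have e1 : (x ^ p ^ s).map ψ = ((p : ℤ) ^ p ^ s) • (Matrix.of Z) ^ p ^ s := by
      have : (x ^ p ^ s).map ψ = (x.map ψ) ^ p ^ s := map_pow ψ.mapMatrix x _
      rw [this, ← smul_pow]
      congr 1
      ext i j : 2
      simp [hZ]
    rw [matTr_apply]
    apply Finset.dvd_sum
    intro i _
    rw [hψ]
    have e2 := congrFun (congrFun e1 i) i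
    rw [Matrix.map_apply, Matrix.smul_apply] at e2
    rw [e2, Matrix.trace_smul, smul_eq_mul]
    apply Dvd.dvd.mul_right
    exact pow_dvd_pow _ (Nat.lt_pow_self hp.one_lt)
  have h4 : ∀ s, (p : ℤ) ^ (s + 1) ∣ (Fintype.card d : ℤ) * t := by
    intro s
    have h5 := main s
    rw [h1] at h5
    have h6 := (dvd_sub_right (h3 s)).mp h5
    have h7 := dvd_add (Dvd.dvd.mul_right (h2 s) t) h6
    refine h7.trans (dvd_of_eq ?_)
    ring
  have h8 : (Fintype.card d : ℤ) * t = 0 := by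
    by_contra hne
    set D := (Fintype.card d : ℤ) * t with hD
    have h2 := Int.natAbs_dvd_natAbs.mpr (h4 D.natAbs)
    have h3 := Nat.le_of_dvd (Int.natAbs_pos.mpr hne) h2
    rw [Int.natAbs_pow, Int.natAbs_natCast] at h3
    have h4 : D.natAbs + 1 < p ^ (D.natAbs + 1) := Nat.lt_pow_self hp.one_lt
    omega
  rcases mul_eq_zero.mp h8 with h | h
  · exact absurd h (by exact_mod_cast Fintype.card_ne_zero)
  · exact h

/-- `T` is normalised by `T' ≥ T` and `T' / T` is cyclic. -/
def PolyStep {H : Type*} [Group H] (T T' : Subgroup H) : Prop :=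
  T ≤ T' ∧ (∀ x ∈ T', ∀ y ∈ T, x * y * x⁻¹ ∈ T) ∧
    ∃ t ∈ T', ∀ x ∈ T', ∃ k : ℤ, x * t ^ k ∈ T

/-- Subgroups which can be reached from the trivial one by finitely many cyclic extensions. -/
inductive Reach {H : Type*} [Group H] : Subgroup H → Prop
  | bot : Reach ⊥
  | step {T T' : Subgroup H} : Reach T → PolyStep T T' → Reach T'

section
variable {H K : Type*} [Group H] [Group K]

theorem polyStep_of_hom {T T' : Subgroup H} (h : T ≤ T') {C : Type*} [Group C] [IsCyclic C]
    (θ : T' →* C) (hθ : ∀ x : T', θ x = 1 ↔ (x : H) ∈ T) : PolyStep T T' := by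
  refine ⟨h, fun x hx y hy => ?_, ?_⟩
  · have := (hθ (⟨x, hx⟩ * ⟨y, h hy⟩ * ⟨x, hx⟩⁻¹)).mp (by
      rw [map_mul, map_mul, (hθ ⟨y, h hy⟩).mpr hy, map_inv]; simp)
    exact this
  · obtain ⟨⟨_, t, rfl⟩, ht⟩ := IsCyclic.exists_generator (α := θ.range)
    refine ⟨t, t.2, fun x hx => ?_⟩
    obtain ⟨k, hk⟩ := Subgroup.mem_zpowers_iff.mp (ht ⟨θ ⟨x, hx⟩, ⟨x, hx⟩, rfl⟩)
    have hk' : θ t ^ k = θ ⟨x, hx⟩ := congrArg Subtype.val hk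
    refine ⟨-k, ?_⟩
    have := (hθ (⟨x, hx⟩ * t ^ (-k))).mp (by
      rw [map_mul, map_zpow, ← hk', zpow_neg, mul_inv_cancel])
    simpa using this

theorem PolyStep.normal {T T' : Subgroup H} (h : PolyStep T T') : (T.subgroupOf T').Normal := by
  refine ⟨fun y hy x => ?_⟩
  rw [Subgroup.mem_subgroupOf] at hy ⊢
  exact h.2.1 x x.2 y hy

theorem PolyStep.isCyclic {T T' : Subgroup H} (h : PolyStep T T') [(T.subgroupOf T').Normal] :
    IsCyclic (T' ⧸ T.subgroupOf T') := by
  obtain ⟨t, ht, htk⟩ := h.2.2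
  refine ⟨⟨QuotientGroup.mk ⟨t, ht⟩, fun x => ?_⟩⟩
  obtain ⟨x, rfl⟩ := QuotientGroup.mk_surjective x
  obtain ⟨k, hk⟩ := htk x x.2
  refine Subgroup.mem_zpowers_iff.mpr ⟨-k, ?_⟩
  rw [← QuotientGroup.mk_zpow, QuotientGroup.eq, Subgroup.mem_subgroupOf]
  have h1 : x.1⁻¹ * (x.1 * t ^ k) * x.1⁻¹⁻¹ ∈ T := h.2.1 _ (inv_mem x.2) _ hk
  have h2 : (((⟨t, ht⟩ : T') ^ (-k))⁻¹ * x : T').1 = x.1⁻¹ * (x.1 * t ^ k) * x.1⁻¹⁻¹ := by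
    simp
  rw [h2]; exact h1

theorem PolyStep.comap {T T' : Subgroup H} (h : PolyStep T T') (f : K →* H) :
    PolyStep (T.comap f) (T'.comap f) := by
  have := h.normal
  have := h.isCyclic
  refine polyStep_of_hom (Subgroup.comap_mono h.1)
    ((QuotientGroup.mk' (T.subgroupOf T')).comp (f.subgroupComap T')) fun x => ?_
  rw [MonoidHom.comp_apply, QuotientGroup.mk'_apply, QuotientGroup.eq_one_iff,
    Subgroup.mem_subgroupOf]
  rfl

theorem PolyStep.map {T T' : Subgroup H} (h : PolyStep T T') (f : H →* K) :
    PolyStep (T.map f) (T'.map f) := by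
  obtain ⟨h1, h2, t, ht, h3⟩ := h
  refine ⟨Subgroup.map_mono h1, ?_, f t, ⟨t, ht, rfl⟩, ?_⟩
  · rintro _ ⟨x, hx, rfl⟩ _ ⟨y, hy, rfl⟩
    exact ⟨_, h2 x hx y hy, by simp⟩
  · rintro _ ⟨x, hx, rfl⟩
    obtain ⟨k, hk⟩ := h3 x hx
    exact ⟨k, _, hk, by simp⟩

theorem Reach.comap {T : Subgroup H} (h : Reach T) (f : K →* H) (hf : Function.Injective f) :
    Reach (T.comap f) := by
  induction h with
  | bot => rw [MonoidHom.comap_bot, (MonoidHom.ker_eq_bot_iff f).mpr hf]; exact .bot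
  | step _ h2 ih => exact ih.step (h2.comap f)

theorem Reach.map {T : Subgroup H} (h : Reach T) (f : H →* K) : Reach (T.map f) := by
  induction h with
  | bot => rw [Subgroup.map_bot]; exact .bot
  | step _ h2 ih => exact ih.step (h2.map f)

theorem Reach.top_subgroup (h : Reach (⊤ : Subgroup H)) (S : Subgroup H) :
    Reach (⊤ : Subgroup S) := h.comap S.subtype S.subtype_injective

theorem Reach.top_of_surjective (h : Reach (⊤ : Subgroup H)) (f : H →* K)
    (hf : Function.Surjective f) : Reach (⊤ : Subgroup K) := by
  have := h.map f
  rwa [Subgroup.map_top_of_surjective f hf] at this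

theorem Reach.fg {T : Subgroup H} (h : Reach T) : T.FG := by
  induction h with
  | bot => exact ⟨∅, by simp⟩
  | @step T T' _ h2 ih =>
    obtain ⟨h1, h2, t, ht, h3⟩ := h2
    have : T' = T ⊔ Subgroup.closure {t} := by
      apply le_antisymm
      · intro x hx
        obtain ⟨k, hk⟩ := h3 x hx
        have h4 : (x * t ^ k) * t ^ (-k) = x := by simp
        have h5 : x * t ^ k ∈ T ⊔ Subgroup.closure {t} := (le_sup_left : T ≤ _) hk
        have h6 : t ∈ T ⊔ Subgroup.closure {t} :=
          (le_sup_right : Subgroup.closure {t} ≤ _) (Subgroup.subset_closure rfl)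
        rw [← h4]
        exact Subgroup.mul_mem _ h5 (Subgroup.zpow_mem _ h6 _)
      · refine sup_le h1 ((Subgroup.closure_le _).mpr ?_)
        simpa using ht
    rw [this]
    exact ih.sup ⟨{t}, by simp⟩

theorem Reach.fg_of_top (h : Reach (⊤ : Subgroup H)) (S : Subgroup H) : S.FG := by
  rw [← Group.fg_iff_subgroup_fg]
  exact ⟨(h.top_subgroup S).fg⟩

theorem Reach.isSolvable {T : Subgroup H} (h : Reach T) : Group.IsSolvable T := by
  induction h with
  | bot => exact Group.isSolvable_of_comm fun a b => Subsingleton.elim _ _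
  | @step T T' _ h2 ih =>
    have := h2.normal
    have := h2.isCyclic
    have : Group.IsSolvable (T' ⧸ T.subgroupOf T') :=
      Group.isSolvable_of_comm (fun a b => by
        let := IsCyclic.commGroup (α := T' ⧸ T.subgroupOf T')
        exact mul_comm a b)
    refine Group.isSolvable_of_ker_le_range (Subgroup.inclusion h2.1)
      (QuotientGroup.mk' (T.subgroupOf T')) ?_
    rw [QuotientGroup.ker_mk']
    intro x hx
    exact ⟨⟨x, hx⟩, rfl⟩

/-- A nonempty family of subgroups of a polycyclic group has a maximal element. -/
theorem Reach.exists_maximal (h : Reach (⊤ : Subgroup H)) (P : Subgroup H → Prop)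
    (hP : ∃ S, P S) : ∃ S, P S ∧ ∀ S', P S' → S ≤ S' → S' = S := by
  have hw : WellFoundedGT (Subgroup H) := by
    rw [wellFoundedGT_iff_monotone_chain_condition]
    intro a
    obtain ⟨F, hF⟩ := h.fg_of_top (⨆ n, a n)
    have hmem : ∀ x ∈ F, ∃ n, x ∈ a n := fun x hx => by
      have : x ∈ ⨆ n, a n := by rw [← hF]; exact Subgroup.subset_closure hx
      exact (Subgroup.mem_iSup_of_directed a.monotone.directed_le).mp this
    choose! N hN using hmem
    refine ⟨F.sup N, fun m hm => le_antisymm (a.monotone hm) ?_⟩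
    refine (le_iSup a m).trans ?_
    rw [← hF, Subgroup.closure_le]
    exact fun x hx => a.monotone (Finset.le_sup hx) (hN x hx)
  obtain ⟨S, hS⟩ := hP
  obtain ⟨M, hM, hmax⟩ := hw.wf.has_min {S | P S} ⟨S, hS⟩
  refine ⟨M, hM, fun S' hS' hle => ?_⟩
  by_contra hne
  exact hmax S' hS' (lt_of_le_of_ne hle (Ne.symm hne))
end

theorem IsPolycyclic.reach {G : Type*} [Group G] (h : IsPolycyclic G) :
    Reach (⊤ : Subgroup G) := by
  obtain ⟨n, s, h0, hn, hs⟩ := h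
  rw [← hn]
  generalize Fin.last n = i
  induction i using Fin.induction with
  | zero => rw [h0]; exact .bot
  | succ i ih =>
    obtain ⟨h1, h2, h3⟩ := hs i
    have := h2
    have := h3
    refine ih.step (polyStep_of_hom h1
      (QuotientGroup.mk' ((s i.castSucc).subgroupOf (s i.succ))) fun x => ?_)
    rw [QuotientGroup.mk'_apply, QuotientGroup.eq_one_iff, Subgroup.mem_subgroupOf]

section

/-- Compatible actions of a group on a ring and on a module. -/
class SemilinAct (H B V : Type*) [Group H] [CommRing B] [AddCommGroup V] [Module B V]
    [MulSemiringAction H B] [DistribMulAction H V] : Prop where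
  smul_smul' : ∀ (h : H) (b : B) (v : V), h • (b • v) = (h • b) • (h • v)

set_option linter.unusedSectionVars false

section SemilinAct
variable {H B V : Type*} [Group H] [CommRing B] [AddCommGroup V] [Module B V]
    [MulSemiringAction H B] [DistribMulAction H V] [SemilinAct H B V]

/-- Translation of submodules by a group element. -/
def tr (h : H) (U : Submodule B V) : Submodule B V where
  carrier := {v | h⁻¹ • v ∈ U}
  add_mem' {a b} ha hb := by
    change h⁻¹ • (a + b) ∈ U
    rw [smul_add]; exact U.add_mem ha hb
  zero_mem' := by
    change h⁻¹ • (0 : V) ∈ U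
    rw [smul_zero]; exact U.zero_mem
  smul_mem' b v hv := by
    change h⁻¹ • (b • v) ∈ U
    rw [SemilinAct.smul_smul']; exact U.smul_mem _ hv

theorem mem_tr {h : H} {U : Submodule B V} {v : V} : v ∈ tr h U ↔ h⁻¹ • v ∈ U := Iff.rfl

theorem smul_mem_tr {h : H} {U : Submodule B V} {v : V} : h • v ∈ tr h U ↔ v ∈ U := by
  rw [mem_tr, inv_smul_smul]

theorem tr_tr (g h : H) (U : Submodule B V) : tr g (tr h U) = tr (g * h) U := by
  ext v; rw [mem_tr, mem_tr, mem_tr, mul_inv_rev, mul_smul]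

theorem tr_one (U : Submodule B V) : tr (1 : H) U = U := by
  ext v; rw [mem_tr, inv_one, one_smul]

theorem tr_mono (h : H) {U U' : Submodule B V} (hU : U ≤ U') : tr h U ≤ tr h U' :=
  fun _ hv => hU hv

theorem tr_sup (h : H) (U U' : Submodule B V) : tr h (U ⊔ U') = tr h U ⊔ tr h U' := by
  apply le_antisymm
  · intro v hv
    obtain ⟨a, ha, b, hb, hab⟩ := Submodule.mem_sup.mp (mem_tr.mp hv)
    have : v = h • a + h • b := by rw [← smul_add, hab, smul_inv_smul]
    rw [this]
    exact Submodule.add_mem_sup (smul_mem_tr.mpr ha) (smul_mem_tr.mpr hb)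
  · exact sup_le (tr_mono h le_sup_left) (tr_mono h le_sup_right)

theorem tr_bot (h : H) : tr h (⊥ : Submodule B V) = ⊥ := by
  ext v; rw [mem_tr, Submodule.mem_bot, Submodule.mem_bot, smul_eq_zero_iff_eq]

/-- Stability of a submodule under a subgroup. -/
def StableUnder (T : Subgroup H) (U : Submodule B V) : Prop := ∀ h ∈ T, ∀ v ∈ U, h • v ∈ U

theorem StableUnder.tr_eq {T : Subgroup H} {U : Submodule B V} (hU : StableUnder T U) {h : H}
    (hh : h ∈ T) : tr h U = U := by
  ext v
  refine ⟨fun hv => ?_, fun hv => hU _ (inv_mem hh) _ hv⟩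
  have := hU h hh _ (mem_tr.mp hv)
  rwa [smul_inv_smul] at this

theorem StableUnder.of_tr_le {T : Subgroup H} {U : Submodule B V}
    (hU : ∀ h ∈ T, tr h U ≤ U) : StableUnder T U := fun h hh _ hv =>
  hU h hh (smul_mem_tr.mpr hv)

theorem StableUnder.sup {T : Subgroup H} {U U' : Submodule B V} (hU : StableUnder T U)
    (hU' : StableUnder T U') : StableUnder T (U ⊔ U') :=
  .of_tr_le fun h hh => by rw [tr_sup, hU.tr_eq hh, hU'.tr_eq hh]

theorem StableUnder.inf {T : Subgroup H} {U U' : Submodule B V} (hU : StableUnder T U)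
    (hU' : StableUnder T U') : StableUnder T (U ⊓ U') :=
  fun h hh v hv => ⟨hU h hh v hv.1, hU' h hh v hv.2⟩

theorem StableUnder.bot {T : Subgroup H} : StableUnder T (⊥ : Submodule B V) :=
  .of_tr_le fun h _ => by rw [tr_bot]

theorem StableUnder.mono {T T' : Subgroup H} {U : Submodule B V} (hU : StableUnder T' U)
    (h : T ≤ T') : StableUnder T U := fun g hg => hU g (h hg)

theorem StableUnder.translate {T : Subgroup H} {U : Submodule B V} (hU : StableUnder T U) {t : H}
    (ht : ∀ y ∈ T, t⁻¹ * y * t ∈ T) : StableUnder T (tr t U) :=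
  .of_tr_le fun h hh => by
    have : tr h (tr t U) = tr t (tr (t⁻¹ * h * t) U) := by
      rw [tr_tr, tr_tr]; congr 1; group
    rw [this, hU.tr_eq (ht h hh)]

/-- The submodule generated by the translates of a finite set. -/
def gen (B : Type*) {H V : Type*} [Group H] [CommRing B] [AddCommGroup V] [Module B V]
    [DistribMulAction H V] (T : Subgroup H) (F : Finset V) : Submodule B V :=
  Submodule.span B {v | ∃ h ∈ T, ∃ x ∈ F, v = h • x}

theorem gen_le_iff {T : Subgroup H} {F : Finset V} {U : Submodule B V} :
    gen B T F ≤ U ↔ ∀ h ∈ T, ∀ x ∈ F, h • x ∈ U := by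
  rw [gen, Submodule.span_le]
  constructor
  · intro h g hg x hx; exact h ⟨g, hg, x, hx, rfl⟩
  · rintro h _ ⟨g, hg, x, hx, rfl⟩; exact h g hg x hx

theorem smul_mem_gen {T : Subgroup H} {F : Finset V} {h : H} (hh : h ∈ T) {x : V} (hx : x ∈ F) :
    h • x ∈ gen B T F := Submodule.subset_span ⟨h, hh, x, hx, rfl⟩

theorem gen_mono {T T' : Subgroup H} {F : Finset V} (h : T ≤ T') : gen B T F ≤ gen B T' F :=
  gen_le_iff.mpr fun _ hg _ hx => smul_mem_gen (h hg) hx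

theorem stableUnder_gen (T : Subgroup H) (F : Finset V) : StableUnder T (gen B T F) :=
  fun g hg v hv => by
    have : gen B T F ≤ tr g⁻¹ (gen B T F) := gen_le_iff.mpr fun h hh x hx => by
      rw [mem_tr, inv_inv, smul_smul]; exact smul_mem_gen (mul_mem hg hh) hx
    have := mem_tr.mp (this hv)
    rwa [inv_inv] at this

/-- The partial sums `⨆ i < n, t ^ i V₀`. -/
def psum (t : H) (V₀ : Submodule B V) : ℕ → Submodule B V
  | 0 => ⊥
  | n + 1 => psum t V₀ n ⊔ tr (t ^ n) V₀

theorem psum_succ (t : H) (V₀ : Submodule B V) (n : ℕ) :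
    psum t V₀ (n + 1) = psum t V₀ n ⊔ tr (t ^ n) V₀ := rfl

theorem psum_succ' (t : H) (V₀ : Submodule B V) (n : ℕ) :
    psum t V₀ (n + 1) = V₀ ⊔ tr t (psum t V₀ n) := by
  induction n with
  | zero => simp [psum, tr_bot, tr_one]
  | succ n ih =>
    rw [psum_succ t V₀ (n + 1)]
    conv_rhs => rw [psum_succ, tr_sup, tr_tr, ← pow_succ', ← sup_assoc, ← ih]

theorem psum_mono (t : H) (V₀ : Submodule B V) : Monotone (psum t V₀) :=
  monotone_nat_of_le_succ fun _ => le_sup_left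

theorem stableUnder_psum {T : Subgroup H} {t : H} (ht : ∀ y ∈ T, t⁻¹ * y * t ∈ T)
    {V₀ : Submodule B V} (hV : StableUnder T V₀) (n : ℕ) : StableUnder T (psum t V₀ n) := by
  induction n with
  | zero => exact .bot
  | succ n ih => rw [psum_succ']; exact hV.sup (ih.translate ht)

theorem exists_pow_smul_mem_psum {T T' : Subgroup H} {t : H}
    (hn : ∀ x ∈ T', ∀ y ∈ T, x * y * x⁻¹ ∈ T) (ht : t ∈ T')
    (htk : ∀ x ∈ T', ∃ k : ℤ, x * t ^ k ∈ T) {F : Finset V} {v : V} (hv : v ∈ gen B T' F) :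
    ∃ m M : ℕ, t ^ m • v ∈ psum t (gen B T F) M := by
  have hpow : ∀ (l M : ℕ) (v : V), v ∈ psum t (gen B T F) M → t ^ l • v ∈
      psum t (gen B T F) (M + l) := fun l => by
    induction l with
    | zero => intro M v hv; simpa using hv
    | succ l ih =>
      intro M v hv
      rw [← add_assoc, psum_succ', pow_succ', mul_smul]
      exact (le_sup_right : _ ≤ _ ⊔ tr t (psum t (gen B T F) (M + l))) (smul_mem_tr.mpr (ih M v hv))
  let U : Submodule B V :=
    { carrier := {v | ∃ m M : ℕ, t ^ m • v ∈ psum t (gen B T F) M}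
      add_mem' := by
        rintro a b ⟨m, M, h⟩ ⟨m', M', h'⟩
        refine ⟨m + m', (M + m') + (M' + m), ?_⟩
        rw [smul_add]
        refine Submodule.add_mem _ (psum_mono _ _ (Nat.le_add_right _ _) ?_)
          (psum_mono _ _ (Nat.le_add_left _ _) ?_)
        · rw [add_comm m m', pow_add, mul_smul]; exact hpow _ _ _ h
        · rw [pow_add, mul_smul]; exact hpow _ _ _ h'
      zero_mem' := ⟨0, 0, by simp⟩
      smul_mem' := by
        rintro b v ⟨m, M, h⟩
        refine ⟨m, M, ?_⟩
        rw [SemilinAct.smul_smul']; exact Submodule.smul_mem _ _ h }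
  refine (gen_le_iff (U := U)).mpr (fun h hh x hx => ?_) hv
  obtain ⟨k, hk⟩ := htk h hh
  have hk' : t ^ k * h ∈ T := by
    have := hn (t ^ k) (zpow_mem ht k) _ hk
    rwa [show t ^ k * (h * t ^ k) * (t ^ k)⁻¹ = t ^ k * h by group] at this
  have h1 : (t ^ k * h) • x ∈ psum t (gen B T F) 1 := by
    rw [psum_succ']; exact (le_sup_left : gen B T F ≤ _) (smul_mem_gen hk' hx)
  obtain ⟨l, rfl | rfl⟩ := k.eq_nat_or_neg
  · refine ⟨l, 1, ?_⟩
    rwa [zpow_natCast, mul_smul] at h1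
  · refine ⟨0, 1 + l, ?_⟩
    have := hpow l _ _ h1
    rw [smul_smul] at this
    simpa using this

/-- A doubly monotone family with the ascending chain condition stabilises uniformly. -/
theorem uniform_stabilisation {α : Type*} [PartialOrder α] (W : ℕ → ℕ → α)
    (h1 : ∀ j, Monotone (W j)) (h2 : ∀ k, Monotone fun j => W j k)
    (hs : ∀ a : ℕ → α, Monotone a → (∀ n, ∃ j k, a n = W j k) → ∃ n, ∀ m ≥ n, a m = a n) :
    ∃ k₀, ∀ k ≥ k₀, ∀ j, W j k = W j k₀ := by
  obtain ⟨n, hn⟩ := hs (fun n => W n n) (fun a b hab => (h1 a hab).trans (h2 b hab))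
    (fun n => ⟨n, n, rfl⟩)
  choose f hf using fun j => hs (W j) (h1 j) (fun k => ⟨j, k, rfl⟩)
  refine ⟨n + (Finset.range n).sup f, fun k hk j => ?_⟩
  have hn0 : n ≤ n + (Finset.range n).sup f := Nat.le_add_right _ _
  rcases lt_or_ge j n with hj | hj
  · have : f j ≤ n + (Finset.range n).sup f :=
      (Finset.le_sup (f := f) (Finset.mem_range.mpr hj)).trans (Nat.le_add_left _ _)
    rw [hf j k (this.trans hk), hf j _ this]
  · have key : ∀ k ≥ n, W j k = W n n := fun k hk => by
      apply le_antisymm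
      · rw [← hn (max j k) (hj.trans (le_max_left _ _))]
        exact (h1 j (le_max_right _ _)).trans (h2 _ (le_max_left _ _))
      · exact (h1 n hk).trans (h2 k hj)
    rw [key k (hn0.trans hk), key _ hn0]

theorem noetherian_of_reach [IsNoetherianRing B] {T : Subgroup H} (hT : Reach T) (F : Finset V)
    (N : ℕ → Submodule B V) (hN : Monotone N) (hst : ∀ k, StableUnder T (N k))
    (hle : ∀ k, N k ≤ gen B T F) : ∃ k₀, ∀ k ≥ k₀, N k = N k₀ := by
  induction hT generalizing N with
  | bot =>
    have hg : gen B (⊥ : Subgroup H) F = Submodule.span B (F : Set V) := by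
      apply le_antisymm
      · refine gen_le_iff.mpr fun h hh x hx => ?_
        rw [Subgroup.mem_bot.mp hh, one_smul]; exact Submodule.subset_span hx
      · exact Submodule.span_le.mpr fun x hx => by
          have := smul_mem_gen (B := B) (one_mem (⊥ : Subgroup H)) hx
          rwa [one_smul] at this
    have : IsNoetherian B (gen B (⊥ : Subgroup H) F) := by
      rw [hg]; exact isNoetherian_span_of_finite B F.finite_toSet
    obtain ⟨n, hn⟩ := monotone_stabilizes_iff_noetherian.mpr this
      ⟨fun k => (N k).comap (gen B (⊥ : Subgroup H) F).subtype,
        fun a b hab => Submodule.comap_mono (hN hab)⟩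
    refine ⟨n, fun k hk => le_antisymm (fun x hx => ?_) (hN hk)⟩
    have h1 : (⟨x, hle k hx⟩ : gen B (⊥ : Subgroup H) F) ∈
      (N k).comap (gen B (⊥ : Subgroup H) F).subtype := hx
    have h2 : (N n).comap (gen B (⊥ : Subgroup H) F).subtype = (N k).comap _ := hn k hk
    rw [← h2] at h1
    exact h1
  | @step T T' _ h2 ih =>
    obtain ⟨hTT, hn, t, ht, htk⟩ := h2
    have htn : ∀ y ∈ T, t⁻¹ * y * t ∈ T := fun y hy => by
      simpa using hn t⁻¹ (inv_mem ht) y hy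
    set V₀ := gen B T F
    have hV : StableUnder T V₀ := stableUnder_gen T F
    obtain ⟨k₀, hk⟩ := uniform_stabilisation
      (fun j k => V₀ ⊓ (N k ⊔ tr t (psum t V₀ j)))
      (fun j a b hab => inf_le_inf_left _ (sup_le_sup_right (hN hab) _))
      (fun k a b hab => inf_le_inf_left _ (sup_le_sup_left (tr_mono t (psum_mono t V₀ hab)) _))
      (fun a ha haW => ih a ha
        (fun k => by
          obtain ⟨j, l, h⟩ := haW k
          rw [h]
          exact hV.inf (((hst l).mono hTT).sup ((stableUnder_psum htn hV j).translate htn)))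
        (fun k => by
          obtain ⟨j, l, h⟩ := haW k
          rw [h]; exact inf_le_left))
    refine ⟨k₀, fun k hkk => le_antisymm ?_ (hN hkk)⟩
    have key : ∀ j, N k ⊓ psum t V₀ j ≤ N k₀ := by
      intro j
      induction j with
      | zero => intro x hx; rw [(Submodule.mem_bot B).mp hx.2]; exact zero_mem _
      | succ j ihj =>
        rintro x ⟨hx, hxs⟩
        rw [SetLike.mem_coe, psum_succ'] at hxs
        obtain ⟨v, hv, s, hs, rfl⟩ := Submodule.mem_sup.mp hxs
        have hvW : v ∈ V₀ ⊓ (N k ⊔ tr t (psum t V₀ j)) := by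
          refine ⟨hv, ?_⟩
          have := Submodule.sub_mem _ (Submodule.mem_sup_left (T := tr t (psum t V₀ j)) hx)
            (Submodule.mem_sup_right (S := N k) hs)
          rwa [add_sub_cancel_right] at this
        rw [hk k hkk j] at hvW
        obtain ⟨y, hy, s', hs', hv'⟩ := Submodule.mem_sup.mp hvW.2
        have h3 : s' + s ∈ N k := by
          have := Submodule.sub_mem _ hx (hN hkk hy)
          rwa [← hv', show y + s' + s - y = s' + s by abel] at this
        have h4 : s' + s ∈ tr t (psum t V₀ j) := Submodule.add_mem _ hs' hs
        have h5 := hst k₀ t ht _ (ihj ⟨hst k _ (inv_mem ht) _ h3, h4⟩)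
        rw [smul_inv_smul] at h5
        rw [← hv', add_assoc]
        exact Submodule.add_mem _ hy h5
    intro x hx
    obtain ⟨m, M, hmM⟩ := exists_pow_smul_mem_psum hn ht htk (hle k hx)
    have h1 := key M ⟨hst k _ (pow_mem ht m) _ hx, hmM⟩
    have h2 := hst k₀ _ (inv_mem (pow_mem ht m)) _ h1
    rwa [inv_smul_smul] at h2

end SemilinAct

end

section

set_option linter.unusedSectionVars false

section GenericFreeness
variable {H B V : Type*} [Group H] [CommRing B] [AddCommGroup V] [Module B V]
    [MulSemiringAction H B] [DistribMulAction H V] [SemilinAct H B V]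

/-- The set `s` is independent modulo `Y` and generates `X` modulo `Y` up to `M`-torsion. -/
structure IsFreeUpTo (M : Submonoid B) (Y X : Submodule B V) (s : Set V) : Prop where
  sub : s ⊆ X
  indep : ∀ (F : Finset V) (c : V → B), (F : Set V) ⊆ s → ∑ v ∈ F, c v • v ∈ Y → ∀ v ∈ F, c v = 0
  tors : ∀ x ∈ X, ∃ c ∈ M, c • x ∈ Y ⊔ Submodule.span B s

theorem IsFreeUpTo.trans {M : Submonoid B} {Y X Z : Submodule B V} {s s' : Set V} (hYX : Y ≤ X)
    (hXZ : X ≤ Z) (h : IsFreeUpTo M Y X s) (h' : IsFreeUpTo M X Z s') :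
    IsFreeUpTo M Y Z (s ∪ s') := by
  classical
  refine ⟨Set.union_subset (h.sub.trans hXZ) h'.sub, fun F c hF hc => ?_, fun x hx => ?_⟩
  · have hs : ((F.filter (· ∉ s') : Finset V) : Set V) ⊆ s := fun v hv => by
      rw [Finset.mem_coe, Finset.mem_filter] at hv
      exact (hF hv.1).resolve_right hv.2
    have hsplit := Finset.sum_filter_add_sum_filter_not F (· ∈ s') (fun v => c v • v)
    have h1 : ∑ v ∈ F.filter (· ∉ s'), c v • v ∈ X :=
      Submodule.sum_mem _ fun v hv => Submodule.smul_mem _ _ (h.sub (hs hv))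
    have h2 : ∑ v ∈ F.filter (· ∈ s'), c v • v ∈ X := by
      rw [eq_sub_of_add_eq hsplit]; exact Submodule.sub_mem _ (hYX hc) h1
    have h3 := h'.indep _ c (fun v hv => (Finset.mem_filter.mp hv).2) h2
    rw [Finset.sum_eq_zero (s := F.filter (· ∈ s')) (fun v hv => by rw [h3 v hv, zero_smul]),
      zero_add] at hsplit
    have h4 := h.indep _ c hs (hsplit ▸ hc)
    intro v hv
    by_cases hvs : v ∈ s'
    · exact h3 v (Finset.mem_filter.mpr ⟨hv, hvs⟩)
    · exact h4 v (Finset.mem_filter.mpr ⟨hv, hvs⟩)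
  · obtain ⟨c, hc, hcx⟩ := h'.tors x hx
    obtain ⟨y, hy, z, hz, hyz⟩ := Submodule.mem_sup.mp hcx
    obtain ⟨d, hd, hdy⟩ := h.tors y hy
    refine ⟨d * c, mul_mem hd hc, ?_⟩
    rw [mul_smul, ← hyz, smul_add, Submodule.span_union, ← sup_assoc]
    exact Submodule.add_mem_sup hdy (Submodule.smul_mem _ _ hz)

theorem IsFreeUpTo.translate {M : Submonoid B} (hM : ∀ (h : H), ∀ c ∈ M, h • c ∈ M)
    {Y X : Submodule B V} {s : Set V} (hs : IsFreeUpTo M Y X s) (h : H) :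
    IsFreeUpTo M (tr h Y) (tr h X) {v | h⁻¹ • v ∈ s} := by
  classical
  refine ⟨fun v hv => hs.sub hv, fun F c hF hc => ?_, fun x hx => ?_⟩
  · have key := hs.indep (F.image (h⁻¹ • ·)) (fun v => h⁻¹ • c (h • v)) (by
      intro v hv
      obtain ⟨w, hw, rfl⟩ := Finset.mem_image.mp (Finset.mem_coe.mp hv)
      exact hF hw) (by
      rw [Finset.sum_image (fun a _ b _ hab => MulAction.injective _ hab)]
      rw [mem_tr, Finset.smul_sum] at hc
      convert hc using 2 with v hv
      rw [smul_inv_smul, SemilinAct.smul_smul'])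
    intro v hv
    have := key (h⁻¹ • v) (Finset.mem_image_of_mem _ hv)
    rwa [smul_inv_smul, smul_eq_zero_iff_eq] at this
  · obtain ⟨c, hc, hcx⟩ := hs.tors _ hx
    refine ⟨h • c, hM h c hc, ?_⟩
    have h1 : h⁻¹ • ((h • c) • x) ∈ Y ⊔ Submodule.span B s := by
      rw [SemilinAct.smul_smul', inv_smul_smul]; exact hcx
    have h2 : tr h (Submodule.span B s) ≤ Submodule.span B {v | h⁻¹ • v ∈ s} := by
      intro v hv
      have : Submodule.span B s ≤ tr h⁻¹ (Submodule.span B {v | h⁻¹ • v ∈ s}) :=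
        Submodule.span_le.mpr fun w hw => by
          rw [SetLike.mem_coe, mem_tr, inv_inv]
          refine Submodule.subset_span ?_
          change h⁻¹ • (h • w) ∈ s
          rwa [inv_smul_smul]
      have := this (mem_tr.mp hv)
      rwa [smul_mem_tr] at this
    have h3 := mem_tr.mpr h1
    rw [tr_sup] at h3
    exact sup_le_sup_left h2 _ h3

theorem IsFreeUpTo.iSup {M : Submonoid B} {Z : ℕ → Submodule B V} {s : ℕ → Set V}
    (hZ : Monotone Z) (hs : Monotone s) (h : ∀ j, IsFreeUpTo M (Z 0) (Z j) (s j)) :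
    IsFreeUpTo M (Z 0) (⨆ j, Z j) (⋃ j, s j) := by
  refine ⟨Set.iUnion_subset fun j => (h j).sub.trans (le_iSup Z j), fun F c hF hc => ?_,
    fun x hx => ?_⟩
  · have : ∀ v ∈ F, ∃ j, v ∈ s j := fun v hv => Set.mem_iUnion.mp (hF hv)
    choose! f hf using this
    exact (h (F.sup f)).indep F c (fun v hv => hs (Finset.le_sup hv) (hf v hv)) hc
  · obtain ⟨j, hj⟩ := (Submodule.mem_iSup_of_directed _ hZ.directed_le).mp hx
    obtain ⟨c, hc, hcx⟩ := (h j).tors x hj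
    exact ⟨c, hc, (sup_le_sup_left (Submodule.span_mono (Set.subset_iUnion s j)) _ :
      Z 0 ⊔ Submodule.span B (s j) ≤ Z 0 ⊔ Submodule.span B (⋃ j, s j)) hcx⟩

theorem IsFreeUpTo.of_inf {M : Submonoid B} {U V₀ : Submodule B V} {s : Set V}
    (h : IsFreeUpTo M (V₀ ⊓ U) V₀ s) : IsFreeUpTo M U (U ⊔ V₀) s := by
  refine ⟨h.sub.trans (le_sup_right : V₀ ≤ _), fun F c hF hc => h.indep F c hF ⟨?_, hc⟩,
    fun x hx => ?_⟩
  · exact Submodule.sum_mem _ fun v hv => Submodule.smul_mem _ _ (h.sub (hF hv))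
  · obtain ⟨u, hu, v, hv, rfl⟩ := Submodule.mem_sup.mp hx
    obtain ⟨c, hc, hcx⟩ := h.tors v hv
    refine ⟨c, hc, ?_⟩
    rw [smul_add]
    exact Submodule.add_mem _ (Submodule.mem_sup_left (Submodule.smul_mem _ _ hu))
      ((sup_le_sup_right inf_le_right _ :
        V₀ ⊓ U ⊔ Submodule.span B s ≤ U ⊔ Submodule.span B s) hcx)

theorem IsFreeUpTo.refl (M : Submonoid B) (Y : Submodule B V) : IsFreeUpTo M Y Y ∅ := by
  refine ⟨Set.empty_subset _, fun F c hF _ v hv => (hF hv).elim, fun x hx => ⟨1, one_mem _, ?_⟩⟩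
  rw [one_smul]; exact Submodule.mem_sup_left hx

theorem IsFreeUpTo.of_chain {M : Submonoid B} (hM : ∀ (h : H), ∀ c ∈ M, h • c ∈ M)
    {V₀ : Submodule B V} (Z : ℕ → Submodule B V) (τ : ℕ → H)
    (hZ : ∀ j, Z (j + 1) = Z j ⊔ tr (τ j) V₀)
    (h : ∀ j, ∃ s, IsFreeUpTo M (V₀ ⊓ tr (τ j)⁻¹ (Z j)) V₀ s) :
    ∃ s, IsFreeUpTo M (Z 0) (⨆ j, Z j) s := by
  have h' : ∀ j, ∃ s, IsFreeUpTo M (Z j) (Z (j + 1)) s := fun j => by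
    obtain ⟨s, hs⟩ := h j
    refine ⟨{v | (τ j)⁻¹ • v ∈ s}, ?_⟩
    rw [hZ]
    apply IsFreeUpTo.of_inf
    convert hs.translate hM (τ j) using 1
    ext v
    simp only [Submodule.mem_inf, mem_tr, inv_inv, smul_inv_smul]
  choose s hs using h'
  have hmono : Monotone Z := monotone_nat_of_le_succ fun j => by rw [hZ]; exact le_sup_left
  have hj : ∀ j, IsFreeUpTo M (Z 0) (Z j) (⋃ i ∈ Finset.range j, s i) := fun j => by
    induction j with
    | zero => simpa using IsFreeUpTo.refl M (Z 0)
    | succ j ih =>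
      have := ih.trans (hmono (Nat.zero_le j)) (hmono (Nat.le_succ j)) (hs j)
      rwa [Finset.range_add_one, Finset.set_biUnion_insert, Set.union_comm]
  exact ⟨_, IsFreeUpTo.iSup hmono (fun a b hab => Set.biUnion_mono
    (fun i hi => Finset.range_mono hab hi) fun _ _ => le_rfl) hj⟩

theorem exists_isFreeUpTo_span [IsDomain B] (F : Finset V) (W : Submodule B V) :
    ∃ f : B, f ≠ 0 ∧ ∀ M : Submonoid B, (∀ a b : B, a ∣ b → b ∈ M → a ∈ M) → f ∈ M →
      ∃ s, IsFreeUpTo M W (Submodule.span B (F : Set V)) s := by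
  classical
  let P : Finset V → Prop := fun s => s ⊆ F ∧ ∀ (E : Finset V) (c : V → B), (E : Set V) ⊆ s →
    ∑ v ∈ E, c v • v ∈ W → ∀ v ∈ E, c v = 0
  have hfin : {s | P s}.Finite := (Finset.finite_toSet F.powerset).subset fun s hs =>
    Finset.mem_coe.mpr (Finset.mem_powerset.mpr hs.1)
  obtain ⟨s, hs⟩ := hfin.exists_maximal ⟨∅, by simp, fun E c hE _ v hv => by
    simpa using hE hv⟩
  have hsP : P s := hs.prop
  have hc : ∀ x ∈ F, ∃ c : B, c ≠ 0 ∧ c • x ∈ W ⊔ Submodule.span B (s : Set V) := by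
    intro x hx
    by_cases hxs : x ∈ s
    · exact ⟨1, one_ne_zero, by
        rw [one_smul]; exact Submodule.mem_sup_right (Submodule.subset_span hxs)⟩
    by_contra! hcon
    have hP : P (insert x s) := by
      refine ⟨Finset.insert_subset hx hsP.1, fun E c hE hW => ?_⟩
      have hEs : ((E.erase x : Finset V) : Set V) ⊆ s := fun v hv => by
        rw [Finset.mem_coe, Finset.mem_erase] at hv
        have := hE hv.2
        rw [Finset.mem_coe, Finset.mem_insert] at this
        exact this.resolve_left hv.1
      by_cases hxE : x ∈ E
      · have hsum := Finset.add_sum_erase E (fun v => c v • v) hxE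
        have hcx : c x = 0 := by
          by_contra hcx
          refine hcon _ hcx ?_
          rw [eq_sub_of_add_eq hsum]
          exact Submodule.sub_mem _ (Submodule.mem_sup_left hW) (Submodule.mem_sup_right
            (Submodule.sum_mem _ fun v hv => Submodule.smul_mem _ _
              (Submodule.subset_span (hEs hv))))
        rw [hcx, zero_smul, zero_add] at hsum
        have := hsP.2 _ c hEs (hsum ▸ hW)
        intro v hv
        by_cases hvx : v = x
        · rw [hvx, hcx]
        · exact this v (Finset.mem_erase.mpr ⟨hvx, hv⟩)
      · rw [Finset.erase_eq_of_notMem hxE] at hEs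
        exact hsP.2 _ c hEs hW
    exact hxs (hs.le_of_ge hP (Finset.subset_insert x s) (Finset.mem_insert_self x s))
  choose! c hc0 hc using hc
  refine ⟨∏ x ∈ F, c x, Finset.prod_ne_zero_iff.mpr hc0, fun M hM hf => ⟨s, ?_, hsP.2, ?_⟩⟩
  · exact fun v hv => Submodule.subset_span (hsP.1 hv)
  · intro x hx
    refine ⟨∏ x ∈ F, c x, hf, ?_⟩
    have : Submodule.span B (F : Set V) ≤
        (W ⊔ Submodule.span B (s : Set V)).comap (LinearMap.lsmul B V (∏ x ∈ F, c x)) :=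
      Submodule.span_le.mpr fun x hx => by
        rw [SetLike.mem_coe, Submodule.mem_comap, LinearMap.lsmul_apply,
          ← Finset.prod_erase_mul _ _ hx, mul_smul]
        exact Submodule.smul_mem _ _ (hc x hx)
    exact this hx

theorem gen_bot (F : Finset V) : gen B (⊥ : Subgroup H) F = Submodule.span B (F : Set V) := by
  apply le_antisymm
  · refine gen_le_iff.mpr fun h hh x hx => ?_
    rw [Subgroup.mem_bot.mp hh, one_smul]; exact Submodule.subset_span hx
  · exact Submodule.span_le.mpr fun x hx => by
      have := smul_mem_gen (B := B) (one_mem (⊥ : Subgroup H)) hx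
      rwa [one_smul] at this

/-- Generic freeness over polycyclic groups. -/
theorem generic_freeness [IsDomain B] [IsNoetherianRing B] {T : Subgroup H} (hT : Reach T)
    (F : Finset V) (W : Submodule B V) (hst : StableUnder T W) (hle : W ≤ gen B T F) :
    ∃ f : B, f ≠ 0 ∧ ∀ M : Submonoid B, (∀ (h : H), ∀ c ∈ M, h • c ∈ M) →
      (∀ a b : B, a ∣ b → b ∈ M → a ∈ M) → f ∈ M → ∃ s, IsFreeUpTo M W (gen B T F) s := by
  induction hT generalizing W with
  | bot =>
    rw [gen_bot]
    obtain ⟨f, hf, h⟩ := exists_isFreeUpTo_span F W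
    exact ⟨f, hf, fun M _ hM hfM => h M hM hfM⟩
  | @step T T' hTr h2 ih =>
    obtain ⟨hTT, hn, t, ht, htk⟩ := h2
    have htn : ∀ y ∈ T, t⁻¹ * y * t ∈ T := fun y hy => by
      simpa using hn t⁻¹ (inv_mem ht) y hy
    have htn' : ∀ (x : H), x ∈ T' → ∀ y ∈ T, x⁻¹⁻¹ * y * x⁻¹ ∈ T := fun x hx y hy => by
      rw [inv_inv]; exact hn x hx y hy
    set V₀ := gen B T F
    have hV : StableUnder T V₀ := stableUnder_gen T F
    set Z : ℕ → Submodule B V := fun j => W ⊔ psum t V₀ j with hZdef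
    have hZmono : Monotone Z := fun a b hab => sup_le_sup_left (psum_mono t V₀ hab) _
    have hZ0 : Z 0 = W := by simp [hZdef, psum]
    have hZsucc : ∀ j, Z (j + 1) = Z j ⊔ tr (t ^ j) V₀ := fun j => by
      simp only [hZdef, psum_succ, sup_assoc]
    have hZsucc' : ∀ j, Z (j + 1) = tr t (Z j) ⊔ V₀ := fun j => by
      simp only [hZdef, psum_succ', tr_sup, hst.tr_eq ht]
      rw [sup_comm V₀, sup_assoc]
    have hZst : ∀ j, StableUnder T (Z j) := fun j =>
      (hst.mono hTT).sup (stableUnder_psum htn hV j)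
    set X := ⨆ j, Z j with hX
    have hmemX : ∀ v, v ∈ X ↔ ∃ j, v ∈ Z j := fun v =>
      Submodule.mem_iSup_of_directed _ hZmono.directed_le
    have hXst : StableUnder T X := fun g hg v hv => by
      obtain ⟨j, hj⟩ := (hmemX v).mp hv
      exact (hmemX _).mpr ⟨j, hZst j g hg v hj⟩
    have hXt : X = tr t X ⊔ V₀ := by
      apply le_antisymm
      · refine iSup_le fun j => (hZmono (Nat.le_succ j)).trans ?_
        rw [hZsucc']
        exact sup_le_sup_right (tr_mono t (le_iSup Z j)) _
      · refine sup_le (fun v hv => ?_) ?_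
        · obtain ⟨j, hj⟩ := (hmemX _).mp (mem_tr.mp hv)
          refine (hmemX _).mpr ⟨j + 1, ?_⟩
          rw [hZsucc']; exact Submodule.mem_sup_left hj
        · refine le_trans ?_ (le_iSup Z 1)
          rw [hZsucc']; exact le_sup_right
    set A : ℕ → Submodule B V := fun j => V₀ ⊓ tr (t ^ j)⁻¹ (Z j) with hA
    have hAst : ∀ j, StableUnder T (A j) := fun j =>
      hV.inf ((hZst j).translate (htn' _ (pow_mem ht j)))
    have hAmono : Monotone A := monotone_nat_of_le_succ fun j => inf_le_inf_left _ fun v hv => by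
      rw [mem_tr, inv_inv] at hv ⊢
      rw [hZsucc', pow_succ', mul_smul]
      exact Submodule.mem_sup_left (smul_mem_tr.mpr hv)
    obtain ⟨k₀, hk₀⟩ := noetherian_of_reach hTr F A hAmono hAst (fun k => inf_le_left)
    choose f hf0 hf using fun j => ih (A j) (hAst j) inf_le_left
    obtain ⟨f', hf'0, hf'⟩ := ih (V₀ ⊓ tr t X) (hV.inf (hXst.translate htn)) inf_le_left
    refine ⟨f' * ∏ j ∈ Finset.range (k₀ + 1), f j,
      mul_ne_zero hf'0 (Finset.prod_ne_zero_iff.mpr fun j _ => hf0 j), fun M hM1 hM2 hM => ?_⟩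
    have hfj : ∀ j ≤ k₀, f j ∈ M := fun j hj => hM2 _ _ ((Finset.dvd_prod_of_mem f
      (Finset.mem_range.mpr (Nat.lt_succ_of_le hj))).trans (dvd_mul_left _ _)) hM
    obtain ⟨s, hs⟩ := IsFreeUpTo.of_chain hM1 (V₀ := V₀) Z (fun j => t ^ j) hZsucc (fun j => by
      change ∃ s, IsFreeUpTo M (A j) V₀ s
      rcases le_total j k₀ with hj | hj
      · exact hf j M hM1 hM2 (hfj j hj)
      · rw [hk₀ j hj]; exact hf k₀ M hM1 hM2 (hfj k₀ le_rfl))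
    obtain ⟨s', hs'⟩ := IsFreeUpTo.of_chain hM1 (V₀ := V₀) (fun j => tr (t ^ j)⁻¹ X)
      (fun j => (t ^ (j + 1))⁻¹) (fun j => by
        conv_lhs => rw [hXt]
        rw [tr_sup, tr_tr]
        congr 2
        rw [pow_succ', mul_inv_rev, inv_mul_cancel_right]) (fun j => by
      rw [inv_inv, tr_tr, pow_succ', mul_inv_cancel_right]
      exact hf' M hM1 hM2 (hM2 _ _ (dvd_mul_right _ _) hM))
    have e1 : tr (t ^ 0)⁻¹ X = X := by rw [pow_zero, inv_one, tr_one]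
    have hXle : X ≤ gen B T' F := iSup_le fun j => by
      induction j with
      | zero => rw [hZ0]; exact hle
      | succ j ihj =>
        rw [hZsucc]
        refine sup_le ihj ?_
        rw [← (stableUnder_gen T' F).tr_eq (pow_mem ht j)]
        exact tr_mono _ (gen_mono hTT)
    have e2 : ⨆ j : ℕ, tr (t ^ j)⁻¹ X = gen B T' F := by
      apply le_antisymm
      · refine iSup_le fun j => ?_
        rw [← (stableUnder_gen T' F).tr_eq (inv_mem (pow_mem ht j))]
        exact tr_mono _ hXle
      · intro v hv
        obtain ⟨m, N, hmN⟩ := exists_pow_smul_mem_psum hn ht htk hv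
        refine (le_iSup (fun j : ℕ => tr (t ^ j)⁻¹ X) m) ?_
        rw [mem_tr, inv_inv]
        exact (hmemX _).mpr ⟨N, Submodule.mem_sup_right hmN⟩
    rw [e1, e2] at hs'
    rw [hZ0] at hs
    exact ⟨_, hs.trans (hZ0 ▸ le_iSup Z 0) hXle hs'⟩

/-- For generic primes `L`, a module with a torsion-free element is not divisible by `L`. -/
theorem exists_smul_top_ne_top [IsDomain B] [IsNoetherianRing B] (hT : Reach (⊤ : Subgroup H))
    (F : Finset V) (hF : gen B (⊤ : Subgroup H) F = ⊤) (m : V) (hm : ∀ b : B, b ≠ 0 → b • m ≠ 0) :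
    ∃ f : B, f ≠ 0 ∧ ∀ L : Ideal B, L.IsPrime → (∀ h : H, h • f ∉ L) →
      L • (⊤ : Submodule B V) ≠ ⊤ := by
  classical
  obtain ⟨f, hf0, hf⟩ := generic_freeness hT F (⊥ : Submodule B V) .bot bot_le
  refine ⟨f, hf0, fun L hL hfL hLV => ?_⟩
  let M : Submonoid B :=
    { carrier := {c | ∀ h : H, h • c ∉ L}
      one_mem' := fun h => by rw [smul_one]; exact fun h1 => hL.ne_top ((Ideal.eq_top_iff_one L).mpr h1)
      mul_mem' := fun {a b} ha hb h hab => by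
        rw [smul_mul'] at hab
        exact (hL.mem_or_mem hab).elim (ha h) (hb h) }
  obtain ⟨s, hs⟩ := hf M (fun h c hc g hg => hc (g * h) (by rwa [mul_smul]))
    (fun a b ⟨c, hc⟩ hb h ha => hb h (by rw [hc, smul_mul']; exact L.mul_mem_right _ ha)) hfL
  rw [hF] at hs
  have h0 : ∀ c ∈ M, c ≠ 0 := fun c hc h => hc 1 (by rw [h, smul_zero]; exact L.zero_mem)
  have hne : s.Nonempty := by
    rw [Set.nonempty_iff_ne_empty]
    rintro rfl
    obtain ⟨c, hc, hcm⟩ := hs.tors m trivial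
    rw [Submodule.span_empty, sup_bot_eq, Submodule.mem_bot] at hcm
    exact hm c (h0 c hc) hcm
  obtain ⟨v, hv⟩ := hne
  have key : ∀ x ∈ L • (⊤ : Submodule B V), ∃ c ∈ M, c • x ∈ L • Submodule.span B s := by
    intro x hx
    induction hx using Submodule.smul_induction_on' with
    | smul r hr n hn =>
      obtain ⟨c, hc, hcn⟩ := hs.tors n trivial
      rw [bot_sup_eq] at hcn
      exact ⟨c, hc, by rw [smul_comm]; exact Submodule.smul_mem_smul hr hcn⟩
    | add x _ y _ hx hy =>
      obtain ⟨c, hc, hcx⟩ := hx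
      obtain ⟨d, hd, hdy⟩ := hy
      refine ⟨c * d, mul_mem hc hd, ?_⟩
      rw [smul_add]
      refine Submodule.add_mem _ ?_ ?_
      · rw [mul_comm, mul_smul]; exact Submodule.smul_mem _ _ hcx
      · rw [mul_smul]; exact Submodule.smul_mem _ _ hdy
  obtain ⟨c, hc, hcv⟩ := key v (by rw [hLV]; trivial)
  have h1 := (Submodule.mem_ideal_smul_span_iff_exists_sum' L s (id : V → V) (c • v)).mp
    (by rwa [Set.image_id])
  obtain ⟨a, ha, hav⟩ := h1
  have h2 := hs.indep (insert v (a.support.map (Function.Embedding.subtype _)))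
    (fun w => (if h : w ∈ s then a ⟨w, h⟩ else 0) - if w = v then c else 0)
    (by
      intro w hw
      rw [Finset.mem_coe, Finset.mem_insert, Finset.mem_map] at hw
      rcases hw with rfl | ⟨w, _, rfl⟩
      · exact hv
      · exact w.2)
    (by
      rw [Submodule.mem_bot]
      simp only [sub_smul, Finset.sum_sub_distrib, ite_smul, zero_smul]
      rw [Finset.sum_ite_eq' _ v, if_pos (Finset.mem_insert_self _ _), ← hav, sub_eq_zero]
      rw [Finset.sum_insert_of_eq_zero_if_notMem]
      · rw [Finset.sum_map, Finsupp.sum]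
        refine Finset.sum_congr rfl fun w _ => ?_
        simp
      · intro hvn
        have : a ⟨v, hv⟩ = 0 := by
          by_contra h
          exact hvn (Finset.mem_map.mpr ⟨⟨v, hv⟩, Finsupp.mem_support_iff.mpr h, rfl⟩)
        rw [dif_pos hv, this, zero_smul]) v (Finset.mem_insert_self _ _)
  simp only [dif_pos hv, if_true, sub_eq_zero] at h2
  have := hc 1
  rw [one_smul, ← h2] at this
  exact this (ha _)

end GenericFreeness

end

section RelIndex
variable {H : Type*} [Group H]

theorem exists_finset_of_relIndex_ne_zero {S T : Subgroup H} (h : S.relIndex T ≠ 0) :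
    ∃ R : Finset H, (∀ r ∈ R, r ∈ T) ∧ ∀ x ∈ T, ∃ r ∈ R, r⁻¹ * x ∈ S := by
  classical
  have hfi : (S.subgroupOf T).FiniteIndex := ⟨h⟩
  have : Finite (T ⧸ S.subgroupOf T) := inferInstance
  have := Fintype.ofFinite (T ⧸ S.subgroupOf T)
  refine ⟨Finset.univ.image fun c : T ⧸ S.subgroupOf T => (c.out : H), ?_, fun x hx => ?_⟩
  · intro r hr
    obtain ⟨c, _, rfl⟩ := Finset.mem_image.mp hr
    exact c.out.2
  · refine ⟨_, Finset.mem_image_of_mem _ (Finset.mem_univ (QuotientGroup.mk ⟨x, hx⟩)), ?_⟩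
    have := QuotientGroup.eq.mp (QuotientGroup.out_eq' (QuotientGroup.mk ⟨x, hx⟩ : T ⧸ S.subgroupOf T))
    exact Subgroup.mem_subgroupOf.mp this

theorem relIndex_ne_zero_of_finite_cover {S T : Subgroup H} {R : Set H} (hR : R.Finite)
    (h : ∀ x ∈ T, ∃ r ∈ R, r⁻¹ * x ∈ S) : S.relIndex T ≠ 0 := by
  have := hR.to_subtype
  choose! f hfR hf using h
  have : Finite (T ⧸ S.subgroupOf T) := by
    refine Finite.of_injective (fun c => (⟨f c.out, hfR _ c.out.2⟩ : R)) fun c d hcd => ?_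
    have h1 := hf _ c.out.2
    have h2 := hf _ d.out.2
    have h3 : f c.out = f d.out := congrArg Subtype.val hcd
    rw [← h3] at h2
    rw [← QuotientGroup.out_eq' c, ← QuotientGroup.out_eq' d, QuotientGroup.eq,
      Subgroup.mem_subgroupOf]
    have := mul_mem (inv_mem h1) h2
    simpa using this
  exact Subgroup.index_ne_zero_of_finite

theorem mem_comap_conj_inv {S : Subgroup H} {t g : H} :
    g ∈ S.comap (MulAut.conj t⁻¹).toMonoidHom ↔ t⁻¹ * g * t ∈ S := by
  rw [Subgroup.mem_comap]
  change t⁻¹ * g * t⁻¹⁻¹ ∈ S ↔ _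
  rw [inv_inv]

theorem relIndex_conj_ne_zero {S T : Subgroup H} (h : S.relIndex T ≠ 0) {t : H}
    (ht : ∀ y ∈ T, t⁻¹ * y * t ∈ T) : (S.comap (MulAut.conj t⁻¹).toMonoidHom).relIndex T ≠ 0 := by
  obtain ⟨R, -, hR⟩ := exists_finset_of_relIndex_ne_zero h
  refine relIndex_ne_zero_of_finite_cover (R := (fun r => t * r * t⁻¹) '' (R : Set H))
    (R.finite_toSet.image _) fun x hx => ?_
  obtain ⟨r, hr, hrx⟩ := hR _ (ht x hx)
  refine ⟨_, ⟨r, hr, rfl⟩, ?_⟩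
  rw [mem_comap_conj_inv]
  convert hrx using 1
  group

/-- Finite index is preserved by cyclic extensions as soon as a positive power of the generator
is contained in the subgroup. -/
theorem relIndex_ne_zero_of_cyclic {S S' T T' : Subgroup H} (h : S.relIndex T ≠ 0) (hS : S ≤ S')
    {t : H} (ht : t ∈ T') (hn : ∀ x ∈ T', ∀ y ∈ T, x * y * x⁻¹ ∈ T)
    (htk : ∀ x ∈ T', ∃ k : ℤ, x * t ^ k ∈ T) {k : ℕ} (hk : 0 < k) (htS : t ^ k ∈ S') :
    S'.relIndex T' ≠ 0 := by
  obtain ⟨R, -, hR⟩ := exists_finset_of_relIndex_ne_zero h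
  refine relIndex_ne_zero_of_finite_cover
    (R := (fun x : ℕ × H => t ^ x.1 * x.2) '' ((Finset.range k : Set ℕ) ×ˢ (R : Set H)))
    (((Finset.finite_toSet _).prod R.finite_toSet).image _) fun x hx => ?_
  obtain ⟨n, hxn⟩ := htk x hx
  have hk' : (k : ℤ) ≠ 0 := by exact_mod_cast hk.ne'
  obtain ⟨i, hi⟩ := Int.eq_ofNat_of_zero_le (Int.emod_nonneg (-n) hk')
  have hik : i < k := by
    have := Int.emod_lt_of_pos (-n) (by exact_mod_cast hk : (0 : ℤ) < k)
    omega
  have hdiv := Int.mul_ediv_add_emod (-n) k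
  rw [hi] at hdiv
  set m := -n / (k : ℤ)
  have h1 := hn (t ^ i)⁻¹ (inv_mem (pow_mem ht i)) _ hxn
  obtain ⟨r, hr, hrx⟩ := hR _ h1
  refine ⟨_, ⟨(i, r), ⟨by simpa using hik, hr⟩, rfl⟩, ?_⟩
  have h2 : t ^ (k * m : ℤ) ∈ S' := by
    rw [zpow_mul, zpow_natCast]; exact zpow_mem htS m
  have h3 := mul_mem (hS hrx) h2
  convert h3 using 1
  have h4 : n = -(k * m + i : ℤ) := by omega
  rw [h4]
  simp only [mul_inv_rev, inv_inv, ← zpow_natCast]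
  group

end RelIndex

section LieKolchin
variable {H K W : Type*} [Group H] [Field K] [AddCommGroup W] [Module K W]

theorem exists_character (ρ : H →* Module.End K W) {S : Subgroup H} {w : W} (hw : w ≠ 0)
    (h : ∀ g ∈ S, ∃ c : K, ρ g w = c • w) : ∃ χ : S →* K, ∀ g : S, ρ g w = χ g • w := by
  choose! c hc using h
  refine ⟨⟨⟨fun g => c g, ?_⟩, fun a b => ?_⟩, fun g => hc g g.2⟩
  · have := hc 1 (one_mem S)
    rw [map_one, Module.End.one_apply] at this
    exact smul_left_injective K hw (by simpa using this.symm)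
  · have := hc _ (a * b).2
    rw [Subgroup.coe_mul, map_mul, Module.End.mul_apply, hc b b.2, map_smul, hc a a.2,
      smul_smul] at this
    exact smul_left_injective K hw (by simpa [mul_comm] using this.symm)

theorem linearIndependent_of_characters (ρ : H →* Module.End K W) {S : Subgroup H} {ι : Type*}
    {w : ι → W} (hw : ∀ i, w i ≠ 0) (χ : ι → S →* K) (hχ : ∀ i (g : S), ρ g (w i) = χ i g • w i)
    (hinj : Function.Injective χ) : LinearIndependent K w := by
  rw [linearIndependent_iff']
  intro s a ha i hi
  have hli := (linearIndependent_monoidHom S K).comp χ hinj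
  rw [linearIndependent_iff'] at hli
  have key : a i • w i = 0 := by
    rw [← Module.forall_dual_apply_eq_zero_iff K]
    intro f
    have := hli s (fun j => a j * f (w j)) (by
      ext g
      have h1 := congrArg (fun x => f (ρ g x)) ha
      simp only [map_sum, map_smul, hχ, map_zero, smul_eq_mul] at h1
      simp only [Finset.sum_apply, Pi.smul_apply, smul_eq_mul, Pi.zero_apply, Function.comp]
      rw [← h1]
      exact Finset.sum_congr rfl fun j _ => by ring) i hi
    rw [map_smul, smul_eq_mul]; exact this
  exact (smul_eq_zero.mp key).resolve_right (hw i)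

/-- A finite-dimensional representation of a polycyclic group over an algebraically closed field
has a vector spanning a line stabilised by a subgroup of finite index. -/
theorem exists_virtual_eigenvector [IsAlgClosed K] [FiniteDimensional K W] [Nontrivial W]
    (ρ : H →* Module.End K W) {T : Subgroup H} (hT : Reach T) :
    ∃ w : W, w ≠ 0 ∧ ∃ S : Subgroup H, S.relIndex T ≠ 0 ∧ ∀ g ∈ S, ∃ c : K, ρ g w = c • w := by
  induction hT with
  | bot =>
    obtain ⟨w, hw⟩ := exists_ne (0 : W)
    refine ⟨w, hw, ⊥, by simp, fun g hg => ⟨1, ?_⟩⟩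
    rw [Subgroup.mem_bot.mp hg, map_one, one_smul, Module.End.one_apply]
  | @step T T' _ h2 ih =>
    obtain ⟨hTT, hn, t, ht, htk⟩ := h2
    obtain ⟨w, hw, S, hS, hwS⟩ := ih
    have hinj : ∀ g : H, Function.Injective (ρ g) := fun g => by
      refine Function.LeftInverse.injective (g := ρ g⁻¹) fun x => ?_
      rw [← Module.End.mul_apply, ← map_mul, inv_mul_cancel, map_one, Module.End.one_apply]
    have hne : ∀ (g : H) {x : W}, x ≠ 0 → ρ g x ≠ 0 := fun g x hx h =>
      hx (hinj g (by rw [h, map_zero]))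
    have htn : ∀ (j : ℕ), ∀ y ∈ T, (t ^ j)⁻¹ * y * t ^ j ∈ T := fun j y hy => by
      simpa using hn (t ^ j)⁻¹ (inv_mem (pow_mem ht j)) y hy
    set d := Module.finrank K W
    let S' : ℕ → Subgroup H := fun j => S.comap (MulAut.conj (t ^ j)⁻¹).toMonoidHom
    set S₀ : Subgroup H := ⨅ j : Fin (d + 1), S' j
    have hS₀ : S₀.relIndex T ≠ 0 :=
      Subgroup.relIndex_iInf_ne_zero fun j => relIndex_conj_ne_zero hS (htn j)
    have hconj : ∀ (g x : H) (v : W), ρ x (ρ g v) = ρ g (ρ (g⁻¹ * x * g) v) := fun g x v => by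
      simp only [← Module.End.mul_apply, ← map_mul]
      congr 2; group
    have hchar : ∀ j : Fin (d + 1), ∃ χ : S₀ →* K, ∀ g : S₀,
        ρ g (ρ (t ^ (j : ℕ)) w) = χ g • ρ (t ^ (j : ℕ)) w := fun j => by
      refine exists_character ρ (hne _ hw) fun g hg => ?_
      have : (t ^ (j : ℕ))⁻¹ * g * t ^ (j : ℕ) ∈ S :=
        mem_comap_conj_inv.mp ((Subgroup.mem_iInf.mp hg) j)
      obtain ⟨c, hc⟩ := hwS _ this
      exact ⟨c, by rw [hconj, hc, map_smul]⟩
    choose χ hχ using hchar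
    have hnot : ¬ Function.Injective χ := fun hi => by
      have := (linearIndependent_of_characters ρ (fun j => hne _ hw) χ hχ hi).fintype_card_le_finrank
      simp [d] at this
    obtain ⟨i, j, hij, hlt⟩ : ∃ i j, χ i = χ j ∧ i < j := by
      simp only [Function.Injective, not_forall] at hnot
      obtain ⟨i, j, h1, h2⟩ := hnot
      rcases lt_or_gt_of_ne h2 with h | h
      · exact ⟨i, j, h1, h⟩
      · exact ⟨j, i, h1.symm, h⟩
    set k : ℕ := (j : ℕ) - i
    have hk : 0 < k := Nat.sub_pos_of_lt hlt
    set u := ρ (t ^ (i : ℕ)) w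
    have hu : u ≠ 0 := hne _ hw
    have hku : ρ (t ^ k) u = ρ (t ^ (j : ℕ)) w := by
      rw [← Module.End.mul_apply, ← map_mul, ← pow_add]
      congr 3
      exact Nat.sub_add_cancel hlt.le
    have hχk : ∀ (g : S₀) (hg : (t ^ k)⁻¹ * g * t ^ k ∈ S₀), χ i ⟨_, hg⟩ = χ i g := fun g hg => by
      have h1 := hχ j g
      rw [← hku, hconj, hχ i ⟨_, hg⟩, map_smul, ← hij] at h1
      exact smul_left_injective K (hne (t ^ k) hu) h1
    let W' : Submodule K W :=
      { carrier := {v | ∃ S₁ : Subgroup H, S₁.relIndex T ≠ 0 ∧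
          ∀ g ∈ S₁, ∀ hg : g ∈ S₀, ρ g v = χ i ⟨g, hg⟩ • v}
        add_mem' := by
          rintro a b ⟨S₁, h1, h1'⟩ ⟨S₂, h2, h2'⟩
          refine ⟨S₁ ⊓ S₂, Subgroup.relIndex_inf_ne_zero h1 h2, fun g hg hg0 => ?_⟩
          rw [map_add, h1' g hg.1 hg0, h2' g hg.2 hg0, smul_add]
        zero_mem' := ⟨S₀, hS₀, fun g _ _ => by rw [map_zero, smul_zero]⟩
        smul_mem' := by
          rintro c a ⟨S₁, h1, h1'⟩
          exact ⟨S₁, h1, fun g hg hg0 => by rw [map_smul, h1' g hg hg0, smul_comm]⟩ }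
    have hstab : ∀ v ∈ W', ρ (t ^ k) v ∈ W' := by
      rintro v ⟨S₁, h1, h1'⟩
      refine ⟨S₀ ⊓ (S₀ ⊓ S₁).comap (MulAut.conj (t ^ k)⁻¹).toMonoidHom,
        Subgroup.relIndex_inf_ne_zero hS₀ (relIndex_conj_ne_zero
          (Subgroup.relIndex_inf_ne_zero hS₀ h1) (htn k)), fun g hg hg0 => ?_⟩
      have h3 : (t ^ k)⁻¹ * g * t ^ k ∈ S₀ ⊓ S₁ := mem_comap_conj_inv.mp hg.2
      rw [hconj, h1' _ h3.2 h3.1, map_smul, hχk ⟨g, hg0⟩]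
    have huW : u ∈ W' := ⟨S₀, hS₀, fun g _ hg => hχ i ⟨g, hg⟩⟩
    have : Nontrivial W' := ⟨⟨u, huW⟩, 0, fun h => hu (congrArg Subtype.val h)⟩
    obtain ⟨c, hc⟩ := Module.End.exists_eigenvalue ((ρ (t ^ k)).restrict hstab)
    obtain ⟨v, hv⟩ := hc.exists_hasEigenvector
    have hv0 : (v : W) ≠ 0 := fun h => hv.2 (Subtype.ext h)
    have hvc : ρ (t ^ k) v = c • (v : W) := congrArg Subtype.val hv.apply_eq_smul
    obtain ⟨S₁, h1, h1'⟩ := v.2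
    have hcne : c ≠ 0 := by
      rintro rfl
      rw [zero_smul] at hvc
      exact hne _ hv0 hvc
    let St : Subgroup H :=
      { carrier := {g | ∃ c : K, ρ g v = c • (v : W)}
        mul_mem' := by
          rintro a b ⟨c, hc⟩ ⟨d, hd⟩
          exact ⟨d * c, by rw [map_mul, Module.End.mul_apply, hd, map_smul, hc, smul_smul]⟩
        one_mem' := ⟨1, by rw [map_one, one_smul, Module.End.one_apply]⟩
        inv_mem' := by
          rintro a ⟨c, hc⟩
          have hc0 : c ≠ 0 := by
            rintro rfl
            rw [zero_smul] at hc
            exact hne _ hv0 hc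
          refine ⟨c⁻¹, hinj a ?_⟩
          rw [← Module.End.mul_apply, ← map_mul, mul_inv_cancel, map_one, Module.End.one_apply,
            map_smul, hc, smul_smul, inv_mul_cancel₀ hc0, one_smul] }
    refine ⟨v, hv0, St, ?_, fun g hg => hg⟩
    exact relIndex_ne_zero_of_cyclic (S := S₀ ⊓ S₁) (Subgroup.relIndex_inf_ne_zero hS₀ h1)
      (fun g hg => ⟨_, h1' g hg.2 hg.1⟩) ht hn htk hk ⟨c, hvc⟩

end LieKolchin

open Polynomial in
theorem exists_prime_dvd_eval (g : ℤ[X]) (hg : 0 < g.natDegree) (M : ℤ) (hM : M ≠ 0) :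
    ∃ l : ℕ, l.Prime ∧ ¬ (l : ℤ) ∣ M ∧ ∃ k : ℤ, (l : ℤ) ∣ g.eval k := by
  by_cases hc : g.eval 0 = 0
  · obtain ⟨l, hl, hlp⟩ := Nat.exists_infinite_primes (M.natAbs + 1)
    refine ⟨l, hlp, fun h => ?_, 0, by rw [hc]; exact dvd_zero _⟩
    have := Nat.le_of_dvd (Int.natAbs_pos.mpr hM) (Int.natCast_dvd.mp h)
    omega
  · set c := g.eval 0 with hcdef
    have hne : ∀ d : ℤ, g - C d ≠ 0 := fun d h => by
      rw [sub_eq_zero.mp h, natDegree_C] at hg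
      exact lt_irrefl _ hg
    have hpol : (g - C c) * (g - C (-c)) ≠ 0 := mul_ne_zero (hne _) (hne _)
    have hinf : (Set.range fun x : ℤ => M * c * x).Infinite :=
      Set.infinite_range_of_injective fun x y h => mul_left_cancel₀ (mul_ne_zero hM hc) h
    obtain ⟨_, ⟨x, rfl⟩, hx⟩ := hinf.exists_notMem_finset ((g - C c) * (g - C (-c))).roots.toFinset
    rw [Multiset.mem_toFinset, mem_roots hpol, IsRoot.def, eval_mul, mul_eq_zero, not_or] at hx
    simp only [eval_sub, eval_C, sub_eq_zero] at hx
    obtain ⟨w, hw⟩ := sub_dvd_eval_sub (M * c * x) 0 g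
    have hfac : g.eval (M * c * x) = c * (1 + M * (x * w)) := by
      rw [← hcdef] at hw
      linear_combination hw
    set u := 1 + M * (x * w) with hu
    have hu1 : u.natAbs ≠ 1 := fun h => by
      rcases Int.natAbs_eq_iff.mp h with h | h
      · exact hx.1 (by rw [hfac, h]; simp)
      · exact hx.2 (by rw [hfac, h]; simp)
    refine ⟨u.natAbs.minFac, Nat.minFac_prime hu1, fun h => ?_, M * c * x, ?_⟩
    · have h1 : (u.natAbs.minFac : ℤ) ∣ u := Int.natCast_dvd.mpr (Nat.minFac_dvd _)
      have h2 : (u.natAbs.minFac : ℤ) ∣ 1 := by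
        have := dvd_sub h1 (h.mul_right (x * w))
        rwa [hu, add_sub_cancel_right] at this
      have := (Nat.minFac_prime hu1).one_lt
      have h3 := Int.le_of_dvd one_pos h2
      omega
    · rw [hfac]
      exact (Int.natCast_dvd.mpr (Nat.minFac_dvd _)).mul_left _

open Polynomial in
theorem exists_clear_denominators (f : ℚ[X]) : ∃ N : ℤ, N ≠ 0 ∧ ∃ g : ℤ[X],
    g.map (Int.castRingHom ℚ) = C (N : ℚ) * f := by
  obtain ⟨b, hb, h⟩ := IsLocalization.integerNormalization_spec (nonZeroDivisors ℤ) f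
  refine ⟨b, nonZeroDivisors.ne_zero hb, _, h.trans ?_⟩
  rw [zsmul_eq_mul]
  simp

open Polynomial in
/-- Every number field embeds into `ℚ_ℓ` for some prime `ℓ` outside a given finite set. -/
theorem exists_padic_embedding (E : Type*) [Field E] [Algebra ℚ E] [FiniteDimensional ℚ E]
    (m : ℤ) (hm : m ≠ 0) :
    ∃ (l : ℕ) (_ : Fact l.Prime), ¬ (l : ℤ) ∣ m ∧ Nonempty (E →+* ℚ_[l]) := by
  have pb := Field.powerBasisOfFiniteOfSeparable ℚ E
  have hirr : Irreducible (minpoly ℚ pb.gen) := minpoly.irreducible pb.isIntegral_gen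
  obtain ⟨a, b, hab⟩ := hirr.separable
  obtain ⟨N₁, hN₁, g, hg⟩ := exists_clear_denominators (minpoly ℚ pb.gen)
  obtain ⟨N₂, hN₂, a', ha'⟩ := exists_clear_denominators a
  obtain ⟨N₃, hN₃, b', hb'⟩ := exists_clear_denominators b
  have hdeg : 0 < g.natDegree := by
    have h1 : (g.map (Int.castRingHom ℚ)).natDegree = g.natDegree :=
      natDegree_map_eq_of_injective (RingHom.injective_int _) g
    rw [← h1, hg, natDegree_C_mul (by exact_mod_cast hN₁)]
    exact minpoly.natDegree_pos pb.isIntegral_gen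
  have hbez : C N₃ * a' * g + C N₂ * b' * derivative g = C (N₁ * N₂ * N₃) := by
    apply map_injective (Int.castRingHom ℚ) (RingHom.injective_int _)
    have hC : ∀ N : ℤ, (C N).map (Int.castRingHom ℚ) = C (N : ℚ) := fun N => by
      rw [Polynomial.map_C]; rfl
    simp only [Polynomial.map_add, Polynomial.map_mul, hC, ← derivative_map, hg, ha', hb',
      derivative_C_mul, C_mul]
    linear_combination (C (N₁ : ℚ) * C (N₂ : ℚ) * C (N₃ : ℚ)) * hab
  obtain ⟨l, hl, hlm, k, hk⟩ := exists_prime_dvd_eval g hdeg (m * (N₁ * N₂ * N₃))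
    (mul_ne_zero hm (mul_ne_zero (mul_ne_zero hN₁ hN₂) hN₃))
  have : Fact l.Prime := ⟨hl⟩
  refine ⟨l, this, fun h => hlm (h.mul_right _), ?_⟩
  have hder : ¬ (l : ℤ) ∣ (derivative g).eval k := fun h => by
    have := congrArg (eval k) hbez
    simp only [eval_add, eval_mul, eval_C] at this
    refine hlm (Dvd.dvd.mul_left ?_ _)
    rw [← this]
    exact dvd_add (hk.mul_left _) (h.mul_left _)
  have hcast : ∀ f : ℤ[X], aeval (k : ℤ_[l]) f = ((f.eval k : ℤ) : ℤ_[l]) := fun f => by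
    have := aeval_algebraMap_apply ℤ_[l] k f
    simpa using this
  have h1 : ‖aeval (k : ℤ_[l]) g‖ < 1 := by
    rw [hcast]; exact (PadicInt.norm_int_lt_one_iff_dvd _).mpr hk
  have h2 : ‖aeval (k : ℤ_[l]) (derivative g)‖ = 1 := by
    apply le_antisymm (PadicInt.norm_le_one _)
    rw [hcast]
    exact not_lt.mp fun h => hder ((PadicInt.norm_int_lt_one_iff_dvd _).mp h)
  obtain ⟨z, hz, -⟩ := hensels_lemma (F := g) (a := (k : ℤ_[l])) (by rw [h2]; simpa using h1)
  refine ⟨(pb.lift (z : ℚ_[l]) ?_).toRingHom⟩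
  have h3 : aeval (z : ℚ_[l]) g = 0 := by
    have := aeval_algebraMap_apply ℚ_[l] z g
    rw [hz, map_zero] at this
    exact this
  have h4 : aeval (z : ℚ_[l]) (g.map (Int.castRingHom ℚ)) = 0 := by
    rw [aeval_def, eval₂_map]
    rw [show (algebraMap ℚ ℚ_[l]).comp (Int.castRingHom ℚ) = algebraMap ℤ ℚ_[l] from
      Subsingleton.elim _ _]
    exact h3
  rw [hg, map_mul, aeval_C, mul_eq_zero] at h4
  exact h4.resolve_left (by simpa using hN₁)

/-- A `Q`-module `A` is a plinth if every nonzero subgroup of `A` invariant under a finite-index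
subgroup of `Q` has torsion quotient. -/
def IsPlinth (Q A : Type*) [Group Q] [AddCommGroup A] [DistribMulAction Q A] : Prop :=
  ∀ C : AddSubgroup A, C ≠ ⊥ → ∀ S : Subgroup Q, S.FiniteIndex →
    (∀ q ∈ S, ∀ a ∈ C, q • a ∈ C) → ∀ a : A, ∃ n : ℕ, 0 < n ∧ n • a ∈ C

section
variable {Q A : Type*} [Group Q] [AddCommGroup A] [DistribMulAction Q A]

/-- The contragredient action on linear forms with values in a field. -/
def dualRep (K : Type*) [Field K] : Q →* Module.End K (A →ₗ[ℤ] K) where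
  toFun q :=
    { toFun := fun w => w ∘ₗ (DistribSMul.toAddMonoidHom A q⁻¹).toIntLinearMap
      map_add' := fun _ _ => rfl
      map_smul' := fun _ _ => rfl }
  map_one' := by
    ext w a
    simp
  map_mul' q r := by
    ext w a
    simp [mul_smul]

@[simp] theorem dualRep_apply (K : Type*) [Field K] (q : Q) (w : A →ₗ[ℤ] K) (a : A) :
    dualRep K q w a = w (q⁻¹ • a) := rfl

theorem exists_injective_virtual_eigenform [Module.Free ℤ A] [Module.Finite ℤ A] [Nontrivial A]
    (hQ : Reach (⊤ : Subgroup Q)) (hpl : IsPlinth Q A) (K : Type*) [Field K] [IsAlgClosed K]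
    [CharZero K] :
    ∃ w : A →ₗ[ℤ] K, Function.Injective w ∧ ∃ S : Subgroup Q, S.FiniteIndex ∧
      ∀ q ∈ S, ∃ c : K, ∀ a, w (q • a) = c * w a := by
  have hfin : Module.Finite K (A →ₗ[ℤ] K) := Module.Finite.linearMap ℤ K A K
  have hnt : Nontrivial (A →ₗ[ℤ] K) := by
    let b := Module.Free.chooseBasis ℤ A
    have : Nonempty (Module.Free.ChooseBasisIndex ℤ A) := b.index_nonempty
    obtain ⟨i⟩ := this
    refine ⟨(Algebra.linearMap ℤ K) ∘ₗ b.coord i, 0, fun h => ?_⟩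
    have := LinearMap.congr_fun h (b i)
    simp at this
  obtain ⟨w, hw, S, hS, hSw⟩ := exists_virtual_eigenvector (dualRep (Q := Q) (A := A) K) hQ
  have hSf : S.FiniteIndex := ⟨by rwa [Subgroup.relIndex_top_right] at hS⟩
  have key : ∀ q ∈ S, ∃ c : K, ∀ a, w (q • a) = c * w a := fun q hq => by
    obtain ⟨c, hc⟩ := hSw q⁻¹ (S.inv_mem hq)
    refine ⟨c, fun a => ?_⟩
    have := LinearMap.congr_fun hc a
    simpa using this
  refine ⟨w, ?_, S, hSf, key⟩
  by_contra hinj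
  have hker : w.toAddMonoidHom.ker ≠ ⊥ := fun h => hinj ((AddMonoidHom.ker_eq_bot_iff _).mp h)
  refine hw (LinearMap.ext fun a => ?_)
  obtain ⟨n, hn, hna⟩ := hpl _ hker S hSf (fun q hq a ha => by
    obtain ⟨c, hc⟩ := key q hq
    have ha' : w a = 0 := ha
    change w (q • a) = 0
    rw [hc, ha', mul_zero]) a
  have h2 : w (n • a) = 0 := hna
  rw [map_nsmul, nsmul_eq_mul, mul_eq_zero] at h2
  exact h2.resolve_left (by exact_mod_cast hn.ne')

theorem exists_padic_eigenform [Module.Free ℤ A] [Module.Finite ℤ A] [Nontrivial A]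
    (hQ : Reach (⊤ : Subgroup Q)) (hpl : IsPlinth Q A) (m : ℤ) (hm : m ≠ 0) :
    ∃ (l : ℕ) (_ : Fact l.Prime), ¬ (l : ℤ) ∣ m ∧ ∃ (φ : A →+ ℤ_[l]) (a₀ : A),
      Function.Injective φ ∧ φ a₀ = 1 ∧ ∃ S : Subgroup Q, S.FiniteIndex ∧
        ∀ q ∈ S, ∀ a, φ (q • a) = φ (q • a₀) * φ a := by
  obtain ⟨w, hw, S, hSf, hS⟩ :=
    exists_injective_virtual_eigenform hQ hpl (AlgebraicClosure ℚ)
  let b := Module.Free.chooseBasis ℤ A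
  have hspan : ∀ T : AddSubgroup A, (∀ i, b i ∈ T) → ∀ a, a ∈ T := fun T hT a => by
    have h1 : Submodule.span ℤ (Set.range b) ≤ AddSubgroup.toIntSubmodule T :=
      Submodule.span_le.mpr (by rintro _ ⟨i, rfl⟩; exact hT i)
    rw [b.span_eq] at h1
    exact h1 (Submodule.mem_top (x := a))
  let E := IntermediateField.adjoin ℚ (Set.range fun i => w (b i))
  have hE : FiniteDimensional ℚ E := by
    have : Finite (Set.range fun i => w (b i)) := Set.finite_range _
    exact IntermediateField.finiteDimensional_adjoin fun x _ => by
      have h := ((AlgebraicClosure.isAlgebraic ℚ).isAlgebraic x).isIntegral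
      convert h
      exact Subsingleton.elim _ _
  have hwE : ∀ a, w a ∈ E := hspan (E.toSubfield.toSubring.toAddSubgroup.comap w.toAddMonoidHom)
    fun i => IntermediateField.subset_adjoin _ _ ⟨i, rfl⟩
  obtain ⟨l, hl, hlm, ⟨j⟩⟩ := exists_padic_embedding E m hm
  let w' : A →+ E :=
    { toFun := fun a => ⟨w a, hwE a⟩
      map_zero' := Subtype.ext (map_zero w)
      map_add' := fun x y => Subtype.ext (map_add w x y) }
  let ψ : A →+ ℚ_[l] := j.toAddMonoidHom.comp w'
  have hψ : Function.Injective ψ := fun x y h =>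
    hw (congrArg Subtype.val (j.injective h : w' x = w' y))
  have : Nonempty (Module.Free.ChooseBasisIndex ℤ A) := b.index_nonempty
  obtain ⟨i, hi⟩ := Finite.exists_max fun i => ‖ψ (b i)‖
  have hle : ∀ a, ‖ψ a‖ ≤ ‖ψ (b i)‖ := hspan
    { carrier := {a | ‖ψ a‖ ≤ ‖ψ (b i)‖}
      zero_mem' := by simp
      add_mem' := fun {x y} hx hy => by
        have := Padic.nonarchimedean (ψ x) (ψ y)
        rw [Set.mem_ofPred_eq, map_add]
        exact this.trans (max_le hx hy)
      neg_mem' := fun {x} hx => by simpa using hx } hi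
  have h0 : ψ (b i) ≠ 0 := fun h => b.ne_zero i (hψ (h.trans (map_zero ψ).symm))
  have hn0 : 0 < ‖ψ (b i)‖ := norm_pos_iff.mpr h0
  let φ : A →+ ℤ_[l] :=
    { toFun := fun a => ⟨ψ a / ψ (b i), by rw [norm_div]; exact (div_le_one hn0).mpr (hle a)⟩
      map_zero' := Subtype.ext (by simp)
      map_add' := fun x y => Subtype.ext (by
        change ψ (x + y) / ψ (b i) = ψ x / ψ (b i) + ψ y / ψ (b i)
        rw [map_add, add_div]) }
  have hφ : ∀ a, ((φ a : ℤ_[l]) : ℚ_[l]) = ψ a / ψ (b i) := fun _ => rfl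
  refine ⟨l, hl, hlm, φ, b i, fun x y h => hψ ?_, ?_, S, hSf, fun q hq a => ?_⟩
  · have := congrArg (fun z : ℤ_[l] => (z : ℚ_[l])) h
    simp only [hφ] at this
    exact (div_left_inj' h0).mp this
  · apply Subtype.ext
    change ψ (b i) / ψ (b i) = 1
    exact div_self h0
  · obtain ⟨c, hc⟩ := hS q hq
    have h1 : w' (q • a) * w' (b i) = w' (q • b i) * w' a := Subtype.ext (by
      change w (q • a) * w (b i) = w (q • b i) * w a
      rw [hc, hc]; ring)
    have h2 : ψ (q • a) * ψ (b i) = ψ (q • b i) * ψ a := by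
      have := congrArg j h1
      rwa [map_mul, map_mul] at this
    apply Subtype.ext
    change ψ (q • a) / ψ (b i) = ψ (q • b i) / ψ (b i) * (ψ a / ψ (b i))
    field_simp
    linear_combination h2

end

theorem sq_dvd_one_add_pow_sub {R : Type*} [CommRing R] (a : R) (y : ℕ) :
    a ^ 2 ∣ (1 + a) ^ y - 1 - y * a := by
  induction y with
  | zero => simp
  | succ y ih =>
    obtain ⟨z, hz⟩ := ih
    refine ⟨z * (1 + a) + y, ?_⟩
    push_cast
    rw [pow_succ]
    linear_combination (1 + a) * hz

/-- The closed subgroup of `ℤ_ℓˣ` generated by `p` contains `1 + ℓ ^ s ℤ_ℓ` for some `s`. -/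
theorem exists_modEq_pow {p l : ℕ} (hp : p.Prime) (hl : l.Prime) (hl2 : l ≠ 2) (hlp : l ≠ p) :
    ∃ s : ℕ, ∀ (r : ℕ) (x : ℤ), (l : ℤ) ^ s ∣ x - 1 → ∃ i : ℕ, (l : ℤ) ^ r ∣ x - (p : ℤ) ^ i := by
  have : Fact l.Prime := ⟨hl⟩
  have hlZ : Prime (l : ℤ) := Nat.prime_iff_prime_int.mp hl
  have hcop : p.Coprime l := (Nat.coprime_primes hp hl).mpr hlp.symm
  set u := p ^ (l - 1) with hu
  have hu1 : 1 < u := Nat.one_lt_pow (by have := hl.two_le; omega) hp.one_lt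
  have hlu : l ∣ u - 1 := by
    have h := Nat.ModEq.pow_totient hcop
    rw [Nat.totient_prime hl] at h
    exact (Nat.modEq_iff_dvd' hu1.le).mp h.symm
  have hlu' : ¬ l ∣ u := fun h => by
    have := (Nat.dvd_sub_iff_right hu1.le h).mp hlu
    exact hl.one_lt.ne' (Nat.dvd_one.mp this)
  have hlpow : ∀ i : ℕ, ¬ (l : ℤ) ∣ (p : ℤ) ^ i := fun i h => by
    have h1 := hlZ.dvd_of_dvd_pow h
    have h2 := (Nat.prime_dvd_prime_iff_eq hl hp).mp (by exact_mod_cast h1)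
    exact hlp h2
  set s := padicValNat l (u - 1) with hs
  have hs1 : 1 ≤ s := one_le_padicValNat_of_dvd (by omega) hlu
  have hpow : ∀ t : ℕ, ∃ c : ℤ, (u : ℤ) ^ l ^ t = 1 + (l : ℤ) ^ (s + t) * c ∧ ¬ (l : ℤ) ∣ c :=
      fun t => by
    have hv := padicValNat.pow_sub_pow (hl.odd_of_ne_two hl2) hu1 hlu hlu'
      (n := l ^ t) (pow_ne_zero _ hl.ne_zero)
    rw [one_pow, padicValNat.prime_pow, ← hs] at hv
    have hne : u ^ l ^ t - 1 ≠ 0 := by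
      have := Nat.one_lt_pow (pow_ne_zero t hl.ne_zero) hu1
      omega
    obtain ⟨c, hc⟩ := (padicValNat_dvd_iff_le (p := l) hne (n := s + t)).mpr hv.ge
    refine ⟨c, ?_, fun h => ?_⟩
    · have h1 : u ^ l ^ t = 1 + l ^ (s + t) * c := by omega
      exact_mod_cast h1
    · have h1 : l ^ (s + t + 1) ∣ u ^ l ^ t - 1 := by
        rw [hc, pow_succ]
        exact mul_dvd_mul_left _ (by exact_mod_cast h)
      have := (padicValNat_dvd_iff_le (p := l) hne).mp h1
      omega
  have main : ∀ (t : ℕ) (x : ℤ), (l : ℤ) ^ s ∣ x - 1 →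
      ∃ i : ℕ, (l : ℤ) ^ (s + t) ∣ x - (p : ℤ) ^ i := by
    intro t
    induction t with
    | zero => intro x hx; exact ⟨0, by simpa using hx⟩
    | succ t ih =>
      intro x hx
      obtain ⟨i, z, hz⟩ := ih x hx
      obtain ⟨c, hc, hlc⟩ := hpow t
      have hunit : ¬ (l : ℤ) ∣ (p : ℤ) ^ i * c := fun h =>
        (hlZ.dvd_or_dvd h).elim (hlpow i) hlc
      have hco : IsCoprime (l : ℤ) ((p : ℤ) ^ i * c) :=
        (Prime.coprime_iff_not_dvd hlZ).mpr hunit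
      obtain ⟨v, w, hvw⟩ := hco
      have hlpos : (0 : ℤ) < l := by exact_mod_cast hl.pos
      obtain ⟨y, hy⟩ := Int.eq_ofNat_of_zero_le (Int.emod_nonneg (z * w) hlpos.ne')
      have hyz : (l : ℤ) ∣ z - (p : ℤ) ^ i * c * y := by
        rw [← hy]
        have h1 : (z * w) % l = z * w - l * (z * w / l) := Int.emod_def _ _
        rw [h1]
        exact ⟨v * z + (p : ℤ) ^ i * c * (z * w / l), by linear_combination -z * hvw⟩
      refine ⟨i + (l - 1) * l ^ t * y, ?_⟩
      have hup : (p : ℤ) ^ (i + (l - 1) * l ^ t * y) =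
          (p : ℤ) ^ i * (1 + (l : ℤ) ^ (s + t) * c) ^ y := by
        rw [← hc, hu, pow_add, pow_mul, pow_mul]
        push_cast
        rfl
      obtain ⟨g, hg⟩ := sq_dvd_one_add_pow_sub ((l : ℤ) ^ (s + t) * c) y
      obtain ⟨g', hg'⟩ := hyz
      have hsq : (l : ℤ) ^ (s + (t + 1)) ∣ ((l : ℤ) ^ (s + t) * c) ^ 2 := by
        rw [mul_pow, ← pow_mul]
        exact Dvd.dvd.mul_right (pow_dvd_pow _ (by omega)) _
      have heq : x - (p : ℤ) ^ i * (1 + (l : ℤ) ^ (s + t) * c) ^ y =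
          (l : ℤ) ^ (s + (t + 1)) * g' -
            ((l : ℤ) ^ (s + t) * c) ^ 2 * ((p : ℤ) ^ i * g) := by
        have : (l : ℤ) ^ (s + (t + 1)) = (l : ℤ) ^ (s + t) * l := by rw [← add_assoc, pow_succ]
        rw [this]
        linear_combination hz + (l : ℤ) ^ (s + t) * hg' - (p : ℤ) ^ i * hg
      rw [hup, heq]
      exact dvd_sub (dvd_mul_right _ _) (hsq.mul_right _)
  refine ⟨s, fun r x hx => ?_⟩
  obtain ⟨i, hi⟩ := main r x hx
  exact ⟨i, (pow_dvd_pow _ (Nat.le_add_left _ _)).trans hi⟩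

section
variable {A K : Type*} [AddCommGroup A] [Field K] {p N : ℕ} [Fact p.Prime] [Algebra (ZMod p) K]

/-- Evaluation of the group algebra at the `x`-th power of the character `ψ ∘ θ`. -/
noncomputable def charEval (ψ : AddChar (ZMod N) K) (θ : A →+ ZMod N) (x : ZMod N) :
    AddMonoidAlgebra (ZMod p) A →ₐ[ZMod p] K :=
  AddMonoidAlgebra.lift (ZMod p) K A
    { toFun := fun a => ψ (x * θ a.toAdd)
      map_one' := by simp
      map_mul' := fun a b => by simp [mul_add, AddChar.map_add_eq_mul] }

theorem charEval_single (ψ : AddChar (ZMod N) K) (θ : A →+ ZMod N) (x : ZMod N) (a : A)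
    (c : ZMod p) : charEval ψ θ x (AddMonoidAlgebra.single a c) = c • ψ (x * θ a) := by
  rw [charEval, AddMonoidAlgebra.lift_single]
  rfl

theorem charEval_eq_sum (ψ : AddChar (ZMod N) K) (θ : A →+ ZMod N) (x : ZMod N)
    (f : AddMonoidAlgebra (ZMod p) A) :
    charEval ψ θ x f = ∑ a ∈ f.coeff.support, f.coeff a • ψ (x * θ a) := by
  rw [charEval, AddMonoidAlgebra.lift_apply]
  rfl

theorem charEval_pow (ψ : AddChar (ZMod N) K) (θ : A →+ ZMod N) (x : ZMod N) (i : ℕ)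
    (f : AddMonoidAlgebra (ZMod p) A) :
    charEval ψ θ (p ^ i * x) f = charEval ψ θ x f ^ p ^ i := by
  have : CharP K p := charP_of_injective_algebraMap (algebraMap (ZMod p) K).injective p
  induction f using AddMonoidAlgebra.induction_linear with
  | zero => simp [(Fact.out : p.Prime).ne_zero]
  | add f g hf hg => rw [map_add, map_add, hf, hg, add_pow_char_pow]
  | single a c =>
    rw [charEval_single, charEval_single, smul_pow, ZMod.pow_card_pow, ← AddChar.map_nsmul_eq_pow,
      nsmul_eq_mul]
    push_cast
    rw [mul_assoc]

theorem exists_charEval_ne_zero (ψ : AddChar (ZMod N) K) (hψ : Function.Injective ψ)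
    (θ : A →+ ZMod N) (M : ZMod N) (f : AddMonoidAlgebra (ZMod p) A) (hf : f ≠ 0)
    (hinj : Set.InjOn (fun a => M * θ a) f.coeff.support) :
    ∃ y : ℕ, charEval ψ θ (1 + M * y) f ≠ 0 := by
  by_contra! h
  let F : f.coeff.support → (Multiplicative ℕ →* K) := fun a => powersHom K (ψ (M * θ a))
  have hF : Function.Injective F := fun a b hab => by
    have h1 := (powersHom K).injective hab
    exact Subtype.ext (hinj a.2 b.2 (hψ h1))
  have hli := (linearIndependent_monoidHom (Multiplicative ℕ) K).comp F hF
  rw [Fintype.linearIndependent_iff] at hli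
  have hz := hli (fun a => f.coeff a • ψ (θ a)) (by
    ext y
    have h1 := h y.toAdd
    rw [charEval_eq_sum, ← Finset.sum_coe_sort] at h1
    rw [Finset.sum_apply, Pi.zero_apply, ← h1]
    refine Finset.sum_congr rfl fun a _ => ?_
    simp only [Pi.smul_apply, Function.comp_apply, F, powersHom_apply, smul_eq_mul]
    rw [smul_mul_assoc, ← AddChar.map_nsmul_eq_pow, ← AddChar.map_add_eq_mul, nsmul_eq_mul]
    congr 2
    ring)
  obtain ⟨a, ha⟩ : f.coeff.support.Nonempty := by
    rw [Finsupp.support_nonempty_iff]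
    intro h0
    exact hf (by ext a; rw [h0]; rfl)
  have h1 := hz ⟨a, ha⟩
  rw [Algebra.smul_def, mul_eq_zero] at h1
  rcases h1 with h1 | h1
  · exact Finsupp.mem_support_iff.mp ha ((map_eq_zero _).mp h1)
  · exact (ψ.val_isUnit (θ a)).ne_zero h1

/-- The ring endomorphism of the group algebra induced by the action on the group. -/
noncomputable def conjHom (p : ℕ) {H : Type*} [Group H] [DistribMulAction H A] (h : H) :
    AddMonoidAlgebra (ZMod p) A →+* AddMonoidAlgebra (ZMod p) A :=
  AddMonoidAlgebra.mapDomainRingHom (ZMod p) (DistribSMul.toAddMonoidHom A h)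

theorem conjHom_single {H : Type*} [Group H] [DistribMulAction H A] (h : H) (a : A) (c : ZMod p) :
    conjHom p h (AddMonoidAlgebra.single a c) = AddMonoidAlgebra.single (h • a) c := by
  simp [conjHom]

theorem charEval_conjHom {H : Type*} [Group H] [DistribMulAction H A] (ψ : AddChar (ZMod N) K)
    (θ : A →+ ZMod N) (x c : ZMod N) (h : H) (hc : ∀ a, θ (h • a) = c * θ a)
    (f : AddMonoidAlgebra (ZMod p) A) :
    charEval ψ θ x (conjHom p h f) = charEval ψ θ (x * c) f := by
  induction f using AddMonoidAlgebra.induction_linear with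
  | zero => simp
  | add f g hf hg => simp only [map_add, hf, hg]
  | single a d => rw [conjHom_single, charEval_single, charEval_single, hc, mul_assoc]

end

section
variable {A H : Type*} [AddCommGroup A] [Group H] [DistribMulAction H A] {p l : ℕ}
  [Fact p.Prime] [Fact l.Prime]

theorem exists_toZModPow_injOn (φ : A →+ ℤ_[l]) (hφ : Function.Injective φ) (s : ℕ)
    (T : Finset A) :
    ∃ r : ℕ, Set.InjOn (fun a => (l : ZMod (l ^ r)) ^ s * PadicInt.toZModPow r (φ a)) T := by
  have hz : ∀ z : ℤ_[l], z ≠ 0 → ∃ r : ℕ, ∀ r', r ≤ r' → PadicInt.toZModPow r' z ≠ 0 := by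
    intro z hz
    by_contra! h
    refine hz ?_
    rw [← PadicInt.ext_of_toZModPow]
    intro n
    obtain ⟨r', hr', h0⟩ := h n
    rw [map_zero]
    have h1 : z ∈ RingHom.ker (PadicInt.toZModPow (p := l) r') := h0
    rw [PadicInt.ker_toZModPow, Ideal.mem_span_singleton] at h1
    have h2 : z ∈ RingHom.ker (PadicInt.toZModPow (p := l) n) := by
      rw [PadicInt.ker_toZModPow, Ideal.mem_span_singleton]
      exact (pow_dvd_pow _ hr').trans h1
    exact h2
  have hl0 : (l : ℤ_[l]) ≠ 0 := by exact_mod_cast (Fact.out : l.Prime).ne_zero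
  have hpair : ∀ ab : A × A, ∃ r : ℕ, ab.1 ≠ ab.2 → ∀ r', r ≤ r' →
      PadicInt.toZModPow r' ((l : ℤ_[l]) ^ s * (φ ab.1 - φ ab.2)) ≠ 0 := fun ab => by
    by_cases h : ab.1 = ab.2
    · exact ⟨0, fun h' => absurd h h'⟩
    · obtain ⟨r, hr⟩ := hz ((l : ℤ_[l]) ^ s * (φ ab.1 - φ ab.2))
        (mul_ne_zero (pow_ne_zero _ hl0) (sub_ne_zero.mpr fun h' => h (hφ h')))
      exact ⟨r, fun _ => hr⟩
  choose R hR using hpair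
  refine ⟨(T ×ˢ T).sup R, fun a ha b hb hab => ?_⟩
  by_contra hne
  refine hR (a, b) hne _ (Finset.le_sup (Finset.mem_product.mpr ⟨ha, hb⟩)) ?_
  simp only at hab
  simp only [map_mul, map_pow, map_natCast, map_sub, mul_sub, hab, sub_self]

theorem exists_prime_ideal_of_eigenform (hlp : l ≠ p) (s : ℕ)
    (hs : ∀ (r : ℕ) (x : ℤ), (l : ℤ) ^ s ∣ x - 1 → ∃ i : ℕ, (l : ℤ) ^ r ∣ x - (p : ℤ) ^ i)
    (φ : A →+ ℤ_[l]) (hφ : Function.Injective φ) (a₀ : A) (ha₀ : φ a₀ = 1)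
    (hH : ∀ h : H, ∃ c : ℤ_[l], (l : ℤ_[l]) ^ s ∣ c - 1 ∧ ∀ a, φ (h • a) = c * φ a)
    (f : AddMonoidAlgebra (ZMod p) A) (hf : f ≠ 0) :
    ∃ L : Ideal (AddMonoidAlgebra (ZMod p) A), L.IsPrime ∧ (∀ h : H, conjHom p h f ∉ L) ∧
      ∃ C : AddSubgroup A, C ≠ ⊥ ∧ (∀ h : H, ∀ a ∈ C, h • a ∈ C) ∧
        ∀ a ∈ C, AddMonoidAlgebra.single a 1 - 1 ∈ L := by
  have hl : l.Prime := Fact.out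
  obtain ⟨r, hr⟩ := exists_toZModPow_injOn φ hφ s f.coeff.support
  let K := AlgebraicClosure (ZMod p)
  have : NeZero (l ^ r) := ⟨pow_ne_zero _ hl.ne_zero⟩
  have hchar : CharP K p := charP_of_injective_algebraMap (algebraMap (ZMod p) K).injective p
  have hNe : NeZero ((l ^ r : ℕ) : K) := ⟨by
    rw [Nat.cast_pow]
    refine pow_ne_zero _ fun h => hlp ?_
    rw [CharP.cast_eq_zero_iff K p] at h
    exact ((Nat.prime_dvd_prime_iff_eq Fact.out hl).mp h).symm⟩
  obtain ⟨ζ, hζ⟩ := HasEnoughRootsOfUnity.exists_primitiveRoot K (l ^ r)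
  let ψ : AddChar (ZMod (l ^ r)) K := AddChar.zmodChar (l ^ r) hζ.pow_eq_one
  have hψ : Function.Injective ψ := fun x y hxy => by
    simp only [ψ, AddChar.zmodChar_apply] at hxy
    exact ZMod.val_injective _ (hζ.pow_inj (ZMod.val_lt x) (ZMod.val_lt y) hxy)
  let θ : A →+ ZMod (l ^ r) := (PadicInt.toZModPow r).toAddMonoidHom.comp φ
  have hcast : ∀ x i : ℤ, (l : ℤ) ^ r ∣ x - i → (x : ZMod (l ^ r)) = i := fun x i h => by
    rw [ZMod.intCast_eq_intCast_iff_dvd_sub]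
    have := (dvd_neg.mpr h)
    push_cast
    rwa [neg_sub] at this
  have hpx : ∀ x : ℤ, (l : ℤ) ^ s ∣ x - 1 → ∃ i : ℕ,
      charEval ψ θ (x : ZMod (l ^ r)) f = charEval ψ θ 1 f ^ p ^ i := fun x hx => by
    obtain ⟨i, hi⟩ := hs r x hx
    refine ⟨i, ?_⟩
    rw [← charEval_pow, mul_one, hcast x _ hi]
    push_cast
    rfl
  have hev : charEval ψ θ 1 f ≠ 0 := fun h0 => by
    obtain ⟨y, hy⟩ := exists_charEval_ne_zero ψ hψ θ ((l : ZMod (l ^ r)) ^ s) f hf hr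
    obtain ⟨i, hi⟩ := hpx (1 + (l : ℤ) ^ s * y) ⟨y, by ring⟩
    push_cast at hi
    refine hy (hi.trans ?_)
    rw [h0, zero_pow (pow_ne_zero _ (Fact.out : p.Prime).ne_zero)]
  refine ⟨RingHom.ker (charEval ψ θ 1 : _ →ₐ[ZMod p] K), RingHom.ker_isPrime _, fun h hmem => ?_,
    θ.ker, fun hbot => ?_, fun h a ha => ?_, fun a ha => ?_⟩
  · obtain ⟨c, hc1, hc⟩ := hH h
    have hx := PadicInt.appr_spec (r + s) c
    rw [Ideal.mem_span_singleton] at hx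
    have hxs : (l : ℤ) ^ s ∣ (c.appr (r + s) : ℤ) - 1 := by
      rw [← PadicInt.pow_p_dvd_int_iff]
      have h1 : (l : ℤ_[l]) ^ s ∣ c - c.appr (r + s) :=
        (pow_dvd_pow _ (Nat.le_add_left _ _)).trans hx
      have h2 := dvd_sub hc1 h1
      push_cast
      rwa [sub_sub_sub_cancel_left] at h2
    have hcr : PadicInt.toZModPow r c = ((c.appr (r + s) : ℤ) : ZMod (l ^ r)) := by
      have h1 : c - c.appr (r + s) ∈ RingHom.ker (PadicInt.toZModPow (p := l) r) := by
        rw [PadicInt.ker_toZModPow, Ideal.mem_span_singleton]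
        exact (pow_dvd_pow _ (Nat.le_add_right _ _)).trans hx
      rw [RingHom.mem_ker, map_sub, map_natCast, sub_eq_zero] at h1
      rw [h1]
      push_cast
      rfl
    obtain ⟨i, hi⟩ := hpx _ hxs
    rw [RingHom.mem_ker, charEval_conjHom ψ θ 1 (PadicInt.toZModPow r c) h
      (fun a => by simp [θ, hc]), one_mul, hcr, hi] at hmem
    exact hev (eq_zero_of_pow_eq_zero hmem)
  · have h1 : l ^ r • a₀ ∈ θ.ker := by
      rw [AddMonoidHom.mem_ker, map_nsmul, nsmul_eq_mul, ZMod.natCast_self, zero_mul]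
    rw [hbot, AddSubgroup.mem_bot] at h1
    have h2 := congrArg φ h1
    rw [map_nsmul, ha₀, map_zero, nsmul_one] at h2
    exact (pow_ne_zero r hl.ne_zero) (by exact_mod_cast h2)
  · obtain ⟨c, -, hc⟩ := hH h
    rw [AddMonoidHom.mem_ker] at ha ⊢
    have : θ (h • a) = PadicInt.toZModPow r c * θ a := by simp [θ, hc]
    rw [this, ha, mul_zero]
  · rw [RingHom.mem_ker, map_sub, map_one, charEval_single, AddMonoidHom.mem_ker.mp ha]
    simp

end

section

open Submodule

section
variable {Q A : Type*} [Group Q] [AddCommGroup A] [DistribMulAction Q A]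

theorem exists_finiteIndex_eigen {l : ℕ} [Fact l.Prime] (φ : A →+ ℤ_[l]) {a₀ : A}
    (ha₀ : φ a₀ = 1) (S : Subgroup Q) [S.FiniteIndex]
    (hS : ∀ q ∈ S, ∀ a, φ (q • a) = φ (q • a₀) * φ a) (s : ℕ) :
    ∃ S' : Subgroup Q, S'.FiniteIndex ∧
      ∀ q ∈ S', ∃ c : ℤ_[l], (l : ℤ_[l]) ^ s ∣ c - 1 ∧ ∀ a, φ (q • a) = c * φ a := by
  have : NeZero (l ^ s) := ⟨pow_ne_zero _ (Fact.out : l.Prime).ne_zero⟩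
  let χ : S →* ZMod (l ^ s) :=
    { toFun := fun q => PadicInt.toZModPow s (φ (q.1 • a₀))
      map_one' := by simp [ha₀]
      map_mul' := fun q r => by
        rw [Subgroup.coe_mul, mul_smul, hS q.1 q.2, map_mul] }
  refine ⟨χ.toHomUnits.ker.map S.subtype, ⟨?_⟩, ?_⟩
  · rw [Subgroup.index_map_subtype]
    exact mul_ne_zero Subgroup.FiniteIndex.index_ne_zero Subgroup.FiniteIndex.index_ne_zero
  · rintro _ ⟨q, hq, rfl⟩
    refine ⟨φ (q.1 • a₀), ?_, hS q.1 q.2⟩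
    have h1 : χ q = 1 := by
      have := congrArg Units.val (MonoidHom.mem_ker.mp hq)
      simpa using this
    rw [← Ideal.mem_span_singleton, ← PadicInt.ker_toZModPow, RingHom.mem_ker, map_sub, map_one,
      sub_eq_zero]
    exact h1

end

section
variable {k G V : Type*} [Field k] [Group G] [AddCommGroup V] [Module k V]

/-- A representation is finitely generated if it is spanned by finitely many orbits. -/
def IsFGRep (ρ : G →* Module.End k V) : Prop :=
  ∃ F : Finset V, span k {v | ∃ g, ∃ x ∈ F, v = ρ g x} = ⊤

open Classical in
theorem IsFGRep.restrict {ρ : G →* Module.End k V} (h : IsFGRep ρ) (S : Subgroup G)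
    [hS : S.FiniteIndex] : IsFGRep (ρ.comp S.subtype) := by
  obtain ⟨F, hF⟩ := h
  obtain ⟨R, -, hR⟩ := exists_finset_of_relIndex_ne_zero (S := S) (T := ⊤)
    (by rw [Subgroup.relIndex_top_right]; exact hS.index_ne_zero)
  refine ⟨R.biUnion fun r => F.image fun x => ρ r⁻¹ x, ?_⟩
  rw [eq_top_iff, ← hF, span_le]
  rintro _ ⟨g, x, hx, rfl⟩
  obtain ⟨r, hr, hrg⟩ := hR g⁻¹ (Subgroup.mem_top _)
  refine subset_span ⟨⟨_, S.inv_mem hrg⟩, ρ r⁻¹ x, ?_, ?_⟩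
  · exact Finset.mem_biUnion.mpr ⟨r, hr, Finset.mem_image_of_mem _ hx⟩
  · simp only [MonoidHom.comp_apply, Subgroup.subtype_apply]
    rw [← Module.End.mul_apply, ← map_mul]
    congr 2
    group

end

section
variable {p : ℕ} [Fact p.Prime] {Q A V : Type*} [Group Q] [AddCommGroup A] [DistribMulAction Q A]
  [AddCommGroup V] [Module (ZMod p) V]

theorem lift_apply_comm (τ : Multiplicative A →* Module.End (ZMod p) V)
    (φ : V →ₗ[ZMod p] V) (g : AddMonoidAlgebra (ZMod p) A →+* AddMonoidAlgebra (ZMod p) A)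
    (σ : A → A) (hg : ∀ a c, g (AddMonoidAlgebra.single a c) = AddMonoidAlgebra.single (σ a) c)
    (h : ∀ a w, φ (τ (.ofAdd a) w) = τ (.ofAdd (σ a)) (φ w))
    (b : AddMonoidAlgebra (ZMod p) A) (w : V) :
    φ (AddMonoidAlgebra.lift _ _ _ τ b w) = AddMonoidAlgebra.lift _ _ _ τ (g b) (φ w) := by
  induction b using AddMonoidAlgebra.induction_linear with
  | zero => simp
  | add b c hb hc => simp only [map_add, LinearMap.add_apply, hb, hc]
  | single a c =>
    simp only [hg, AddMonoidAlgebra.lift_single, LinearMap.smul_apply, map_smul, h]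

/-- The faithful case: a plinth acting faithfully has a nonzero virtually invariant subgroup with
nonzero coinvariants. -/
theorem exists_coinvariants_of_faithful [Module.Free ℤ A] [Module.Finite ℤ A] [Nontrivial A]
    (hQ : Reach (⊤ : Subgroup Q)) (hpl : IsPlinth Q A)
    (ρ : Q →* Module.End (ZMod p) V) (τ : Multiplicative A →* Module.End (ZMod p) V)
    (hρτ : ∀ q a w, ρ q (τ (.ofAdd a) w) = τ (.ofAdd (q • a)) (ρ q w)) (hfg : IsFGRep ρ)
    (hendo : ∃ m : V, ∀ v, ∃ φ : V →ₗ[ZMod p] V,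
      (∀ a w, φ (τ (.ofAdd a) w) = τ (.ofAdd a) (φ w)) ∧ φ m = v)
    (hJ : ∀ b, AddMonoidAlgebra.lift (ZMod p) _ A τ b = 0 → b = 0) :
    ∃ C : AddSubgroup A, C ≠ ⊥ ∧ ∃ S : Subgroup Q, S.FiniteIndex ∧
      (∀ q ∈ S, ∀ a ∈ C, q • a ∈ C) ∧
      span (ZMod p) {v | ∃ a ∈ C, ∃ w, v = τ (.ofAdd a) w - w} ≠ ⊤ := by
  have hp : p.Prime := Fact.out
  obtain ⟨l, hl, hlm, φ, a₀, hφ, ha₀, S, hSf, hS⟩ :=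
    exists_padic_eigenform hQ hpl (2 * p) (mul_ne_zero two_ne_zero (by exact_mod_cast hp.ne_zero))
  have hl2 : l ≠ 2 := fun h => hlm (by rw [h]; exact dvd_mul_right _ _)
  have hlp : l ≠ p := fun h => hlm (by rw [h]; exact dvd_mul_left _ _)
  obtain ⟨s, hs⟩ := exists_modEq_pow hp hl.out hl2 hlp
  obtain ⟨H, hHf, hH⟩ := exists_finiteIndex_eigen φ ha₀ S hS s
  let B := AddMonoidAlgebra (ZMod p) A
  let Λ : B →ₐ[ZMod p] Module.End (ZMod p) V := AddMonoidAlgebra.lift (ZMod p) _ A τ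
  let _ : Module B V := Module.compHom V Λ.toRingHom
  let _ : DistribMulAction H V := DistribMulAction.compHom V (ρ.comp H.subtype)
  let _ : MulSemiringAction H B :=
    { smul := fun h b => conjHom p h b
      one_smul := fun b => by
        change conjHom p (1 : H) b = b
        induction b using AddMonoidAlgebra.induction_linear with
        | zero => simp
        | add b c hb hc => rw [map_add, hb, hc]
        | single a c => rw [conjHom_single, one_smul]
      mul_smul := fun g h b => by
        change conjHom p (g * h) b = conjHom p g (conjHom p h b)
        induction b using AddMonoidAlgebra.induction_linear with
        | zero => simp
        | add b c hb hc => simp only [map_add, hb, hc]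
        | single a c => simp only [conjHom_single, mul_smul]
      smul_zero := fun h => map_zero (conjHom p h)
      smul_add := fun h => map_add (conjHom p h)
      smul_one := fun h => map_one (conjHom p h)
      smul_mul := fun h => map_mul (conjHom p h) }
  have hsmul : ∀ (b : B) (v : V), b • v = Λ b v := fun _ _ => rfl
  have hsmulH : ∀ (h : H) (v : V), h • v = ρ h v := fun _ _ => rfl
  have hconj : ∀ (h : H) (b : B), h • b = conjHom p h b := fun _ _ => rfl
  have : SemilinAct H B V := ⟨fun h b v => by
    rw [hsmul, hsmul, hsmulH, hsmulH, hconj]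
    exact lift_apply_comm τ (ρ h) (conjHom p h) _ (fun a c => conjHom_single h a c)
      (fun a w => hρτ h a w) b v⟩
  have : IsAddTorsionFree A := by
    have : Module.IsTorsionFree ℤ A := inferInstance
    exact IsAddTorsionFree.of_isTorsionFree ℤ A
  have hft : AddMonoid.FG A :=
    AddGroup.fg_iff_addMonoid_fg.mp (Module.Finite.iff_addGroup_fg.mp inferInstance)
  have hdom : IsDomain B := by
    have : NoZeroDivisors (AddMonoidAlgebra (ZMod p) A) := inferInstance
    exact NoZeroDivisors.to_isDomain (AddMonoidAlgebra (ZMod p) A)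
  have hnoeth : IsNoetherianRing B := Algebra.FiniteType.isNoetherianRing (ZMod p) _
  obtain ⟨m, hm⟩ := hendo
  obtain ⟨F, hF⟩ := hfg.restrict H
  have hsc : ∀ (c : ZMod p) (v : V), c • v = (AddMonoidAlgebra.single 0 c : B) • v := fun c v => by
    rw [hsmul, AddMonoidAlgebra.lift_single]
    simp
  have htop : ∀ (W : Submodule B V) (X : Set V), X ⊆ W → span (ZMod p) X = ⊤ → W = ⊤ :=
      fun W X hX hXt => by
    rw [eq_top_iff]
    intro v _
    have hv : v ∈ span (ZMod p) X := by rw [hXt]; trivial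
    induction hv using span_induction with
    | mem x hx => exact hX hx
    | zero => exact W.zero_mem
    | add x y _ _ hx hy => exact W.add_mem (hx trivial) (hy trivial)
    | smul c x _ hx => rw [hsc]; exact W.smul_mem _ (hx trivial)
  obtain ⟨f, hf, hfL⟩ := exists_smul_top_ne_top (H := H) (B := B) (V := V) (hQ.top_subgroup H) F
    (htop _ _ (by
      rintro _ ⟨g, x, hx, rfl⟩
      exact subset_span ⟨g, Subgroup.mem_top _, x, hx, rfl⟩) hF) m (fun b hb hbm => by
      refine hb (hJ b (LinearMap.ext fun v => ?_))
      obtain ⟨ψ, hψ, rfl⟩ := hm v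
      have h1 := lift_apply_comm τ ψ (RingHom.id _) id (fun _ _ => rfl) hψ b m
      rw [hsmul] at hbm
      rw [LinearMap.zero_apply]
      refine h1.symm.trans ?_
      change ψ (Λ b m) = 0
      rw [hbm, map_zero])
  obtain ⟨L, hLp, hLf, C, hC, hCH, hCL⟩ := exists_prime_ideal_of_eigenform (H := H) hlp s hs φ hφ
    a₀ ha₀ (fun h => hH h.1 h.2) f hf
  refine ⟨C, hC, H, hHf, fun q hq => hCH ⟨q, hq⟩, fun htop' => hfL L hLp hLf ?_⟩
  refine htop _ _ ?_ htop'
  rintro _ ⟨a, ha, w, rfl⟩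
  have h1 : τ (.ofAdd a) w - w = (AddMonoidAlgebra.single a 1 - 1 : B) • w := by
    have h2 : Λ (AddMonoidAlgebra.single a 1) = τ (.ofAdd a) :=
      (AddMonoidAlgebra.lift_single _ _ _).trans (one_smul _ _)
    rw [hsmul, map_sub, map_one, h2]
    rfl
  rw [h1]
  exact smul_mem_smul (hCL a ha) trivial

end

end

section

open Module Pointwise

open Classical in
/-- If every translate of `W` contains a member of a fixed finite family of nonzero subspaces,
then `W` contains a nonzero virtually invariant subspace. -/
theorem exists_virtually_invariant_of_cover {K U Q : Type*} [Field K] [AddCommGroup U] [Module K U]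
    [FiniteDimensional K U] [Group Q] [DistribMulAction Q U] [SMulCommClass Q K U]
    (W : Submodule K U) (F : Finset (Submodule K U)) (hF : ∀ D ∈ F, D ≠ ⊥)
    (hcov : ∀ q : Q, ∃ D ∈ F, q • D ≤ W) :
    ∃ E : Submodule K U, E ≠ ⊥ ∧ E ≤ W ∧ (MulAction.stabilizer Q E).FiniteIndex := by
  have hfr : ∀ (q : Q) (D : Submodule K U), finrank K (q • D : Submodule K U) = finrank K D :=
    fun q D => LinearEquiv.finrank_map_eq (DistribMulAction.toLinearEquiv K U q) D
  let Cov : ℕ → ℕ → Prop := fun k c => ∃ F : Finset (Submodule K U),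
    (∀ q : Q, ∃ D ∈ F, q • D ≤ W) ∧ (∀ D ∈ F, k ≤ finrank K D) ∧
      (F.filter fun D : Submodule K U => finrank K D = k).card ≤ c
  obtain ⟨k, hk1, hk, hk'⟩ : ∃ k, 1 ≤ k ∧ (∃ c, Cov k c) ∧ ¬ ∃ c, Cov (k + 1) c := by
    by_contra! h
    have hall : ∀ k, ∃ c, Cov (k + 1) c := by
      intro k
      induction k with
      | zero =>
        exact ⟨_, F, hcov, fun D hD => Nat.one_le_iff_ne_zero.mpr fun h0 =>
          hF D hD (Submodule.finrank_eq_zero.mp h0), le_rfl⟩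
      | succ k ih =>
        obtain ⟨c, hc⟩ := ih
        exact h (k + 1) (by omega) ⟨c, hc⟩
    obtain ⟨c, F', hF', hr, -⟩ := hall (finrank K U)
    obtain ⟨D, hD, -⟩ := hF' 1
    have h1 := hr D hD
    have h2 := Submodule.finrank_le D
    omega
  obtain ⟨F', hF', hr, hc⟩ := Nat.find_spec hk
  have hmin : ∀ c, Cov k c → Nat.find hk ≤ c := fun c hc => Nat.find_min' hk hc
  obtain ⟨D, hD, hDk⟩ : ∃ D ∈ F', finrank K D = k := by
    by_contra! h
    exact hk' ⟨_, F', hF', fun D hD => Nat.lt_of_le_of_ne (hr D hD) (h D hD).symm, le_rfl⟩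
  have herase : ((F'.erase D).filter fun D : Submodule K U => finrank K D = k).card + 1 ≤ Nat.find hk := by
    rw [Finset.filter_erase, Finset.card_erase_add_one (Finset.mem_filter.mpr ⟨hD, hDk⟩)]
    exact hc
  obtain ⟨g, hg⟩ : ∃ g : Q, g • D ≤ W := by
    by_contra! h
    have := hmin (Nat.find hk - 1) ⟨F'.erase D, fun q => by
      obtain ⟨D', hD', hq⟩ := hF' q
      exact ⟨D', Finset.mem_erase.mpr ⟨fun he => h q (he ▸ hq), hD'⟩, hq⟩,
      fun D' hD' => hr D' (Finset.mem_of_mem_erase hD'), by omega⟩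
    omega
  have horb : ∀ h : Q, ∃ D' ∈ F', h • D' = D := by
    by_contra! hcon
    obtain ⟨h, hh⟩ := hcon
    have hlt : ∀ D' ∈ F', k < finrank K (D ⊔ h • D' : Submodule K U) := fun D' hD' => by
      refine lt_of_le_of_ne (hDk ▸ Submodule.finrank_mono le_sup_left) fun he => hh D' hD' ?_
      have h1 : D = D ⊔ h • D' :=
        Submodule.eq_of_le_of_finrank_le le_sup_left (by rw [← he, hDk])
      have h2 : h • D' ≤ D := le_sup_right.trans h1.ge
      refine Submodule.eq_of_le_of_finrank_le h2 ?_
      rw [hfr, hDk]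
      exact hr D' hD'
    have := hmin (Nat.find hk - 1) ⟨F'.erase D ∪ F'.image (fun D' => D ⊔ h • D'), fun q => ?_,
      fun D' hD' => ?_, ?_⟩
    · omega
    · obtain ⟨D₁, hD₁, hq₁⟩ := hF' q
      by_cases he : D₁ = D
      · subst he
        obtain ⟨D', hD', hq⟩ := hF' (q * h)
        refine ⟨_, Finset.mem_union_right _ (Finset.mem_image_of_mem _ hD'), ?_⟩
        rw [Submodule.smul_sup', smul_smul]
        exact sup_le hq₁ hq
      · exact ⟨D₁, Finset.mem_union_left _ (Finset.mem_erase.mpr ⟨he, hD₁⟩), hq₁⟩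
    · rcases Finset.mem_union.mp hD' with h1 | h1
      · exact hr D' (Finset.mem_of_mem_erase h1)
      · obtain ⟨D₁, hD₁, rfl⟩ := Finset.mem_image.mp h1
        exact (hlt D₁ hD₁).le
    · have : ((F'.image (fun D' => D ⊔ h • D')).filter fun D : Submodule K U => finrank K D = k) = ∅ := by
        rw [Finset.filter_eq_empty_iff]
        intro D' hD'
        obtain ⟨D₁, hD₁, rfl⟩ := Finset.mem_image.mp hD'
        exact (hlt D₁ hD₁).ne'
      rw [Finset.filter_union, this, Finset.union_empty]
      omega
  have hfin : (MulAction.orbit Q D).Finite := by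
    refine F'.finite_toSet.subset ?_
    rintro _ ⟨h, rfl⟩
    obtain ⟨D', hD', he⟩ := horb h⁻¹
    have : D' = h • D := by rw [← he, smul_inv_smul]
    change h • D ∈ (F' : Set (Submodule K U))
    rw [← this]
    exact hD'
  refine ⟨g • D, fun h0 => ?_, hg, ⟨?_⟩⟩
  · have := hfr g D
    rw [h0, finrank_bot] at this
    omega
  · rw [MulAction.index_stabilizer, MulAction.orbit_smul]
    exact (Set.ncard_pos hfin).mpr (MulAction.nonempty_orbit D) |>.ne'

end

section

open Pointwise TensorProduct

section
variable {Q A : Type*} [Group Q] [AddCommGroup A] [DistribMulAction Q A]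

theorem exists_nsmul_eq_one_tmul (u : ℚ ⊗[ℤ] A) : ∃ n : ℕ, 0 < n ∧ ∃ a : A, n • u = 1 ⊗ₜ a := by
  induction u using TensorProduct.induction_on with
  | zero => exact ⟨1, one_pos, 0, by simp⟩
  | tmul x a =>
    refine ⟨x.den, x.den_pos, x.num • a, ?_⟩
    rw [← TensorProduct.smul_tmul, TensorProduct.smul_tmul', nsmul_eq_mul, Rat.den_mul_eq_num,
      zsmul_one]
  | add x y hx hy =>
    obtain ⟨m, hm, a, ha⟩ := hx
    obtain ⟨n, hn, b, hb⟩ := hy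
    refine ⟨n * m, Nat.mul_pos hn hm, n • a + m • b, ?_⟩
    rw [smul_add, mul_nsmul', ha, mul_comm n m, mul_nsmul', hb, TensorProduct.tmul_add,
      TensorProduct.tmul_smul, TensorProduct.tmul_smul]

open Classical in
/-- Every nonzero real functional on a plinth can be moved off the zero set of finitely many
nonzero vectors. -/
theorem IsPlinth.exists_forall_ne_zero [Module.Free ℤ A] [Module.Finite ℤ A]
    (hpl : IsPlinth Q A) (v : A →+ ℝ) (hv : v ≠ 0) (D : Finset A) (hD : (0 : A) ∉ D) :
    ∃ q : Q, ∀ d ∈ D, v (q • d) ≠ 0 := by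
  by_contra! hcon
  let U := ℚ ⊗[ℤ] A
  let θ : Q →* Module.End ℚ U :=
    (Module.End.baseChangeHom ℤ ℚ A).toRingHom.toMonoidHom.comp (DistribMulAction.toModuleEnd ℤ A)
  let _ : DistribMulAction Q U := DistribMulAction.compHom U θ
  have hθ : ∀ (q : Q) (u : U), q • u = θ q u := fun _ _ => rfl
  have hθ1 : ∀ (q : Q) (a : A), q • ((1 : ℚ) ⊗ₜ[ℤ] a : U) = (1 : ℚ) ⊗ₜ (q • a) := fun _ _ => rfl
  have : SMulCommClass Q ℚ U := ⟨fun q c u => by rw [hθ, hθ, map_smul]⟩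
  have hfd : FiniteDimensional ℚ U := inferInstance
  let v' : U →ₗ[ℚ] ℝ := LinearMap.liftBaseChange ℚ v.toIntLinearMap
  have hv' : ∀ a : A, v' ((1 : ℚ) ⊗ₜ a) = v a := fun a =>
    (one_smul ℚ (v a))
  let b := Module.Free.chooseBasis ℤ A
  have hinj : ∀ a : A, ((1 : ℚ) ⊗ₜ[ℤ] a : U) = 0 → a = 0 := fun a ha => by
    refine b.ext_elem fun i => ?_
    have h1 := congrArg
      (LinearMap.liftBaseChange ℚ ((Algebra.linearMap ℤ ℚ) ∘ₗ b.coord i)) ha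
    simpa using h1
  obtain ⟨E, hE, hEW, hS⟩ := exists_virtually_invariant_of_cover (K := ℚ) (Q := Q)
    (LinearMap.ker v') (D.image fun d => Submodule.span ℚ {((1 : ℚ) ⊗ₜ[ℤ] d : U)})
    (fun X hX => by
      obtain ⟨d, hd, rfl⟩ := Finset.mem_image.mp hX
      rw [Ne, Submodule.span_singleton_eq_bot]
      exact fun h => hD (hinj d h ▸ hd))
    (fun q => by
      obtain ⟨d, hd, hqd⟩ := hcon q
      refine ⟨_, Finset.mem_image_of_mem _ hd, ?_⟩
      rw [Submodule.smul_span, Submodule.span_le]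
      rintro _ ⟨_, rfl, rfl⟩
      change v' (q • ((1 : ℚ) ⊗ₜ[ℤ] d : U)) = 0
      rw [hθ1, hv', hqd])
  let C : AddSubgroup A := E.toAddSubgroup.comap (TensorProduct.mk ℤ ℚ A 1).toAddMonoidHom
  have hC : ∀ a, a ∈ C ↔ ((1 : ℚ) ⊗ₜ[ℤ] a : U) ∈ E := fun _ => Iff.rfl
  have hC0 : C ≠ ⊥ := fun h0 => by
    obtain ⟨u, hu, hu0⟩ := E.ne_bot_iff.mp hE
    obtain ⟨n, hn, a, ha⟩ := exists_nsmul_eq_one_tmul u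
    have h1 : a ∈ C := (hC a).mpr (ha ▸ E.smul_of_tower_mem n hu)
    rw [h0, AddSubgroup.mem_bot] at h1
    rw [h1, TensorProduct.tmul_zero, ← Nat.cast_smul_eq_nsmul ℚ, smul_eq_zero] at ha
    exact ha.elim (by exact_mod_cast hn.ne') hu0
  refine hv (AddMonoidHom.ext fun a => ?_)
  obtain ⟨n, hn, hna⟩ := hpl C hC0 _ hS (fun q hq a ha => by
    rw [hC] at ha ⊢
    rw [← hθ1, ← MulAction.mem_stabilizer_iff.mp hq]
    exact Submodule.smul_mem_pointwise_smul _ _ _ ha) a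
  have h1 : v' ((1 : ℚ) ⊗ₜ[ℤ] (n • a)) = 0 := hEW ((hC _).mp hna)
  rw [hv', map_nsmul, smul_eq_zero] at h1
  exact h1.resolve_left hn.ne'

end

end

section

open Filter

section
variable {Q A : Type*} [Group Q] [AddCommGroup A] [DistribMulAction Q A]

/-- The span of the monomials with exponents in `S`, together with the ideal `J`. -/
noncomputable def spanMonomials {k A : Type*} [Field k] [AddCommGroup A] (J : Ideal (AddMonoidAlgebra k A))
    (S : Set A) : Submodule k (AddMonoidAlgebra k A) :=
  Submodule.span k ((fun a => AddMonoidAlgebra.single a 1) '' S) ⊔ J.restrictScalars k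

section
variable {k : Type*} [Field k] {J : Ideal (AddMonoidAlgebra k A)}

theorem spanMonomials_mono {S T : Set A} (h : S ⊆ T) :
    spanMonomials J S ≤ spanMonomials J T :=
  sup_le_sup_right (Submodule.span_mono (Set.image_mono h)) _

theorem spanMonomials_le {S T : Set A}
    (h : ∀ a ∈ S, AddMonoidAlgebra.single a 1 ∈ spanMonomials J T) :
    spanMonomials J S ≤ spanMonomials J T := by
  refine sup_le (Submodule.span_le.mpr ?_) le_sup_right
  rintro _ ⟨a, ha, rfl⟩
  exact h a ha

theorem single_mul_mem_spanMonomials {S : Set A} {f : AddMonoidAlgebra k A}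
    (h : f ∈ spanMonomials J S) (a : A) :
    AddMonoidAlgebra.single a 1 * f ∈ spanMonomials J ((a + ·) '' S) := by
  obtain ⟨g, hg, j, hj, rfl⟩ := Submodule.mem_sup.mp h
  rw [mul_add]
  refine add_mem (Submodule.mem_sup_left ?_) (Submodule.mem_sup_right (J.mul_mem_left _ hj))
  clear h
  induction hg using Submodule.span_induction with
  | mem x hx =>
    obtain ⟨b, hb, rfl⟩ := hx
    refine Submodule.subset_span ⟨a + b, ⟨b, hb, rfl⟩, ?_⟩
    simp [AddMonoidAlgebra.single_mul_single]
  | zero => rw [mul_zero]; exact zero_mem _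
  | add x y _ _ hx hy => rw [mul_add]; exact add_mem hx hy
  | smul c x _ hx => rw [mul_smul_comm]; exact Submodule.smul_mem _ _ hx

theorem sub_single_mem_span (f : AddMonoidAlgebra k A) (a : A) :
    f - AddMonoidAlgebra.single a (f.coeff a) ∈ Submodule.span k
      ((fun a => AddMonoidAlgebra.single a (1 : k)) '' {b | b ∈ f.coeff.support ∧ b ≠ a}) := by
  classical
  have hf : f = ∑ b ∈ f.coeff.support, AddMonoidAlgebra.single b (f.coeff b) := by
    refine AddMonoidAlgebra.coeff_injective ?_
    rw [AddMonoidAlgebra.coeff_sum]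
    exact (Finsupp.sum_single f.coeff).symm
  have h2 : f - AddMonoidAlgebra.single a (f.coeff a) =
      ∑ b ∈ f.coeff.support.erase a, AddMonoidAlgebra.single b (f.coeff b) := by
    by_cases ha : a ∈ f.coeff.support
    · rw [Finset.sum_erase_eq_sub ha, ← hf]
    · rw [Finset.erase_eq_of_notMem ha, ← hf, Finsupp.notMem_support_iff.mp ha,
        AddMonoidAlgebra.single_zero, sub_zero]
  rw [h2]
  refine Submodule.sum_mem _ fun b hb => ?_
  obtain ⟨hba, hb⟩ := Finset.mem_erase.mp hb
  have h3 : AddMonoidAlgebra.single b (f.coeff b) =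
      f.coeff b • AddMonoidAlgebra.single b (1 : k) := by
    rw [AddMonoidAlgebra.smul_single, smul_eq_mul, mul_one]
  rw [h3]
  exact Submodule.smul_mem _ _ (Submodule.subset_span ⟨b, ⟨hb, hba⟩, rfl⟩)

theorem one_mem_spanMonomials {f : AddMonoidAlgebra k A} (hf : f ∈ J) (hf0 : f ≠ 0) (v : A →+ ℝ)
    (hv : ∀ a ∈ f.coeff.support, ∀ b ∈ f.coeff.support, a ≠ b → v a ≠ v b) :
    ∃ X : Finset A, (∀ x ∈ X, v x < 0) ∧ 1 ∈ spanMonomials J X := by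
  classical
  have hne : f.coeff.support.Nonempty := Finsupp.support_nonempty_iff.mpr fun h =>
    hf0 (by ext; simp [h])
  obtain ⟨a, ha, hmax⟩ := f.coeff.support.exists_max_image v hne
  have h1 : AddMonoidAlgebra.single a 1 ∈ spanMonomials J {b | b ∈ f.coeff.support ∧ b ≠ a} := by
    have h2 : AddMonoidAlgebra.single a 1 = (f.coeff a)⁻¹ • f -
        (f.coeff a)⁻¹ • (f - AddMonoidAlgebra.single a (f.coeff a)) := by
      rw [← smul_sub, sub_sub_cancel, AddMonoidAlgebra.smul_single, smul_eq_mul,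
        inv_mul_cancel₀ (Finsupp.mem_support_iff.mp ha)]
    rw [h2]
    exact sub_mem (Submodule.mem_sup_right (Submodule.smul_mem (J.restrictScalars k) _ hf))
      (Submodule.mem_sup_left (Submodule.smul_mem _ _ (sub_single_mem_span f a)))
  refine ⟨(f.coeff.support.erase a).image (-a + ·), fun x hx => ?_, ?_⟩
  · obtain ⟨b, hb, rfl⟩ := Finset.mem_image.mp hx
    obtain ⟨hba, hb⟩ := Finset.mem_erase.mp hb
    rw [map_add, map_neg]
    linarith [(hmax b hb).lt_of_ne (hv b hb a ha hba)]
  · have h3 := single_mul_mem_spanMonomials h1 (-a)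
    rw [AddMonoidAlgebra.single_mul_single, neg_add_cancel, one_mul,
      ← AddMonoidAlgebra.one_def] at h3
    refine spanMonomials_mono ?_ h3
    rintro _ ⟨b, ⟨hb, hba⟩, rfl⟩
    exact Finset.mem_coe.mpr (Finset.mem_image_of_mem _ (Finset.mem_erase.mpr ⟨hba, hb⟩))

theorem exists_forall_single_mem_spanMonomials {ι : Type*} [Fintype ι]
    (vec : A →+ EuclideanSpace ℝ ι)
    (hX : ∀ v : EuclideanSpace ℝ ι, v ≠ 0 →
      ∃ X : Finset A, (∀ x ∈ X, inner ℝ v (vec x) < 0) ∧ 1 ∈ spanMonomials J X) :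
    ∃ R : ℝ, ∀ a, R ≤ ‖vec a‖ →
      AddMonoidAlgebra.single a 1 ∈ spanMonomials J {c | ‖vec c‖ < ‖vec a‖} := by
  have hP : ∀ᶠ t : ℝ in atTop, ∀ u ∈ Metric.sphere (0 : EuclideanSpace ℝ ι) 1, ∀ a, vec a = t • u →
      AddMonoidAlgebra.single a 1 ∈ spanMonomials J {c | ‖vec c‖ < ‖vec a‖} := by
    refine (isCompact_sphere (0 : EuclideanSpace ℝ ι) 1).induction_on (p := fun s =>
      ∀ᶠ t : ℝ in atTop, ∀ u ∈ s, ∀ a, vec a = t • u →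
        AddMonoidAlgebra.single a 1 ∈ spanMonomials J {c | ‖vec c‖ < ‖vec a‖})
      (by simp) (fun s t hst ht => ht.mono fun _ h u hu => h u (hst hu))
      (fun s t hs ht => (hs.and ht).mono fun _ h u hu => hu.elim (h.1 u) (h.2 u)) fun v hv => ?_
    obtain ⟨X, hX0, hX1⟩ := hX v (fun h0 => by simp [h0] at hv)
    refine ⟨{u | ∀ x ∈ X, inner ℝ u (vec x) < inner ℝ v (vec x) / 2},
      mem_nhdsWithin_of_mem_nhds ?_, ?_⟩
    · refine (Filter.eventually_all_finset X).mpr fun x hx => ?_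
      refine (Continuous.inner continuous_id continuous_const).continuousAt.eventually_lt
        continuousAt_const ?_
      have := hX0 x hx
      simp only [id]
      linarith
    · have h1 : ∀ᶠ t : ℝ in atTop, ∀ x ∈ X, ‖vec x‖ ^ 2 + t * inner ℝ v (vec x) < 0 := by
        refine (Filter.eventually_all_finset X).mpr fun x hx => ?_
        exact (tendsto_atBot_add_const_left _ _
          (tendsto_id.atTop_mul_const_of_neg (hX0 x hx))).eventually_lt_atBot 0
      filter_upwards [h1, eventually_ge_atTop 0] with t ht ht0 u hu a ha
      have h2 := single_mul_mem_spanMonomials hX1 a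
      rw [mul_one] at h2
      refine spanMonomials_mono ?_ h2
      rintro _ ⟨x, hx, rfl⟩
      have h3 : ‖vec (a + x)‖ ^ 2 < ‖vec a‖ ^ 2 := by
        rw [map_add, norm_add_sq_real, ha, inner_smul_left]
        have h4 := mul_le_mul_of_nonneg_left (hu x hx).le ht0
        have h5 := ht x hx
        simp only [conj_trivial]
        nlinarith
      exact lt_of_pow_lt_pow_left₀ 2 (norm_nonneg _) h3
  obtain ⟨R, hR⟩ := Filter.eventually_atTop.mp hP
  refine ⟨max R 1, fun a ha => hR ‖vec a‖ ((le_max_left _ _).trans ha) (‖vec a‖⁻¹ • vec a) ?_ a ?_⟩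
  · have : ‖vec a‖ ≠ 0 := by linarith [(le_max_right R 1).trans ha]
    simp [norm_smul, this]
  · have : ‖vec a‖ ≠ 0 := by linarith [(le_max_right R 1).trans ha]
    rw [smul_inv_smul₀ this]

theorem exists_spanMonomials_finite_eq_top {ι : Type*} [Fintype ι]
    (b : Module.Basis ι ℤ A) (vec : A →+ EuclideanSpace ℝ ι) (hvec : ∀ a i, vec a i = b.repr a i)
    (hX : ∀ v : EuclideanSpace ℝ ι, v ≠ 0 →
      ∃ X : Finset A, (∀ x ∈ X, inner ℝ v (vec x) < 0) ∧ 1 ∈ spanMonomials J X) :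
    ∃ S : Set A, S.Finite ∧ spanMonomials J S = ⊤ := by
  classical
  obtain ⟨R, hR⟩ := exists_forall_single_mem_spanMonomials vec hX
  have hfin : ∀ M : ℝ, {a | ‖vec a‖ < M}.Finite := fun M => by
    obtain ⟨m, hm⟩ := exists_nat_gt M
    refine Set.Finite.subset ((Set.finite_Icc (fun _ : ι => -(m : ℤ)) (fun _ => m)).preimage
      (f := fun a => ⇑(b.repr a)) ?_) fun a ha => ?_
    · exact (DFunLike.coe_injective.comp b.repr.injective).injOn
    · have h1 : ∀ i, |(b.repr a i : ℝ)| ≤ m := fun i => by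
        rw [← hvec, ← Real.norm_eq_abs]
        exact (PiLp.norm_apply_le _ i).trans ((le_of_lt ha).trans hm.le)
      have h2 : ∀ i, |b.repr a i| ≤ (m : ℤ) := fun i => by exact_mod_cast h1 i
      exact ⟨fun i => (abs_le.mp (h2 i)).1, fun i => (abs_le.mp (h2 i)).2⟩
  refine ⟨_, hfin R, ?_⟩
  have key : ∀ n : ℕ, ∀ a, {c | ‖vec c‖ < ‖vec a‖}.ncard = n →
      AddMonoidAlgebra.single a 1 ∈ spanMonomials J {c | ‖vec c‖ < R} := by
    intro n
    induction n using Nat.strong_induction_on with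
    | _ n ih =>
      intro a ha
      rcases lt_or_ge ‖vec a‖ R with h | h
      · exact Submodule.mem_sup_left (Submodule.subset_span ⟨a, h, rfl⟩)
      · refine spanMonomials_le (fun c hc => ih _ ?_ c rfl) (hR a h)
        rw [← ha]
        refine Set.ncard_lt_ncard ⟨fun x hx => ?_, fun hsub => ?_⟩ (hfin _)
        · exact lt_trans (show ‖vec x‖ < ‖vec c‖ from hx) hc
        · exact lt_irrefl ‖vec c‖ (hsub hc)
  refine eq_top_iff.mpr fun f _ => ?_
  induction f using AddMonoidAlgebra.induction_linear with
  | zero => exact zero_mem _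
  | add f g hf hg => exact add_mem (hf trivial) (hg trivial)
  | single a c =>
    have h3 : AddMonoidAlgebra.single a c = c • AddMonoidAlgebra.single a (1 : k) := by
      rw [AddMonoidAlgebra.smul_single, smul_eq_mul, mul_one]
    rw [h3]
    exact Submodule.smul_mem _ _ (key _ a rfl)

end

/-- A nonzero invariant ideal of the group algebra of a plinth over a finite prime field contains
the augmentation ideal of a nonzero invariant subgroup. -/
theorem IsPlinth.exists_single_sub_one_mem {p : ℕ} [Fact p.Prime] [Module.Free ℤ A]
    [Module.Finite ℤ A] [Nontrivial A] (hpl : IsPlinth Q A)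
    (J : Ideal (AddMonoidAlgebra (ZMod p) A)) (hJ0 : J ≠ ⊥)
    (hJ : ∀ (q : Q), ∀ f ∈ J, conjHom p q f ∈ J) :
    ∃ C : AddSubgroup A, C ≠ ⊥ ∧ (∀ q : Q, ∀ a ∈ C, q • a ∈ C) ∧
      ∀ a ∈ C, AddMonoidAlgebra.single a 1 - 1 ∈ J := by
  classical
  let b := Module.Free.chooseBasis ℤ A
  let vec : A →+ EuclideanSpace ℝ (Module.Free.ChooseBasisIndex ℤ A) :=
    { toFun := fun a => WithLp.toLp 2 fun i => (b.repr a i : ℝ)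
      map_zero' := by ext; simp
      map_add' := fun x y => by ext; simp }
  have hvec : ∀ a i, vec a i = b.repr a i := fun _ _ => rfl
  obtain ⟨f₀, hf₀, hf₀0⟩ := J.ne_bot_iff.mp hJ0
  obtain ⟨S, hSfin, hS⟩ := exists_spanMonomials_finite_eq_top (J := J) b vec hvec fun v hv => by
    let v' : A →+ ℝ := ((innerₛₗ ℝ v).toAddMonoidHom).comp vec
    have hv' : ∀ a, v' a = inner ℝ v (vec a) := fun _ => rfl
    have hv0 : v' ≠ 0 := fun h0 => hv (by
      ext i
      have h1 := DFunLike.congr_fun h0 (b i)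
      rw [hv'] at h1
      have h2 : vec (b i) = EuclideanSpace.single i 1 := by
        ext j
        rw [hvec, b.repr_self]
        simp [Finsupp.single_apply, eq_comm]
      rw [h2] at h1
      rw [EuclideanSpace.inner_single_right] at h1
      simpa using h1)
    obtain ⟨q, hq⟩ := hpl.exists_forall_ne_zero v' hv0
      ((f₀.coeff.support ×ˢ f₀.coeff.support).image (fun x => x.1 - x.2) |>.erase 0)
      (Finset.notMem_erase _ _)
    have hinj : Function.Injective (conjHom (A := A) p q) :=
      AddMonoidAlgebra.mapDomain_injective (MulAction.injective q)
    have hsupp : ∀ a ∈ (conjHom p q f₀).coeff.support, ∃ c ∈ f₀.coeff.support, q • c = a := by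
      intro a ha
      exact Finset.mem_image.mp (Finsupp.mapDomain_support ha)
    refine one_mem_spanMonomials (hJ q f₀ hf₀) ((map_ne_zero_iff _ hinj).mpr hf₀0) v' ?_
    intro x hx y hy hxy heq
    obtain ⟨c, hc, rfl⟩ := hsupp x hx
    obtain ⟨d, hd, rfl⟩ := hsupp y hy
    refine hq (c - d) (Finset.mem_erase.mpr ⟨sub_ne_zero.mpr fun h => hxy (by rw [h]),
      Finset.mem_image.mpr ⟨(c, d), Finset.mem_product.mpr ⟨hc, hd⟩, rfl⟩⟩) ?_
    rw [smul_sub, map_sub, heq, sub_self]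
  let π := (J.restrictScalars (ZMod p)).mkQ
  have hfin : Module.Finite (ZMod p) (_ ⧸ J.restrictScalars (ZMod p)) := by
    refine ⟨⟨(hSfin.image fun a => π (AddMonoidAlgebra.single a 1)).toFinset, ?_⟩⟩
    rw [Set.Finite.coe_toFinset, ← Set.image_image π, Submodule.span_image]
    have h1 := congrArg (Submodule.map π) hS
    rw [spanMonomials, Submodule.map_sup, Submodule.map_top, Submodule.range_mkQ,
      Submodule.mkQ_map_self, sup_bot_eq] at h1
    exact h1
  have : Finite (_ ⧸ J.restrictScalars (ZMod p)) := Module.finite_of_finite (ZMod p)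
  have : Infinite A := Module.Free.infinite ℤ A
  obtain ⟨x, y, hxy, hπ⟩ := Finite.exists_ne_map_eq_of_infinite
    fun a : A => π (AddMonoidAlgebra.single a 1)
  let ev (a : A) := (AddMonoidAlgebra.single a 1 : AddMonoidAlgebra (ZMod p) A)
  have hadd : ∀ a c, ev (a + c) = ev a * ev c := fun a c => by
    simp [ev, AddMonoidAlgebra.single_mul_single]
  have hzero : ev 0 = 1 := AddMonoidAlgebra.one_def.symm
  let C : AddSubgroup A :=
    { carrier := {a | ev a - 1 ∈ J}
      zero_mem' := by
        change ev 0 - 1 ∈ J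
        rw [hzero, sub_self]
        exact zero_mem _
      add_mem' := fun {a c} ha hc => by
        change ev (a + c) - 1 ∈ J
        have h1 : ev (a + c) - 1 = ev a * (ev c - 1) + (ev a - 1) := by rw [hadd]; ring
        rw [h1]
        exact add_mem (J.mul_mem_left _ hc) ha
      neg_mem' := fun {a} ha => by
        change ev (-a) - 1 ∈ J
        have h1 : ev (-a) - 1 = -(ev (-a) * (ev a - 1)) := by
          rw [mul_sub, ← hadd, neg_add_cancel, hzero]; ring
        rw [h1]
        exact neg_mem (J.mul_mem_left _ ha) }
  refine ⟨C, fun h0 => hxy ?_, fun q a ha => ?_, fun a ha => ha⟩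
  · have h1 : ev x - ev y ∈ J := (Submodule.Quotient.eq _).mp hπ
    have h2 : x - y ∈ C := by
      change ev (x - y) - 1 ∈ J
      have h3 : ev (x - y) - 1 = ev (-y) * (ev x - ev y) := by
        rw [mul_sub, ← hadd, ← hadd, neg_add_cancel, hzero, neg_add_eq_sub]
      rw [h3]
      exact J.mul_mem_left _ h1
    rw [h0, AddSubgroup.mem_bot, sub_eq_zero] at h2
    exact h2
  · change ev (q • a) - 1 ∈ J
    have h1 := hJ q _ ha
    rwa [map_sub, map_one, conjHom_single] at h1

end

end

section
variable {Q : Type*} [Group Q]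

/-- An infinite polycyclic group has an infinite abelian normal subgroup. -/
theorem Reach.exists_infinite_abelian_normal [Infinite Q] (hQ : Reach (⊤ : Subgroup Q)) :
    ∃ Z : Subgroup Q, Z.Normal ∧ Infinite Z ∧ ∀ x ∈ Z, ∀ y ∈ Z, x * y = y * x := by
  classical
  have hsol : Group.IsSolvable Q := by
    have := hQ.isSolvable
    exact Group.isSolvable_of_surjective (f := (⊤ : Subgroup Q).subtype) fun x => ⟨⟨x, trivial⟩, rfl⟩
  have hex : ∃ n, Finite (derivedSeries Q n) := by
    obtain ⟨n, hn⟩ := hsol.solvable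
    exact ⟨n, by rw [hn]; infer_instance⟩
  have hn := Nat.find_spec hex
  have hmin := fun m => Nat.find_min hex (m := m)
  generalize Nat.find hex = n at hn hmin
  obtain _ | n := n
  · exfalso
    rw [derivedSeries_zero] at hn
    have := Finite.of_equiv _ (Subgroup.topEquiv (G := Q)).toEquiv
    exact not_finite Q
  let D := derivedSeries Q n
  have hDn : D.Normal := derivedSeries_normal Q n
  have hD : Infinite D := not_finite_iff_infinite.mp (hmin n n.lt_succ_self)
  have hfg : Group.FG D := (Group.fg_iff_subgroup_fg D).mpr (hQ.fg_of_top D)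
  have hcomm : Finite (commutatorSet D) := by
    refine Finite.of_injective (fun x : commutatorSet D =>
      (⟨((x : D) : Q), ?_⟩ : derivedSeries Q (n + 1))) ?_
    · obtain ⟨_, a, b, rfl⟩ := x
      rw [derivedSeries_succ]
      exact Subgroup.commutator_mem_commutator a.2 b.2
    · intro x y h
      exact Subtype.ext (Subtype.ext (Subtype.mk.inj h))
  have hc : (Subgroup.center D).FiniteIndex := inferInstance
  have hci : Infinite (Subgroup.center D) := by
    by_contra hfin
    rw [not_infinite_iff_finite] at hfin
    have := Subgroup.finite_quotient_of_finiteIndex (H := Subgroup.center D)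
    have : Finite D := Finite.of_equiv _ (Subgroup.groupEquivQuotientProdSubgroup
      (s := Subgroup.center D)).symm
    exact not_finite D
  refine ⟨(Subgroup.center D).map D.subtype, inferInstance, ?_, ?_⟩
  · exact Infinite.of_injective (fun z : Subgroup.center D =>
      (⟨((z : D) : Q), ⟨z, z.2, rfl⟩⟩ : (Subgroup.center D).map D.subtype)) fun x y h =>
      Subtype.ext (Subtype.ext (Subtype.mk.inj h))
  · rintro _ ⟨x, hx, rfl⟩ _ ⟨y, hy, rfl⟩
    rw [← map_mul, ← map_mul, (Subgroup.mem_center_iff.mp hx y)]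

theorem exists_pow_eq_one_of_isOfFinOrder (Z : Type*) [CommGroup Z]
    (hfg : ∀ S : Subgroup Z, S.FG) : ∃ m : ℕ, 0 < m ∧ ∀ z : Z, IsOfFinOrder z → z ^ m = 1 := by
  have hfg' : Group.FG (CommGroup.torsion Z) := (Group.fg_iff_subgroup_fg _).mpr (hfg _)
  have : Finite (CommGroup.torsion Z) :=
    CommGroup.finite_of_fg_isMulTorsion _ fun z => by
      obtain ⟨n, hn, h⟩ := isOfFinOrder_iff_pow_eq_one.mp z.2
      exact isOfFinOrder_iff_pow_eq_one.mpr ⟨n, hn, Subtype.ext h⟩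
  refine ⟨Nat.card (CommGroup.torsion Z), Nat.card_pos, fun z hz => ?_⟩
  exact congrArg Subtype.val (pow_card_eq_one' (x := (⟨z, hz⟩ : CommGroup.torsion Z)))

/-- An infinite polycyclic group has a nontrivial torsion-free abelian normal subgroup. -/
theorem Reach.exists_torsionFree_abelian_normal [Infinite Q] (hQ : Reach (⊤ : Subgroup Q)) :
    ∃ A : Subgroup Q, A.Normal ∧ A ≠ ⊥ ∧ (∀ x ∈ A, ∀ y ∈ A, x * y = y * x) ∧
      ∀ x ∈ A, ∀ n : ℕ, 0 < n → x ^ n = 1 → x = 1 := by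
  obtain ⟨Z, hZn, hZi, hZc⟩ := hQ.exists_infinite_abelian_normal
  let _ : CommGroup Z := { (inferInstance : Group Z) with
    mul_comm := fun x y => Subtype.ext (hZc x x.2 y y.2) }
  have hfg : ∀ S : Subgroup Z, S.FG := fun S => (hQ.top_subgroup Z).fg_of_top S
  obtain ⟨m, hm, hZm⟩ := exists_pow_eq_one_of_isOfFinOrder Z hfg
  refine ⟨((powMonoidHom m : Z →* Z).range).map Z.subtype, ⟨?_⟩, fun h0 => ?_, ?_, ?_⟩
  · rintro _ ⟨_, ⟨z, rfl⟩, rfl⟩ q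
    refine ⟨_, ⟨⟨q * z * q⁻¹, hZn.conj_mem z z.2 q⟩, rfl⟩, ?_⟩
    simp [conj_pow]
  · have hfgZ : Group.FG Z := (Group.fg_iff_subgroup_fg Z).mpr (hQ.fg_of_top Z)
    have htor : IsMulTorsion Z := by
      refine fun z => isOfFinOrder_iff_pow_eq_one.mpr ⟨m, hm, ?_⟩
      have h1 : ((z ^ m : Z) : Q) ∈ ((powMonoidHom m : Z →* Z).range).map Z.subtype :=
        ⟨_, ⟨z, rfl⟩, rfl⟩
      rw [h0, Subgroup.mem_bot] at h1
      exact Subtype.ext h1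
    have := CommGroup.finite_of_fg_isMulTorsion Z htor
    exact not_finite Z
  · rintro _ ⟨x, hx, rfl⟩ _ ⟨y, hy, rfl⟩
    exact hZc x x.2 y y.2
  · rintro _ ⟨_, ⟨z, rfl⟩, rfl⟩ n hn h1
    have h2 : (z ^ m) ^ n = 1 := Subtype.ext h1
    have h3 := hZm z (isOfFinOrder_iff_pow_eq_one.mpr ⟨m * n, Nat.mul_pos hm hn, by rw [pow_mul, h2]⟩)
    exact congrArg Subtype.val h3

universe u in
/-- An infinite polycyclic group contains a plinth. -/
theorem Reach.exists_isPlinth {Q : Type u} [Group Q] [Infinite Q] (hQ : Reach (⊤ : Subgroup Q)) :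
    ∃ (A : Type u) (_ : AddCommGroup A) (S : Subgroup Q) (_ : DistribMulAction S A)
      (i : Multiplicative A →* Q), S.FiniteIndex ∧ Function.Injective i ∧
      (∀ (s : S) (a : A), i (.ofAdd (s • a)) = s * i (.ofAdd a) * (s : Q)⁻¹) ∧
      Module.Free ℤ A ∧ Module.Finite ℤ A ∧ Nontrivial A ∧ IsPlinth S A := by
  classical
  obtain ⟨A₀, hn, h0, hc, htf⟩ := hQ.exists_torsionFree_abelian_normal
  let _ : CommGroup A₀ := { (inferInstance : Group A₀) with
    mul_comm := fun x y => Subtype.ext (hc x x.2 y y.2) }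
  let M := Additive A₀
  let _ : DistribMulAction Q M :=
    { smul := fun q a => Additive.ofMul (MulAut.conjNormal q a.toMul)
      one_smul := fun a => congrArg (fun f : MulAut A₀ => Additive.ofMul (f a.toMul))
        (map_one MulAut.conjNormal)
      mul_smul := fun q r a => congrArg (fun f : MulAut A₀ => Additive.ofMul (f a.toMul))
        (map_mul MulAut.conjNormal q r)
      smul_zero := fun q => map_one (MulAut.conjNormal q)
      smul_add := fun q a b => map_mul (MulAut.conjNormal q) a.toMul b.toMul }
  have hsm : ∀ (q : Q) (a : M), (((q • a : M).toMul : A₀) : Q) = q * (a.toMul : A₀) * q⁻¹ :=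
    fun _ _ => rfl
  have hfgA : Group.FG A₀ := (Group.fg_iff_subgroup_fg _).mpr (hQ.fg_of_top A₀)
  have hMfin : Module.Finite ℤ M := Module.Finite.iff_addGroup_fg.mpr inferInstance
  have hMtf : IsAddTorsionFree M := by
    refine ⟨fun n hn x y hxy => ?_⟩
    have h1 : n • (x - y) = 0 := by rw [smul_sub]; exact sub_eq_zero.mpr hxy
    have h2 : (((x - y).toMul : A₀) : Q) ^ n = 1 := congrArg (fun z : M => (z.toMul : Q)) h1
    exact sub_eq_zero.mp (Subtype.ext (htf _ (x - y).toMul.2 n (Nat.pos_of_ne_zero hn) h2))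
  let P : Submodule ℤ M → Prop := fun C => C ≠ ⊥ ∧ ∃ S : Subgroup Q, S.FiniteIndex ∧
    ∀ q ∈ S, ∀ a ∈ C, q • a ∈ C
  have hP : ∃ n, ∃ C, P C ∧ Module.finrank ℤ C = n := by
    refine ⟨_, ⊤, ⟨fun h => h0 ?_, ⊤, inferInstance, fun _ _ _ _ => trivial⟩, rfl⟩
    refine (Subgroup.eq_bot_iff_forall _).mpr fun x hx => ?_
    have h1 : (Additive.ofMul (⟨x, hx⟩ : A₀) : M) ∈ (⊤ : Submodule ℤ M) := trivial
    rw [h, Submodule.mem_bot] at h1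
    exact congrArg Subtype.val h1
  obtain ⟨C, ⟨hC0, S, hS, hSC⟩, hrank⟩ := Nat.find_spec hP
  have hmin : ∀ C', P C' → Module.finrank ℤ C ≤ Module.finrank ℤ C' := fun C' hC' =>
    hrank ▸ Nat.find_min' hP ⟨C', hC', rfl⟩
  let _ : DistribMulAction S C :=
    { smul := fun s a => ⟨(s : Q) • (a : M), hSC s s.2 a a.2⟩
      one_smul := fun a => Subtype.ext (one_smul Q (a : M))
      mul_smul := fun q r a => Subtype.ext (mul_smul (q : Q) (r : Q) (a : M))
      smul_zero := fun q => Subtype.ext (smul_zero (q : Q))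
      smul_add := fun q a b => Subtype.ext (smul_add (q : Q) (a : M) b) }
  let i : Multiplicative C →* Q := A₀.subtype.comp
    (AddMonoidHom.toMultiplicativeLeft (C.subtype.toAddMonoidHom))
  have hCfree : Module.Free ℤ C := inferInstance
  refine ⟨C, inferInstance, S, inferInstance, i, hS, ?_, fun s a => ?_, ‹_›, inferInstance,
    Submodule.nontrivial_iff_ne_bot.mpr hC0, ?_⟩
  · exact fun x y h => Subtype.ext (Subtype.ext h)
  · rfl
  · intro C' hC' S' hS' hst a
    let C₁ : Submodule ℤ C := AddSubgroup.toIntSubmodule C'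
    have h1 := hmin (C₁.map C.subtype) ⟨?_, S'.map S.subtype, ⟨?_⟩, ?_⟩
    · rw [Submodule.finrank_map_subtype_eq, ← Submodule.finrank_quotient_add_finrank C₁] at h1
      have h2 : Module.finrank ℤ (C ⧸ C₁) = 0 := by omega
      obtain ⟨n, hn0, hn⟩ := Module.finrank_eq_zero_iff.mp h2 (Submodule.Quotient.mk a)
      rw [← Submodule.Quotient.mk_smul, Submodule.Quotient.mk_eq_zero] at hn
      refine ⟨n.natAbs, Int.natAbs_pos.mpr hn0, ?_⟩
      rw [← natCast_zsmul, Int.natCast_natAbs]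
      rcases abs_choice n with h | h
      · rw [h]; exact hn
      · rw [h, neg_smul]; exact neg_mem hn
    · refine fun h => hC' ((AddSubgroup.eq_bot_iff_forall _).mpr fun x hx => Subtype.ext ?_)
      have h1 : (x : M) ∈ C₁.map C.subtype := ⟨x, hx, rfl⟩
      rwa [h, Submodule.mem_bot] at h1
    · rw [Subgroup.index_map_subtype]
      exact mul_ne_zero hS'.index_ne_zero hS.index_ne_zero
    · rintro _ ⟨q, hq, rfl⟩ _ ⟨c, hc, rfl⟩
      exact ⟨q • c, hst q hq c hc, rfl⟩

end

section

open Submodule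

section
variable {k V G : Type*} [Field k] [AddCommGroup V] [Module k V] [Group G]

/-- The submodule of a representation spanned by the vectors `n • v - v` with `n ∈ N`. -/
def augSubmodule (ρ : G →* Module.End k V) (N : Subgroup G) : Submodule k V :=
  span k {v | ∃ n ∈ N, ∃ w, v = ρ n w - w}

/-- A representation with a vector whose images under equivariant endomorphisms are everything. -/
def IsEndocyclic (ρ : G →* Module.End k V) : Prop :=
  ∃ m : V, ∀ v, ∃ φ : V →ₗ[k] V, (∀ g w, φ (ρ g w) = ρ g (φ w)) ∧ φ m = v

theorem sub_mem_augSubmodule (ρ : G →* Module.End k V) {N : Subgroup G} {n : G} (hn : n ∈ N)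
    (w : V) : ρ n w - w ∈ augSubmodule ρ N :=
  subset_span ⟨n, hn, w, rfl⟩

theorem augSubmodule_le_comap (ρ : G →* Module.End k V) {N : Subgroup G} {g : G}
    (hg : ∀ n ∈ N, g * n * g⁻¹ ∈ N) : augSubmodule ρ N ≤ (augSubmodule ρ N).comap (ρ g) := by
  refine span_le.mpr ?_
  rintro _ ⟨n, hn, w, rfl⟩
  have h : ρ g (ρ n w - w) = ρ (g * n * g⁻¹) (ρ g w) - ρ g w := by
    rw [map_sub, ← Module.End.mul_apply, ← Module.End.mul_apply, ← map_mul, ← map_mul,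
      inv_mul_cancel_right]
  change ρ g (ρ n w - w) ∈ augSubmodule ρ N
  rw [h]
  exact sub_mem_augSubmodule ρ (hg n hn) _

theorem augSubmodule_le_comap_of_comm (ρ : G →* Module.End k V) {N : Subgroup G} {φ : V →ₗ[k] V}
    (hφ : ∀ g w, φ (ρ g w) = ρ g (φ w)) :
    augSubmodule ρ N ≤ (augSubmodule ρ N).comap φ := by
  refine span_le.mpr ?_
  rintro _ ⟨n, hn, w, rfl⟩
  change φ (ρ n w - w) ∈ augSubmodule ρ N
  rw [map_sub, hφ]
  exact sub_mem_augSubmodule ρ hn _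

end

theorem finiteIndex_normalizer_of_le {Q : Type*} [Group Q] {A S : Subgroup Q}
    (hS : S.index ≠ 0) (h : ∀ s ∈ S, ∀ a ∈ A, s * a * s⁻¹ ∈ A) :
    (Subgroup.normalizer (A : Set Q)).FiniteIndex := by
  have hle : S ≤ Subgroup.normalizer (A : Set Q) := fun s hs => Subgroup.mem_normalizer_iff.mpr
    fun a => ⟨h s hs a, fun ha => by
      simpa [mul_assoc] using h s⁻¹ (S.inv_mem hs) _ ha⟩
  have : S.FiniteIndex := ⟨hS⟩
  exact Subgroup.finiteIndex_of_le hle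

section
variable {p : ℕ} [Fact p.Prime] {Q V : Type*} [Group Q] [AddCommGroup V] [Module (ZMod p) V]

theorem exists_augSubmodule_ne_top_of_infinite [Infinite Q] [Nontrivial V]
    (hQ : Reach (⊤ : Subgroup Q)) (ρ : Q →* Module.End (ZMod p) V) (hfg : IsFGRep ρ)
    (hendo : IsEndocyclic ρ) :
    ∃ A : Subgroup Q, A ≠ ⊥ ∧ (Subgroup.normalizer (A : Set Q)).FiniteIndex ∧
      augSubmodule ρ A ≠ ⊤ := by
  obtain ⟨A, _, S, _, i, hS, hi, hconj, _, _, _, hpl⟩ := hQ.exists_isPlinth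
  let τ : Multiplicative A →* Module.End (ZMod p) V := ρ.comp i
  have hτ : ∀ a, τ a = ρ (i a) := fun _ => rfl
  have hρτ : ∀ (s : S) a w, (ρ.comp S.subtype) s (τ (.ofAdd a) w) =
      τ (.ofAdd (s • a)) ((ρ.comp S.subtype) s w) := fun s a w => by
    rw [hτ, hτ, hconj, MonoidHom.comp_apply, Subgroup.subtype_apply, ← Module.End.mul_apply,
      ← Module.End.mul_apply, ← map_mul, ← map_mul, inv_mul_cancel_right]
  have fin : ∀ (C : AddSubgroup A) (_ : C ≠ ⊥) (S' : Subgroup S) (_ : S'.FiniteIndex)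
      (_ : ∀ q ∈ S', ∀ a ∈ C, q • a ∈ C)
      (_ : span (ZMod p) {v | ∃ a ∈ C, ∃ w, v = τ (.ofAdd a) w - w} ≠ ⊤),
      ∃ A : Subgroup Q, A ≠ ⊥ ∧ (Subgroup.normalizer (A : Set Q)).FiniteIndex ∧
        augSubmodule ρ A ≠ ⊤ := by
    intro C hC S' hS' hstab hne
    refine ⟨(AddSubgroup.toSubgroup C).map i, ?_, ?_, ?_⟩
    · intro h
      rw [Subgroup.map_eq_bot_iff_of_injective _ hi] at h
      exact hC ((AddSubgroup.eq_bot_iff_forall _).mpr fun a ha =>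
        (Subgroup.eq_bot_iff_forall _).mp h (Multiplicative.ofAdd a) ha)
    · refine finiteIndex_normalizer_of_le (S := S'.map S.subtype) ?_ ?_
      · rw [Subgroup.index_map_subtype]
        exact mul_ne_zero hS'.index_ne_zero hS.index_ne_zero
      · rintro _ ⟨s, hs, rfl⟩ _ ⟨a, ha, rfl⟩
        exact ⟨_, hstab s hs a.toAdd ha, hconj s a.toAdd⟩
    · refine fun htop => hne (top_le_iff.mp (htop.ge.trans (span_le.mpr ?_)))
      rintro _ ⟨_, ⟨a, ha, rfl⟩, w, rfl⟩
      exact subset_span ⟨a.toAdd, ha, w, rfl⟩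
  by_cases hJ : ∀ b, AddMonoidAlgebra.lift (ZMod p) _ A τ b = 0 → b = 0
  · obtain ⟨C, hC, S', hS', hstab, hne⟩ := exists_coinvariants_of_faithful (hQ.top_subgroup S) hpl
      (ρ.comp S.subtype) τ hρτ (hfg.restrict S)
      (by
        obtain ⟨m, hm⟩ := hendo
        refine ⟨m, fun v => ?_⟩
        obtain ⟨φ, hφ, hv⟩ := hm v
        exact ⟨φ, fun a w => hφ _ w, hv⟩) hJ
    exact fin C hC S' hS' hstab hne
  · obtain ⟨C, hC, hstab, hCJ⟩ := hpl.exists_single_sub_one_mem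
      (RingHom.ker (AddMonoidAlgebra.lift (ZMod p) _ A τ)) (fun h => hJ fun b hb => by
        have : b ∈ RingHom.ker (AddMonoidAlgebra.lift (ZMod p) _ A τ) := hb
        rwa [h] at this) (fun s f hf => by
        rw [RingHom.mem_ker] at hf ⊢
        refine LinearMap.ext fun v => ?_
        have h1 := lift_apply_comm τ (ρ s) (conjHom p s) _ (fun a c => conjHom_single s a c)
          (fun a w => hρτ s a w) f (ρ (s : Q)⁻¹ v)
        rw [hf, LinearMap.zero_apply, map_zero, ← Module.End.mul_apply (ρ (s : Q)), ← map_mul,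
          mul_inv_cancel, map_one, Module.End.one_apply] at h1
        rw [← h1, LinearMap.zero_apply])
    refine fin C hC ⊤ inferInstance (fun q _ => hstab q) fun htop => ?_
    have h0 : ∀ a ∈ C, ∀ w, τ (.ofAdd a) w - w = 0 := fun a ha w => by
      have h1 := hCJ a ha
      rw [RingHom.mem_ker, map_sub, map_one, AddMonoidAlgebra.lift_single, one_smul] at h1
      exact LinearMap.congr_fun h1 w
    refine bot_ne_top (α := Submodule (ZMod p) V) (top_le_iff.mp (htop.ge.trans (span_le.mpr ?_)))
    rintro _ ⟨a, ha, w, rfl⟩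
    exact h0 a ha w

/-- An endocyclic finitely generated nonzero modular representation of a polycyclic group has
nonzero coinvariants under some subgroup of finite index. -/
theorem exists_finiteIndex_augSubmodule_ne_top [Nontrivial V]
    (hQ : Reach (⊤ : Subgroup Q)) (ρ : Q →* Module.End (ZMod p) V) (hfg : IsFGRep ρ)
    (hendo : IsEndocyclic ρ) :
    ∃ N : Subgroup Q, N.FiniteIndex ∧ augSubmodule ρ N ≠ ⊤ := by
  classical
  obtain ⟨N, ⟨hNf, hNt⟩, hmax⟩ := hQ.exists_maximal (fun N =>
    (Subgroup.normalizer (N : Set Q)).FiniteIndex ∧ augSubmodule ρ N ≠ ⊤) ⟨⊥,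
      finiteIndex_normalizer_of_le (S := ⊤) (by simp) (by
        rintro s - a rfl
        simp), fun htop => by
      refine bot_ne_top (α := Submodule (ZMod p) V)
        (top_le_iff.mp (htop.ge.trans (span_le.mpr ?_)))
      rintro _ ⟨a, rfl, w, rfl⟩
      simp⟩
  by_contra! hcon
  let S := Subgroup.normalizer (N : Set Q)
  let N' : Subgroup S := N.subgroupOf S
  have hN'n : N'.Normal := Subgroup.normal_in_normalizer
  have hinf : Infinite (S ⧸ N') := by
    by_contra hfin
    rw [not_infinite_iff_finite] at hfin
    have h1 : N'.FiniteIndex := Subgroup.finiteIndex_of_finite_quotient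
    refine hNt (hcon N ⟨?_⟩)
    rw [← Subgroup.relIndex_mul_index (Subgroup.le_normalizer (H := N))]
    exact mul_ne_zero h1.index_ne_zero hNf.index_ne_zero
  let W := augSubmodule ρ N
  have hW : ∀ s : S, W ≤ W.comap (ρ s) := fun s => augSubmodule_le_comap ρ fun n hn =>
    (Subgroup.mem_normalizer_iff.mp s.2 n).mp hn
  let ρS : S →* Module.End (ZMod p) (V ⧸ W) :=
    { toFun := fun s => W.mapQ W (ρ s) (hW s)
      map_one' := by
        ext v
        simp
      map_mul' := fun s t => by
        ext v
        simp }
  let ρQ : (S ⧸ N') →* Module.End (ZMod p) (V ⧸ W) := QuotientGroup.lift N' ρS fun n hn => by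
    ext v
    exact (Submodule.Quotient.eq _).mpr (sub_mem_augSubmodule ρ hn v)
  have hρQ : ∀ (s : S) (v : V), ρQ (QuotientGroup.mk s) (W.mkQ v) = W.mkQ (ρ s v) :=
    fun _ _ => rfl
  have hU : Nontrivial (V ⧸ W) := Submodule.Quotient.nontrivial_iff.mpr hNt
  obtain ⟨A, hA0, hAf, hA⟩ := exists_augSubmodule_ne_top_of_infinite
    ((hQ.top_subgroup S).top_of_surjective (QuotientGroup.mk' N') (QuotientGroup.mk'_surjective N'))
    ρQ (by
      obtain ⟨F, hF⟩ := hfg.restrict S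
      refine ⟨F.image W.mkQ, ?_⟩
      have h1 := congrArg (Submodule.map W.mkQ) hF
      rw [Submodule.map_top, Submodule.range_mkQ, ← Submodule.span_image] at h1
      refine top_le_iff.mp (h1.ge.trans (span_mono ?_))
      rintro _ ⟨_, ⟨g, x, hx, rfl⟩, rfl⟩
      exact ⟨QuotientGroup.mk g, W.mkQ x, Finset.mem_image_of_mem _ hx, rfl⟩) (by
      obtain ⟨m, hm⟩ := hendo
      refine ⟨W.mkQ m, fun v => ?_⟩
      obtain ⟨v, rfl⟩ := W.mkQ_surjective v
      obtain ⟨φ, hφ, hv⟩ := hm v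
      refine ⟨W.mapQ W φ (augSubmodule_le_comap_of_comm ρ hφ), fun g w => ?_, ?_⟩
      · obtain ⟨s, rfl⟩ := QuotientGroup.mk_surjective g
        obtain ⟨w, rfl⟩ := W.mkQ_surjective w
        exact congrArg W.mkQ (hφ s w)
      · exact congrArg W.mkQ hv)
  let N₁ : Subgroup Q := (A.comap (QuotientGroup.mk' N')).map S.subtype
  have hle : N ≤ N₁ := fun n hn => ⟨⟨n, Subgroup.le_normalizer hn⟩, by
    change (QuotientGroup.mk (⟨n, _⟩ : S) : S ⧸ N') ∈ A
    rw [(QuotientGroup.eq_one_iff _).mpr (show (⟨n, _⟩ : S) ∈ N' from hn)]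
    exact A.one_mem, rfl⟩
  have heq := hmax N₁ ⟨?_, ?_⟩ hle
  · refine hA0 ((Subgroup.eq_bot_iff_forall _).mpr fun a ha => ?_)
    obtain ⟨s, rfl⟩ := QuotientGroup.mk_surjective a
    have h1 : (s : Q) ∈ N₁ := ⟨s, ha, rfl⟩
    rw [heq] at h1
    exact (QuotientGroup.eq_one_iff _).mpr h1
  · refine finiteIndex_normalizer_of_le
      (S := ((Subgroup.normalizer (A : Set (S ⧸ N'))).comap (QuotientGroup.mk' N')).map S.subtype)
      ?_ ?_
    · rw [Subgroup.index_map_subtype,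
        Subgroup.index_comap_of_surjective _ (QuotientGroup.mk'_surjective N')]
      exact mul_ne_zero hAf.index_ne_zero hNf.index_ne_zero
    · rintro _ ⟨s, hs, rfl⟩ _ ⟨a, ha, rfl⟩
      exact ⟨s * a * s⁻¹, (Subgroup.mem_normalizer_iff.mp hs _).mp ha, rfl⟩
  · intro htop
    refine hA (top_le_iff.mp ?_)
    rw [← W.range_mkQ, ← Submodule.map_top, ← htop, augSubmodule, Submodule.map_span, span_le]
    rintro _ ⟨_, ⟨_, ⟨s, hs, rfl⟩, w, rfl⟩, rfl⟩
    rw [map_sub]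
    exact sub_mem_augSubmodule ρQ hs (W.mkQ w)

end

end

section
variable {H : Type*} [Group H]

theorem exists_characteristic_le {T : Type*} [Group T] [hT : Group.FG T] (S : Subgroup T)
    [S.FiniteIndex] : ∃ K ≤ S, K.Characteristic ∧ K.FiniteIndex := by
  classical
  have hfin : Finite (T →* Equiv.Perm (T ⧸ S)) := by
    obtain ⟨F, hF⟩ := Group.fg_def.mp hT
    refine Finite.of_injective (fun (f : T →* Equiv.Perm (T ⧸ S)) (x : F) => f x) fun f g h => ?_
    exact MonoidHom.eq_of_eqOn_dense hF fun x hx => congrFun h ⟨x, hx⟩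
  refine ⟨⨅ f : T →* Equiv.Perm (T ⧸ S), f.ker, ?_, ?_, ?_⟩
  · refine (iInf_le _ (MulAction.toPermHom T (T ⧸ S))).trans ?_
    rw [← Subgroup.normalCore_eq_ker]
    exact S.normalCore_le
  · rw [Subgroup.characteristic_iff_le_comap]
    intro φ x hx
    rw [Subgroup.mem_comap, Subgroup.mem_iInf]
    intro f
    exact Subgroup.mem_iInf.mp hx (f.comp φ.toMonoidHom)
  · exact Subgroup.finiteIndex_iInf fun f => inferInstance

/-- The subgroup generated by a subgroup and an element normalising it. -/
def zpowExt (S : Subgroup H) (u : H) (hu : u ∈ Subgroup.normalizer (S : Set H)) : Subgroup H where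
  carrier := {y | ∃ j : ℤ, y * u ^ j ∈ S}
  one_mem' := ⟨0, by simp⟩
  mul_mem' := by
    rintro a b ⟨i, hi⟩ ⟨j, hj⟩
    refine ⟨j + i, ?_⟩
    have h1 := (Subgroup.mem_normalizer_iff.mp (zpow_mem hu (-i)) _).mp hj
    convert mul_mem hi h1 using 1
    group
  inv_mem' := by
    rintro a ⟨i, hi⟩
    refine ⟨-i, ?_⟩
    have h1 := (Subgroup.mem_normalizer_iff.mp (zpow_mem hu i) _).mp (inv_mem hi)
    convert h1 using 1
    group

theorem le_zpowExt {S : Subgroup H} {u : H} {hu : u ∈ Subgroup.normalizer (S : Set H)} :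
    S ≤ zpowExt S u hu := fun y hy => ⟨0, by simpa using hy⟩

theorem self_mem_zpowExt {S : Subgroup H} {u : H} {hu : u ∈ Subgroup.normalizer (S : Set H)} :
    u ∈ zpowExt S u hu := ⟨-1, by simp⟩

/-- Polycyclic groups are residually finite. -/
theorem Reach.exists_relIndex_ne_zero_notMem {T : Subgroup H} (hT : Reach T) :
    ∀ x ∈ T, x ≠ 1 → ∃ S : Subgroup H, S.relIndex T ≠ 0 ∧ x ∉ S := by
  induction hT with
  | bot => exact fun x hx h => absurd hx h
  | @step T T' hT h2 ih =>
    intro x hx hx1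
    obtain ⟨hTT, hn, t, ht, htk⟩ := h2
    have hnorm : ∀ u ∈ T', u ∈ Subgroup.normalizer (T : Set H) := fun u hu =>
      Subgroup.mem_normalizer_iff.mpr fun y => ⟨hn u hu y, fun hy => by
        simpa [mul_assoc] using hn u⁻¹ (inv_mem hu) _ hy⟩
    by_cases hfin : ∃ k : ℕ, 0 < k ∧ t ^ k ∈ T
    · obtain ⟨k, hk, htT⟩ := hfin
      have hTi : T.relIndex T' ≠ 0 :=
        relIndex_ne_zero_of_cyclic (S := T) (T := T) (by simp) le_rfl ht hn htk hk htT
      by_cases hxT : x ∈ T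
      · obtain ⟨S, hS, hxS⟩ := ih x hxT hx1
        refine ⟨S ⊓ T, ?_, fun h => hxS h.1⟩
        rw [← Subgroup.relIndex_mul_relIndex (S ⊓ T) T T' inf_le_right hTT,
          Subgroup.inf_relIndex_right]
        exact mul_ne_zero hS hTi
      · exact ⟨T, hTi, hxT⟩
    · have hz : ∀ j : ℤ, t ^ j ∈ T → j = 0 := fun j hj => by
        by_contra hj0
        refine hfin ⟨j.natAbs, Int.natAbs_pos.mpr hj0, ?_⟩
        rcases Int.natAbs_eq j with h | h
        · rw [h, zpow_natCast] at hj
          exact hj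
        · rw [h, zpow_neg, inv_mem_iff, zpow_natCast] at hj
          exact hj
      by_cases hxT : x ∈ T
      · obtain ⟨S, hS, hxS⟩ := ih x hxT hx1
        have : Group.FG T := (Group.fg_iff_subgroup_fg T).mpr hT.fg
        have : (S.subgroupOf T).FiniteIndex := ⟨hS⟩
        obtain ⟨K, hK, hKc, hKf⟩ := exists_characteristic_le (S.subgroupOf T)
        have hu : t ∈ Subgroup.normalizer (K.map T.subtype : Set H) := by
          have hs : ∀ u ∈ T', ∀ y ∈ K.map T.subtype, u * y * u⁻¹ ∈ K.map T.subtype := by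
            rintro u hu _ ⟨y, hy, rfl⟩
            let φ : MulAut T := Subgroup.normalizerMonoidHom T ⟨u, hnorm u hu⟩
            exact ⟨φ y, (Subgroup.characteristic_iff_le_comap.mp hKc φ) hy, rfl⟩
          exact Subgroup.mem_normalizer_iff.mpr fun y => ⟨hs t ht y, fun hy => by
            simpa [mul_assoc] using hs t⁻¹ (inv_mem ht) _ hy⟩
        refine ⟨zpowExt (K.map T.subtype) t hu, ?_, ?_⟩
        · refine relIndex_ne_zero_of_cyclic (S := K.map T.subtype) (T := T) (k := 1) ?_ le_zpowExt
            ht hn htk one_pos (by simpa using self_mem_zpowExt)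
          rw [Subgroup.relIndex, Subgroup.subgroupOf,
            Subgroup.comap_map_eq_self_of_injective T.subtype_injective]
          exact hKf.index_ne_zero
        · rintro ⟨j, y, hy, hyx⟩
          have h1 : t ^ j ∈ T := by
            have := mul_mem (inv_mem hxT) y.2
            rw [← Subgroup.subtype_apply, hyx] at this
            simpa using this
          rw [hz j h1, zpow_zero, mul_one] at hyx
          exact hxS (hyx ▸ Subgroup.mem_subgroupOf.mp (hK hy))
      · obtain ⟨k, hk⟩ := htk x hx
        have hk0 : k ≠ 0 := by
          rintro rfl
          exact hxT (by simpa using hk)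
        refine ⟨zpowExt T (t ^ (2 * k)) (hnorm _ (zpow_mem ht _)), ?_, ?_⟩
        · refine relIndex_ne_zero_of_cyclic (S := T) (T := T) (k := (2 * k).natAbs) (by simp)
            le_zpowExt ht hn htk (by omega) ?_
          have h1 := self_mem_zpowExt (S := T) (u := t ^ (2 * k))
            (hu := hnorm _ (zpow_mem ht _))
          rcases Int.natAbs_eq (2 * k) with h | h
          · rw [← zpow_natCast, ← h]
            exact h1
          · rw [← zpow_natCast, ← inv_mem_iff, ← zpow_neg, ← h]
            exact h1
        · rintro ⟨j, hj⟩
          have h1 := mul_mem (inv_mem hk) hj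
          have h2 : (x * t ^ k)⁻¹ * (x * (t ^ (2 * k)) ^ j) = t ^ (2 * k * j - k) := by
            rw [← zpow_mul, sub_eq_neg_add, zpow_add]
            group
          rw [h2] at h1
          have h3 := hz _ h1
          have h4 : k * (2 * j - 1) = 0 := by linarith
          rcases mul_eq_zero.mp h4 with h | h
          · exact hk0 h
          · omega

end

section TraceIdeal
variable {R P : Type*} [Ring R] [AddCommGroup P] [Module R P]

theorem apply_mem_traceIdeal (f : P →ₗ[R] R) (x : P) : f x ∈ traceIdeal R P :=
  (le_iSup (fun f : P →ₗ[R] R => LinearMap.range f) f) ⟨x, rfl⟩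

theorem mul_mem_traceIdeal {x : R} (hx : x ∈ traceIdeal R P) (r : R) :
    x * r ∈ traceIdeal R P := by
  induction hx using Submodule.iSup_induction' with
  | mem f x hx =>
    obtain ⟨y, rfl⟩ := hx
    exact apply_mem_traceIdeal ((LinearMap.toSpanSingleton R R r).comp f) y
  | zero => rw [zero_mul]; exact zero_mem _
  | add x y _ _ hx hy => rw [add_mul]; exact add_mem hx hy

theorem exists_surjective_of_traceIdeal_eq_top (h : traceIdeal R P = ⊤) :
    ∃ (k : ℕ) (g : (Fin k → P) →ₗ[R] R), Function.Surjective g := by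
  have h1 : ∀ x ∈ traceIdeal R P, ∃ (k : ℕ) (g : (Fin k → P) →ₗ[R] R), x ∈ LinearMap.range g := by
    intro x hx
    induction hx using Submodule.iSup_induction' with
    | mem f x hx =>
      obtain ⟨y, rfl⟩ := hx
      exact ⟨1, f.comp (LinearMap.proj 0), fun _ => y, rfl⟩
    | zero => exact ⟨0, 0, zero_mem _⟩
    | add x y _ _ hx hy =>
      obtain ⟨k, f, a, rfl⟩ := hx
      obtain ⟨l, g, b, rfl⟩ := hy
      refine ⟨k + l, f.comp (LinearMap.funLeft R P (Fin.castAdd l)) +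
        g.comp (LinearMap.funLeft R P (Fin.natAdd k)), Fin.append a b, ?_⟩
      have ha : LinearMap.funLeft R P (Fin.castAdd l) (Fin.append a b) = a := by
        ext i
        simp [LinearMap.funLeft_apply]
      have hb : LinearMap.funLeft R P (Fin.natAdd k) (Fin.append a b) = b := by
        ext i
        simp [LinearMap.funLeft_apply]
      rw [LinearMap.add_apply, LinearMap.comp_apply, LinearMap.comp_apply, ha, hb]
  obtain ⟨k, g, hg⟩ := h1 1 (by rw [h]; trivial)
  exact ⟨k, g, LinearMap.range_eq_top.mp ((Ideal.eq_top_iff_one _).mpr hg)⟩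

/-- A nonzero finitely generated projective module is the image of a nonzero idempotent matrix with
entries in its trace ideal. -/
theorem exists_idempotent_matrix_mem_traceIdeal [Nontrivial P] [Module.Finite R P]
    [Module.Projective R P] : ∃ (n : ℕ) (e : Matrix (Fin n) (Fin n) R),
      e * e = e ∧ e ≠ 0 ∧ ∀ i j, e i j ∈ traceIdeal R P := by
  classical
  obtain ⟨n, f, g, hf, hg, hfg⟩ := Module.Finite.exists_comp_eq_id_of_projective R P
  have hsum : ∀ (v : Fin n → R) k, g (f v) k = ∑ j, v j * g (f (Pi.single j 1)) k := fun v k => by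
    conv_lhs => rw [pi_eq_sum_univ' v]
    simp only [map_sum, Finset.sum_apply, map_smul, Pi.smul_apply, smul_eq_mul]
  refine ⟨n, Matrix.of fun i j => g (f (Pi.single i 1)) j, ?_, fun h => ?_, fun i j =>
    apply_mem_traceIdeal ((LinearMap.proj j).comp g) _⟩
  · ext i k
    rw [Matrix.mul_apply]
    have h1 : f (g (f (Pi.single i 1))) = f (Pi.single i 1) := LinearMap.congr_fun hfg _
    have h2 := hsum (g (f (Pi.single i 1))) k
    rw [h1] at h2
    exact h2.symm
  · obtain ⟨x, hx⟩ := exists_ne (0 : P)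
    obtain ⟨v, rfl⟩ := hf x
    refine hx (hg ?_)
    ext k
    rw [hsum, map_zero, Pi.zero_apply]
    refine Finset.sum_eq_zero fun j _ => ?_
    have h3 : g (f (Pi.single j 1)) k = 0 := congrFun (congrFun h j) k
    rw [h3, mul_zero]

end TraceIdeal

section
variable {H : Type*} [Group H]

/-- A finitely generated endocyclic module for a polycyclic group is not divisible by some prime. -/
theorem exists_prime_smul_ne {V : Type*} [AddCommGroup V] [DistribMulAction H V] [Nontrivial V]
    (hH : Reach (⊤ : Subgroup H)) (F : Finset V)
    (hF : Submodule.span ℤ {v | ∃ h : H, ∃ x ∈ F, v = h • x} = ⊤) (m : V)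
    (hm : ∀ v, ∃ φ : V →+ V, φ m = v) : ∃ p : ℕ, p.Prime ∧ ∃ v : V, ∀ w, p • w ≠ v := by
  let _ : MulSemiringAction H ℤ :=
    { smul := fun _ b => b
      one_smul := fun _ => rfl
      mul_smul := fun _ _ _ => rfl
      smul_zero := fun _ => rfl
      smul_add := fun _ _ _ => rfl
      smul_one := fun _ => rfl
      smul_mul := fun _ _ _ => rfl }
  have hsm : ∀ (h : H) (b : ℤ), h • b = b := fun _ _ => rfl
  have : SemilinAct H ℤ V := ⟨fun h b v => by
    rw [hsm]
    exact map_zsmul (DistribSMul.toAddMonoidHom V h) b v⟩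
  by_cases htor : ∀ b : ℤ, b ≠ 0 → b • m ≠ 0
  · obtain ⟨f, hf, hL⟩ := exists_smul_top_ne_top (H := H) (B := ℤ) hH F (by
      rw [gen, ← hF]
      simp only [Subgroup.mem_top, true_and]) m htor
    obtain ⟨p, hpf, hp⟩ := Nat.exists_infinite_primes (f.natAbs + 1)
    refine ⟨p, hp, ?_⟩
    by_contra! hcon
    refine hL (Ideal.span {(p : ℤ)}) ?_ (fun h => ?_) ?_
    · rw [Ideal.span_singleton_prime (by exact_mod_cast hp.ne_zero)]
      exact Nat.prime_iff_prime_int.mp hp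
    · rw [hsm, Ideal.mem_span_singleton]
      intro hdvd
      have h1 := Nat.le_of_dvd (Int.natAbs_pos.mpr hf) (Int.natCast_dvd.mp hdvd)
      omega
    · rw [eq_top_iff]
      intro v _
      obtain ⟨w, rfl⟩ := hcon v
      rw [← natCast_zsmul]
      exact Submodule.smul_mem_smul (Ideal.mem_span_singleton_self _) trivial
  · push Not at htor
    obtain ⟨b, hb, hbm⟩ := htor
    by_contra! hcon
    have hall : ∀ n : ℕ, n ≠ 0 → ∀ v : V, ∃ w, n • w = v := by
      intro n
      induction n using induction_on_primes with
      | zero => exact fun h => absurd rfl h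
      | one => exact fun _ v => ⟨v, one_smul _ _⟩
      | prime_mul p a hp ih =>
        intro hpa v
        obtain ⟨w, rfl⟩ := hcon p hp v
        obtain ⟨u, rfl⟩ := ih (right_ne_zero_of_mul hpa) w
        exact ⟨u, mul_smul _ _ _⟩
    obtain ⟨v, hv⟩ := exists_ne (0 : V)
    obtain ⟨w, rfl⟩ := hall b.natAbs (Int.natAbs_ne_zero.mpr hb) v
    obtain ⟨φ, rfl⟩ := hm w
    refine hv ?_
    rw [← map_nsmul]
    rcases Int.natAbs_eq b with h | h
    · rw [← natCast_zsmul, ← h, hbm, map_zero]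
    · rw [← natCast_zsmul, ← neg_neg (b.natAbs : ℤ), ← h, neg_zsmul, hbm, neg_zero, map_zero]

theorem exists_finiteIndex_notMem {N : Subgroup H} [N.FiniteIndex]
    (hN : Reach (⊤ : Subgroup N)) (x : H) (hx : x ≠ 1) :
    ∃ S : Subgroup H, S.FiniteIndex ∧ x ∉ S := by
  by_cases hxN : x ∈ N
  · obtain ⟨S, hS, hxS⟩ := hN.exists_relIndex_ne_zero_notMem ⟨x, hxN⟩ trivial
      (fun h => hx (congrArg Subtype.val h))
    rw [Subgroup.relIndex_top_right] at hS
    refine ⟨S.map N.subtype, ⟨?_⟩, ?_⟩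
    · rw [Subgroup.index_map_subtype]
      exact mul_ne_zero hS Subgroup.FiniteIndex.index_ne_zero
    · rintro ⟨y, hy, rfl⟩
      exact hxS hy
  · exact ⟨N, inferInstance, hxN⟩

theorem exists_normal_mapDomain_ne_zero {k : Type*} [Semiring k] {N : Subgroup H} [N.FiniteIndex]
    (hN : Reach (⊤ : Subgroup N)) {S : Subgroup H} [S.FiniteIndex] {a : MonoidAlgebra k H}
    (ha : a ≠ 0) : ∃ (K : Subgroup H) (_ : K.Normal), K.FiniteIndex ∧ K ≤ S ∧
      MonoidAlgebra.mapDomainRingHom k (QuotientGroup.mk' K) a ≠ 0 := by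
  classical
  have h1 : ∀ x : H, ∃ S : Subgroup H, S.FiniteIndex ∧ (x ∈ S → x = 1) := fun x => by
    by_cases hx : x = 1
    · exact ⟨⊤, inferInstance, fun _ => hx⟩
    · obtain ⟨S, hS, hxS⟩ := exists_finiteIndex_notMem hN x hx
      exact ⟨S, hS, fun h => absurd h hxS⟩
  choose U hU hU' using h1
  let X := a.coeff.support
  let K₀ : Subgroup H := S ⊓ ⨅ q : X × X, U (q.1.1⁻¹ * q.2.1)
  have hf : (⨅ q : X × X, U (q.1.1⁻¹ * q.2.1)).FiniteIndex := Subgroup.finiteIndex_iInf fun q => hU _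
  have hK₀ : K₀.FiniteIndex := inferInstance
  refine ⟨K₀.normalCore, inferInstance, inferInstance, K₀.normalCore_le.trans inf_le_left, ?_⟩
  have hinj : Set.InjOn (QuotientGroup.mk' K₀.normalCore) (X : Set H) := fun x hx y hy hxy => by
    have h2 := K₀.normalCore_le (QuotientGroup.eq.mp hxy)
    exact inv_mul_eq_one.mp (hU' _ (Subgroup.mem_iInf.mp h2.2 (⟨x, hx⟩, ⟨y, hy⟩)))
  obtain ⟨g, hg⟩ : X.Nonempty := by
    rw [Finsupp.support_nonempty_iff]
    exact fun h => ha (MonoidAlgebra.coeff_injective h)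
  intro h0
  have h2 : Finsupp.mapDomain (QuotientGroup.mk' K₀.normalCore) a.coeff
      (QuotientGroup.mk' K₀.normalCore g) = a.coeff g :=
    Finsupp.mapDomain_apply' (X : Set H) a.coeff subset_rfl hinj hg
  have h3 : Finsupp.mapDomain (QuotientGroup.mk' K₀.normalCore) a.coeff = 0 :=
    congrArg MonoidAlgebra.coeff h0
  rw [h3] at h2
  exact (Finsupp.mem_support_iff.mp hg) h2.symm

end

theorem idempotent_eq_zero_of_finite_rep {n Γ V : Type*} [Fintype n] [DecidableEq n] [Group Γ]
    [Finite Γ] {p : ℕ} [Fact p.Prime] [AddCommGroup V] [Module (ZMod p) V] [Nontrivial V]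
    [Module.Finite (ZMod p) V] (σ : Γ →* Module.End (ZMod p) V) {e : Matrix n n (MonoidAlgebra ℤ Γ)}
    (he : e * e = e) (hσ : ∀ i j, MonoidAlgebra.lift ℤ (Module.End (ZMod p) V) Γ σ (e i j) = 0) :
    e = 0 := by
  let b := Module.finBasis (ZMod p) V
  let Φ : Module.End (ZMod p) V →ₐ[ZMod p] Matrix _ _ (ZMod p) :=
    (LinearMap.toMatrixAlgEquiv b).toAlgHom
  have : Nonempty (Fin (Module.finrank (ZMod p) V)) := ⟨⟨0, Module.finrank_pos⟩⟩
  refine idempotent_eq_zero_of_lift_eq_zero Fact.out (Φ.toRingHom.toMonoidHom.comp σ) he fun i j => ?_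
  have h1 : ∀ a : MonoidAlgebra ℤ Γ, MonoidAlgebra.lift ℤ (Matrix _ _ (ZMod p)) Γ
      (Φ.toRingHom.toMonoidHom.comp σ) a =
        Φ (MonoidAlgebra.lift ℤ (Module.End (ZMod p) V) Γ σ a) := fun a => by
    induction a using MonoidAlgebra.induction_linear with
    | zero => simp only [map_zero]
    | add a b ha hb => simp only [map_add, ha, hb]
    | single g c =>
      rw [MonoidAlgebra.lift_single, MonoidAlgebra.lift_single, map_zsmul]
      rfl
  rw [h1, hσ, map_zero]

section
variable {G : Type*} [Group G]

theorem smul_eq_zero_imp_idempotent_eq_zero_of_char {N : Subgroup G} [N.FiniteIndex]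
    (hN : Reach (⊤ : Subgroup N)) {p : ℕ} [Fact p.Prime] {V : Type*} [AddCommGroup V]
    [Module (ZMod p) V] [Module (MonoidAlgebra ℤ G) V] [Nontrivial V] {m : V}
    (hspan : Submodule.span (MonoidAlgebra ℤ G) {m} = ⊤)
    (hm : ∀ v : V, ∃ φ : V →ₗ[MonoidAlgebra ℤ G] V, φ m = v) {n : Type*} [Fintype n]
    [DecidableEq n] {e : Matrix n n (MonoidAlgebra ℤ G)} (he : e * e = e)
    (heV : ∀ i j (v : V), e i j • v = 0) : e = 0 := by
  classical
  let ρ : G →* Module.End (ZMod p) V :=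
    { toFun := fun g =>
        { toFun := fun v => (MonoidAlgebra.single g 1 : MonoidAlgebra ℤ G) • v
          map_add' := smul_add _
          map_smul' := ZMod.map_smul (DistribSMul.toAddMonoidHom V
            (MonoidAlgebra.single g 1 : MonoidAlgebra ℤ G)) }
      map_one' := by
        refine LinearMap.ext fun v => ?_
        rw [Module.End.one_apply]
        exact one_smul (MonoidAlgebra ℤ G) v
      map_mul' := fun g h => by
        ext v
        change (MonoidAlgebra.single (g * h) 1 : MonoidAlgebra ℤ G) • v =
          (MonoidAlgebra.single g 1 : MonoidAlgebra ℤ G) •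
            (MonoidAlgebra.single h 1 : MonoidAlgebra ℤ G) • v
        rw [← mul_smul, MonoidAlgebra.single_mul_single, one_mul] }
  have hρ : ∀ g v, ρ g v = (MonoidAlgebra.single g 1 : MonoidAlgebra ℤ G) • v := fun _ _ => rfl
  have hfg : IsFGRep ρ := by
    refine ⟨{m}, eq_top_iff.mpr fun v _ => ?_⟩
    obtain ⟨r, rfl⟩ := Submodule.mem_span_singleton.mp
      (show v ∈ Submodule.span (MonoidAlgebra ℤ G) {m} by rw [hspan]; trivial)
    induction r using MonoidAlgebra.induction_linear with
    | zero => rw [zero_smul]; exact zero_mem _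
    | add x y hx hy => rw [add_smul]; exact add_mem (hx trivial) (hy trivial)
    | single g c =>
      have h1 : (MonoidAlgebra.single g c : MonoidAlgebra ℤ G) • m = c • ρ g m := by
        rw [hρ, ← smul_assoc, MonoidAlgebra.smul_single, smul_eq_mul, mul_one]
      rw [h1]
      refine zsmul_mem (Submodule.subset_span ?_) c
      exact ⟨g, m, by simp, rfl⟩
  obtain ⟨N₁, hN₁, hne⟩ := exists_finiteIndex_augSubmodule_ne_top hN (ρ.comp N.subtype)
    (hfg.restrict N) ⟨m, fun v => by
      obtain ⟨φ, hφ⟩ := hm v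
      exact ⟨φ.toAddMonoidHom.toZModLinearMap p, fun g w => φ.map_smul _ w, hφ⟩⟩
  by_contra he0
  obtain ⟨i, j, hij⟩ : ∃ i j, e i j ≠ 0 := by
    by_contra! h
    exact he0 (Matrix.ext h)
  have hN₁' : (N₁.map N.subtype).FiniteIndex := ⟨by
    rw [Subgroup.index_map_subtype]
    exact mul_ne_zero hN₁.index_ne_zero Subgroup.FiniteIndex.index_ne_zero⟩
  obtain ⟨K, hKn, hKf, hK, hKe⟩ :=
    exists_normal_mapDomain_ne_zero hN (S := N₁.map N.subtype) hij
  let W := augSubmodule ρ K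
  have hW : W ≠ ⊤ := by
    refine fun h => hne (top_le_iff.mp (h.ge.trans (Submodule.span_le.mpr ?_)))
    rintro _ ⟨k, hk, w, rfl⟩
    obtain ⟨l, hl, rfl⟩ := hK hk
    exact Submodule.subset_span ⟨l, hl, w, rfl⟩
  have hWs : ∀ g, W ≤ W.comap (ρ g) := fun g => augSubmodule_le_comap ρ fun k hk =>
    hKn.conj_mem k hk g
  let ρW : G →* Module.End (ZMod p) (V ⧸ W) :=
    { toFun := fun g => W.mapQ W (ρ g) (hWs g)
      map_one' := by
        ext v
        simp
      map_mul' := fun s t => by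
        ext v
        simp }
  let σ : (G ⧸ K) →* Module.End (ZMod p) (V ⧸ W) := QuotientGroup.lift K ρW fun k hk => by
    ext v
    exact (Submodule.Quotient.eq _).mpr (sub_mem_augSubmodule ρ hk v)
  have hσ : ∀ (g : G) (v : V), σ (QuotientGroup.mk' K g) (W.mkQ v) = W.mkQ (ρ g v) :=
    fun _ _ => rfl
  have hnt : Nontrivial (V ⧸ W) := Submodule.Quotient.nontrivial_iff.mpr hW
  have hfin : Finite (G ⧸ K) := inferInstance
  have hfd : Module.Finite (ZMod p) (V ⧸ W) := by
    obtain ⟨F, hF⟩ := hfg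
    have hs : (Set.image2 (fun (g : G ⧸ K) (v : V) => σ g (W.mkQ v)) Set.univ F).Finite :=
      Set.Finite.image2 _ Set.finite_univ F.finite_toSet
    refine ⟨Submodule.fg_def.mpr ⟨_, hs, ?_⟩⟩
    have h1 := congrArg (Submodule.map W.mkQ) hF
    rw [Submodule.map_top, Submodule.range_mkQ, ← Submodule.span_image] at h1
    refine top_le_iff.mp (h1.ge.trans (Submodule.span_mono ?_))
    rintro _ ⟨_, ⟨g, x, hx, rfl⟩, rfl⟩
    exact ⟨QuotientGroup.mk g, trivial, x, hx, rfl⟩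
  let π := MonoidAlgebra.mapDomainRingHom ℤ (QuotientGroup.mk' K)
  have hlift : ∀ (r : MonoidAlgebra ℤ G) (v : V),
      MonoidAlgebra.lift ℤ _ _ σ (π r) (W.mkQ v) = W.mkQ (r • v) := by
    intro r v
    induction r using MonoidAlgebra.induction_linear with
    | zero => simp
    | add x y hx hy => rw [map_add, map_add, LinearMap.add_apply, hx, hy, add_smul, map_add]
    | single g c =>
      have h1 : π (MonoidAlgebra.single g c) = MonoidAlgebra.single (QuotientGroup.mk' K g) c :=
        MonoidAlgebra.mapDomain_single
      have h2 : (MonoidAlgebra.single g c : MonoidAlgebra ℤ G) • v = c • ρ g v := by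
        rw [hρ, ← smul_assoc, MonoidAlgebra.smul_single, smul_eq_mul, mul_one]
      rw [h1, h2, MonoidAlgebra.lift_single, map_zsmul, LinearMap.smul_apply, hσ]
  have h0 : e.map π = 0 := by
    refine idempotent_eq_zero_of_finite_rep σ (e := e.map π) (by rw [← Matrix.map_mul, he])
      fun k l => LinearMap.ext fun v => ?_
    obtain ⟨v, rfl⟩ := W.mkQ_surjective v
    rw [Matrix.map_apply, hlift, heV, map_zero, LinearMap.zero_apply]
  exact hKe (congrFun (congrFun h0 i) j)

theorem smul_eq_zero_imp_idempotent_eq_zero {N : Subgroup G} [N.FiniteIndex]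
    (hN : Reach (⊤ : Subgroup N)) {V : Type*} [AddCommGroup V]
    [Module (MonoidAlgebra ℤ G) V] [Nontrivial V] {m : V}
    (hspan : Submodule.span (MonoidAlgebra ℤ G) {m} = ⊤)
    (hm : ∀ v : V, ∃ φ : V →ₗ[MonoidAlgebra ℤ G] V, φ m = v) {n : Type*} [Fintype n]
    [DecidableEq n] {e : Matrix n n (MonoidAlgebra ℤ G)} (he : e * e = e)
    (heV : ∀ i j (v : V), e i j • v = 0) : e = 0 := by
  classical
  let _ : DistribMulAction N V :=
    DistribMulAction.compHom V ((MonoidAlgebra.of ℤ G).comp N.subtype)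
  have hsm : ∀ (g : N) (v : V), g • v = (MonoidAlgebra.single (g : G) 1 : MonoidAlgebra ℤ G) • v :=
    fun _ _ => rfl
  obtain ⟨R, -, hR⟩ := exists_finset_of_relIndex_ne_zero (S := N) (T := ⊤)
    (by rw [Subgroup.relIndex_top_right]; exact Subgroup.FiniteIndex.index_ne_zero)
  obtain ⟨p, hp, v₀, hv₀⟩ := exists_prime_smul_ne hN
    (R.image fun r => (MonoidAlgebra.single r⁻¹ 1 : MonoidAlgebra ℤ G) • m) (by
      refine eq_top_iff.mpr fun v _ => ?_
      obtain ⟨r, rfl⟩ := Submodule.mem_span_singleton.mp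
        (show v ∈ Submodule.span (MonoidAlgebra ℤ G) {m} by rw [hspan]; trivial)
      induction r using MonoidAlgebra.induction_linear with
      | zero => rw [zero_smul]; exact zero_mem _
      | add x y hx hy => rw [add_smul]; exact add_mem (hx trivial) (hy trivial)
      | single g c =>
        obtain ⟨r, hr, hrg⟩ := hR g⁻¹ (Subgroup.mem_top _)
        have h1 : (MonoidAlgebra.single g c : MonoidAlgebra ℤ G) • m =
            c • ((⟨_, N.inv_mem hrg⟩ : N) •
              (MonoidAlgebra.single r⁻¹ 1 : MonoidAlgebra ℤ G) • m) := by
          rw [hsm, ← mul_smul, MonoidAlgebra.single_mul_single, ← smul_assoc,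
            MonoidAlgebra.smul_single, smul_eq_mul, mul_one, mul_one]
          congr 2
          group
        rw [h1]
        refine zsmul_mem (Submodule.subset_span ?_) c
        exact ⟨_, _, Finset.mem_image_of_mem _ hr, rfl⟩) m (fun v => by
      obtain ⟨φ, hφ⟩ := hm v
      exact ⟨φ.toAddMonoidHom, hφ⟩)
  have : Fact p.Prime := ⟨hp⟩
  let W : Submodule (MonoidAlgebra ℤ G) V := LinearMap.range (p • LinearMap.id)
  have hW : Nontrivial (V ⧸ W) := Submodule.Quotient.nontrivial_iff.mpr fun h => by
    obtain ⟨w, hw⟩ : v₀ ∈ W := by rw [h]; trivial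
    exact hv₀ w hw
  let _ : Module (ZMod p) (V ⧸ W) := AddCommGroup.zmodModule fun v => by
    obtain ⟨v, rfl⟩ := W.mkQ_surjective v
    rw [← map_nsmul]
    exact (Submodule.Quotient.mk_eq_zero W).mpr ⟨v, rfl⟩
  refine smul_eq_zero_imp_idempotent_eq_zero_of_char hN (p := p) (V := V ⧸ W) (m := W.mkQ m)
    ?_ ?_ he ?_
  · rw [← Set.image_singleton, ← Submodule.map_span, hspan, Submodule.map_top, Submodule.range_mkQ]
  · intro v
    obtain ⟨v, rfl⟩ := W.mkQ_surjective v
    obtain ⟨φ, rfl⟩ := hm v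
    refine ⟨W.mapQ W φ ?_, rfl⟩
    rintro _ ⟨w, rfl⟩
    exact ⟨φ w, (map_nsmul φ p w).symm⟩
  · intro i j v
    obtain ⟨v, rfl⟩ := W.mkQ_surjective v
    rw [← map_smul, heV, map_zero]

end

/-- **Proposition** (Linnell–Puninski–Smith).  Every nonzero finitely generated
projective module over the integral group ring of a polycyclic-by-finite group
is a generator: its trace ideal is all of `ℤG`, equivalently some finite power
of it maps `ℤG`-linearly onto `ℤG`. -/
theorem fg_projective_is_generator (G : Type*) [Group G]
    (hG : IsPolycyclicByFinite G) (P : Type*) [AddCommGroup P]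
    [Module (MonoidAlgebra ℤ G) P] (hnz : Nontrivial P)
    (hfg : Module.Finite (MonoidAlgebra ℤ G) P)
    (hproj : Module.Projective (MonoidAlgebra ℤ G) P) :
    traceIdeal (MonoidAlgebra ℤ G) P = ⊤ ∧
    ∃ (k : ℕ) (g : (Fin k → P) →ₗ[MonoidAlgebra ℤ G] MonoidAlgebra ℤ G),
      Function.Surjective g := by
  obtain ⟨N, _, hNf, hN⟩ := hG
  have key : traceIdeal (MonoidAlgebra ℤ G) P = ⊤ := by
    by_contra htop
    set I := traceIdeal (MonoidAlgebra ℤ G) P with hI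
    obtain ⟨n, e, he, he0, heI⟩ :=
      exists_idempotent_matrix_mem_traceIdeal (R := MonoidAlgebra ℤ G) (P := P)
    have hV : Nontrivial (MonoidAlgebra ℤ G ⧸ I) := Submodule.Quotient.nontrivial_iff.mpr htop
    refine he0 (smul_eq_zero_imp_idempotent_eq_zero hN.reach (V := MonoidAlgebra ℤ G ⧸ I)
      (m := Submodule.mkQ I 1) ?_ ?_ he ?_)
    · rw [← Set.image_singleton, ← Submodule.map_span, ← Ideal.span, Ideal.span_singleton_one,
        Submodule.map_top, Submodule.range_mkQ]
    · intro v
      obtain ⟨r, rfl⟩ := Submodule.mkQ_surjective I v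
      refine ⟨Submodule.mapQ I I (LinearMap.toSpanSingleton _ _ r) fun x hx =>
        mul_mem_traceIdeal hx r, ?_⟩
      exact congrArg (Submodule.mkQ I) (one_mul r)
    · intro i j v
      obtain ⟨r, rfl⟩ := Submodule.mkQ_surjective I v
      rw [← map_smul]
      exact (Submodule.Quotient.mk_eq_zero I).mpr (mul_mem_traceIdeal (heI i j) r)
  exact ⟨key, exists_surjective_of_traceIdeal_eq_top key⟩
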